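/- Let 𝔽 be a finite field with q elements and n ≥ 1. The number of isomorphism classes of cuspidal representations of GL_n(𝔽) equals (1/n) · Σ_{d | n} μ(d) (q^{n/d} − 1), where μ is the Möbius function. (This reflects Green's parametrization of cuspidal representations of GL_n(F_q) by regular characters of F_{q^n}^× up to the action of Gal(F_{q^n}/F_q).) -/

import Mathlib

open Matrix CategoryTheory

set_option synthInstance.maxHeartbeats 1000000
set_option maxHeartbeats 1000000

/-- A submodule `W` is invariant under a representation `ρ` if `ρ g` maps `W` into
itself for every `g`. -/
def RepInvariant {G V : Type*} [Group G] [AddCommGroup V] [Module ℂ V]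
    (ρ : Representation ℂ G V) (W : Submodule ℂ V) : Prop :=
  ∀ g : G, ∀ v ∈ W, ρ g v ∈ W

/-- A representation is irreducible if the underlying space is nonzero and its only
invariant subspaces are `⊥` and `⊤`. -/
def IsIrreducibleRep {G V : Type*} [Group G] [AddCommGroup V] [Module ℂ V]
    (ρ : Representation ℂ G V) : Prop :=
  (⊥ : Submodule ℂ V) ≠ ⊤ ∧ ∀ W : Submodule ℂ V, RepInvariant ρ W → W = ⊥ ∨ W = ⊤

/-- `u ∈ GL_m(𝔽)` is block upper-triangular unipotent of type `(r, m - r)`, i.e. of the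
form `[[I_r, X], [0, I_{m-r}]]`: its diagonal entries are `1` and its off-diagonal
entries vanish outside the top-right `r × (m - r)` block. -/
def IsBlockUnipotent {𝔽 : Type*} [Field 𝔽] {m : ℕ} (r : ℕ) (u : GL (Fin m) 𝔽) : Prop :=
  (∀ i : Fin m, (u : Matrix (Fin m) (Fin m) 𝔽) i i = 1) ∧
    ∀ i j : Fin m, i ≠ j → ¬((i : ℕ) < r ∧ r ≤ (j : ℕ)) →
      (u : Matrix (Fin m) (Fin m) 𝔽) i j = 0

/-- A finite-dimensional complex representation `ρ` of `GL_m(𝔽)` is cuspidal if it is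
irreducible and, for every `0 < r < m`, the only vector fixed by `ρ u` for all block
upper-triangular unipotent matrices `u = [[I_r, X], [0, I_{m-r}]]` is zero. -/
def IsCuspidal {𝔽 : Type*} [Field 𝔽] {m : ℕ} {V : Type*} [AddCommGroup V] [Module ℂ V]
    (ρ : Representation ℂ (GL (Fin m) 𝔽) V) : Prop :=
  IsIrreducibleRep ρ ∧
    ∀ r : ℕ, 0 < r → r < m →
      ∀ v : V, (∀ u : GL (Fin m) 𝔽, IsBlockUnipotent r u → ρ u v = v) → v = 0

/-- The setoid identifying isomorphic cuspidal finite-dimensional complex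
representations of `GL_n(𝔽)`. -/
def cuspidalSetoid (𝔽 : Type) [Field 𝔽] (n : ℕ) :
    Setoid {V : FDRep ℂ (GL (Fin n) 𝔽) // IsCuspidal V.ρ} where
  r V W := Nonempty (V.1 ≅ W.1)
  iseqv := ⟨fun V => ⟨Iso.refl _⟩, fun ⟨e⟩ => ⟨e.symm⟩, fun ⟨e⟩ ⟨f⟩ => ⟨e.trans f⟩⟩

namespace GLCuspidal

section Counting

/-- A graded set `X` on which the elements of `ι` act by commuting injective maps of positive
degree, in such a way that `X` is the free commutative monoid on `ι`. -/
structure FreeAction (X ι : Type) where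
  deg : X → ℕ
  wt : ι → ℕ
  act : ι → X → X
  wt_pos : ∀ i, 1 ≤ wt i
  deg_act : ∀ i x, deg (act i x) = wt i + deg x
  inj : ∀ i, Function.Injective (act i)
  comm : ∀ i j x, act i (act j x) = act j (act i x)
  exch : ∀ i j x y, i ≠ j → act i x = act j y → ∃ z, x = act j z ∧ y = act i z
  gen : ∀ x, deg x ≠ 0 → ∃ i y, act i y = x

namespace FreeAction

variable {X ι : Type} (S : FreeAction X ι)

theorem deg_iterate (i : ι) (j : ℕ) (x : X) :
    S.deg ((S.act i)^[j] x) = j * S.wt i + S.deg x := by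
  induction j with
  | zero => simp
  | succ j ih => rw [Function.iterate_succ_apply', S.deg_act, ih]; ring

theorem le_of_iterate {i : ι} {j : ℕ} {x y : X} (h : (S.act i)^[j] y = x) :
    j ≤ S.deg x := by
  have := S.deg_iterate i j y
  rw [h] at this
  have := S.wt_pos i
  nlinarith

open Classical in
/-- The exponent of `i` in the factorisation of `x`. -/
noncomputable def mult (i : ι) (x : X) : ℕ :=
  ((Finset.Icc 1 (S.deg x)).filter fun j => ∃ y, (S.act i)^[j] y = x).card

open Classical in
theorem mult_eq (i : ι) (x : X) {N : ℕ} (hN : S.deg x ≤ N) :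
    S.mult i x = ((Finset.Icc 1 N).filter fun j => ∃ y, (S.act i)^[j] y = x).card := by
  unfold mult
  congr 1
  ext j
  simp only [Finset.mem_filter, Finset.mem_Icc]
  constructor
  · rintro ⟨⟨h1, h2⟩, h3⟩; exact ⟨⟨h1, h2.trans hN⟩, h3⟩
  · rintro ⟨⟨h1, h2⟩, y, h3⟩; exact ⟨⟨h1, S.le_of_iterate h3⟩, y, h3⟩

theorem mult_act_self (i : ι) (x : X) : S.mult i (S.act i x) = S.mult i x + 1 := by
  classical
  rw [S.mult_eq i (S.act i x) (N := (S.deg (S.act i x)) + 1) (by omega),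
    S.mult_eq i x (N := S.deg (S.act i x)) (by rw [S.deg_act]; omega)]
  have : ((Finset.Icc 1 (S.deg (S.act i x) + 1)).filter
      fun j => ∃ y, (S.act i)^[j] y = S.act i x) =
      insert 1 ((((Finset.Icc 1 (S.deg (S.act i x))).filter
        fun j => ∃ y, (S.act i)^[j] y = x)).map ⟨fun j => j + 1, add_left_injective 1⟩) := by
    ext j
    simp only [Finset.mem_filter, Finset.mem_Icc, Finset.mem_insert, Finset.mem_map,
      Function.Embedding.coeFn_mk]
    constructor
    · rintro ⟨⟨h1, h2⟩, y, hy⟩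
      rcases Nat.lt_or_ge 1 j with h | h
      · right
        obtain ⟨k, rfl⟩ : ∃ k, j = k + 1 := ⟨j - 1, by omega⟩
        rw [Function.iterate_succ_apply'] at hy
        exact ⟨k, ⟨⟨by omega, by omega⟩, y, S.inj i hy⟩, rfl⟩
      · left; omega
    · rintro (rfl | ⟨k, ⟨⟨h1, h2⟩, y, hy⟩, rfl⟩)
      · exact ⟨⟨le_rfl, by omega⟩, x, rfl⟩
      · refine ⟨⟨by omega, by omega⟩, y, ?_⟩
        rw [Function.iterate_succ_apply', hy]
  rw [this, Finset.card_insert_of_notMem, Finset.card_map]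
  intro hmem
  obtain ⟨k, hk, h2⟩ := Finset.mem_map.1 hmem
  have h1 := (Finset.mem_Icc.1 (Finset.mem_filter.1 hk).1).1
  change k + 1 = 1 at h2
  omega

theorem exists_iterate_act_iff {i k : ι} (hik : i ≠ k) (j : ℕ) (x : X) :
    (∃ y, (S.act i)^[j] y = S.act k x) ↔ ∃ y, (S.act i)^[j] y = x := by
  induction j generalizing x with
  | zero => simp
  | succ j ih =>
    simp only [Function.iterate_succ_apply']
    constructor
    · rintro ⟨y, hy⟩
      obtain ⟨z, hz1, hz2⟩ := S.exch i k _ _ hik hy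
      obtain ⟨w, hw⟩ := (ih z).1 ⟨y, hz1⟩
      exact ⟨w, by rw [hw, hz2]⟩
    · rintro ⟨y, rfl⟩
      obtain ⟨w, hw⟩ := (ih ((S.act i)^[j] y)).2 ⟨y, rfl⟩
      exact ⟨w, by rw [hw, S.comm]⟩

theorem mult_act_of_ne {i k : ι} (hik : i ≠ k) (x : X) :
    S.mult i (S.act k x) = S.mult i x := by
  rw [S.mult_eq i (S.act k x) le_rfl,
    S.mult_eq i x (N := S.deg (S.act k x)) (by rw [S.deg_act]; omega)]
  congr 1
  ext j
  simp only [Finset.mem_filter]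
  rw [S.exists_iterate_act_iff hik]


theorem sum_wt_mul_mult (I : Finset ι) (n : ℕ) (hI : ∀ i, S.wt i ≤ n → i ∈ I) (x : X)
    (hx : S.deg x ≤ n) : ∑ i ∈ I, S.wt i * S.mult i x = S.deg x := by
  classical
  induction h : S.deg x using Nat.strong_induction_on generalizing x with
  | _ d ih =>
    by_cases hd : d = 0
    · subst hd
      have : ∀ i, S.mult i x = 0 := fun i => by simp [mult, h]
      simp [this]
    · obtain ⟨k, y, rfl⟩ := S.gen x (by omega)
      have hk := S.deg_act k y
      have := S.wt_pos k
      have h1 := ih (S.deg y) (by omega) y (by omega) rfl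
      have hkI : k ∈ I := hI k (by omega)
      rw [← Finset.add_sum_erase _ _ hkI] at h1 ⊢
      rw [S.mult_act_self]
      have : ∑ i ∈ I.erase k, S.wt i * S.mult i (S.act k y) =
          ∑ i ∈ I.erase k, S.wt i * S.mult i y :=
        Finset.sum_congr rfl fun i hi => by
          rw [S.mult_act_of_ne (Finset.ne_of_mem_erase hi)]
      rw [this, ← h, hk, ← h1]
      ring

theorem card_iterate (i : ι) (j n : ℕ) (h : j * S.wt i ≤ n) :
    Nat.card {x : {x : X // S.deg x = n} // ∃ y, (S.act i)^[j] y = x.1} =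
      Nat.card {x : X // S.deg x = n - j * S.wt i} := by
  symm
  refine Nat.card_congr (Equiv.ofBijective
    (fun x => ⟨⟨(S.act i)^[j] x.1, by rw [S.deg_iterate, x.2]; omega⟩, x.1, rfl⟩) ⟨?_, ?_⟩)
  · intro x y hxy
    simp only [Subtype.mk.injEq] at hxy
    exact Subtype.ext ((S.inj i).iterate j hxy)
  · rintro ⟨⟨x, hx⟩, y, hy⟩
    refine ⟨⟨y, ?_⟩, Subtype.ext (Subtype.ext hy)⟩
    have := S.deg_iterate i j y
    rw [hy] at this
    dsimp only at this
    omega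

theorem finite_wt (hfin : ∀ n, Finite {x : X // S.deg x = n}) (h0 : ∃ x, S.deg x = 0) (d : ℕ) :
    {i | S.wt i = d}.Finite := by
  obtain ⟨x0, hx0⟩ := h0
  have : Function.Injective fun i : {i | S.wt i = d} =>
      (⟨S.act i.1 x0, by rw [S.deg_act, hx0, i.2]; rfl⟩ : {x : X // S.deg x = d}) := by
    intro i k hik
    by_contra hne
    simp only [Subtype.mk.injEq] at hik
    obtain ⟨z, hz, -⟩ := S.exch i k x0 x0 (fun h => hne (Subtype.ext h)) hik
    have h1 := S.deg_act k z
    have := S.wt_pos k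
    rw [← hz, hx0] at h1
    omega
  exact Set.finite_coe_iff.mp (Finite.of_injective _ this)

theorem deg_mul_card (hfin : ∀ n, Finite {x : X // S.deg x = n}) (h0 : ∃ x, S.deg x = 0) (n : ℕ) :
    n * Nat.card {x : X // S.deg x = n} =
      ∑ k ∈ Finset.Icc 1 n, (∑ d ∈ k.divisors, d * Nat.card {i // S.wt i = d}) *
        Nat.card {x : X // S.deg x = n - k} := by
  classical
  have := hfin n
  have := Fintype.ofFinite {x : X // S.deg x = n}
  have hI : {i | S.wt i ≤ n}.Finite := by
    have : {i | S.wt i ≤ n} = ⋃ d ∈ Finset.range (n + 1), {i | S.wt i = d} := by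
      ext i; simp
    rw [this]
    exact Set.Finite.biUnion (Finset.finite_toSet _) fun d _ => S.finite_wt hfin h0 d
  set I := hI.toFinset with hIdef
  have hmem : ∀ i, i ∈ I ↔ S.wt i ≤ n := fun i => by simp [hIdef]
  set A : ℕ → ℕ := fun m => Nat.card {x : X // S.deg x = m} with hA
  have key : ∀ i, ∑ x : {x : X // S.deg x = n}, S.mult i x.1 =
      ∑ k ∈ (Finset.Icc 1 n).filter (S.wt i ∣ ·), A (n - k) := by
    intro i
    have h1 : ∀ x : {x : X // S.deg x = n}, S.mult i x.1 =
        ∑ j ∈ Finset.Icc 1 n, if ∃ y, (S.act i)^[j] y = x.1 then 1 else 0 := fun x => by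
      rw [S.mult_eq i x.1 x.2.le, Finset.card_filter]
    simp only [h1]
    rw [Finset.sum_comm]
    have h2 : ∀ j ∈ Finset.Icc 1 n, (∑ x : {x : X // S.deg x = n},
        if ∃ y, (S.act i)^[j] y = x.1 then 1 else 0) =
        if j * S.wt i ≤ n then A (n - j * S.wt i) else 0 := by
      intro j hj
      rw [← Finset.card_filter, ← Fintype.card_subtype, ← Nat.card_eq_fintype_card]
      split_ifs with h
      · exact S.card_iterate i j n h
      · rw [Nat.card_eq_zero]
        left
        refine ⟨?_⟩
        rintro ⟨⟨x, hx⟩, y, hy⟩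
        have := S.deg_iterate i j y
        rw [hy] at this
        dsimp only at this
        omega
    rw [Finset.sum_congr rfl h2, ← Finset.sum_filter]
    have := S.wt_pos i
    refine Finset.sum_bij (fun j _ => j * S.wt i) ?_ ?_ ?_ ?_
    · intro j hj
      simp only [Finset.mem_filter, Finset.mem_Icc] at hj ⊢
      exact ⟨⟨by nlinarith, hj.2⟩, Dvd.intro_left j rfl⟩
    · intro a _ b _ h
      exact Nat.eq_of_mul_eq_mul_right this h
    · intro k hk
      simp only [Finset.mem_filter, Finset.mem_Icc] at hk
      obtain ⟨⟨h1, h2⟩, j, rfl⟩ := hk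
      refine ⟨j, ?_, mul_comm _ _⟩
      simp only [Finset.mem_filter, Finset.mem_Icc]
      refine ⟨⟨?_, by nlinarith⟩, by rwa [mul_comm]⟩
      rcases Nat.eq_zero_or_pos j with rfl | h
      · simp at h1
      · exact h
    · intros; rfl
  calc n * A n = ∑ x : {x : X // S.deg x = n}, ∑ i ∈ I, S.wt i * S.mult i x.1 := by
        rw [Finset.sum_congr rfl fun x _ =>
          (S.sum_wt_mul_mult I n (fun i => (hmem i).2) x.1 x.2.le).trans x.2]
        simp [hA, mul_comm]
    _ = ∑ i ∈ I, S.wt i * ∑ k ∈ (Finset.Icc 1 n).filter (S.wt i ∣ ·), A (n - k) := by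
        rw [Finset.sum_comm]
        refine Finset.sum_congr rfl fun i _ => ?_
        rw [← key, Finset.mul_sum]
    _ = ∑ d ∈ Finset.Icc 1 n, ∑ i ∈ I with S.wt i = d,
          S.wt i * ∑ k ∈ (Finset.Icc 1 n).filter (S.wt i ∣ ·), A (n - k) := by
        rw [Finset.sum_fiberwise_of_maps_to]
        intro i hi
        exact Finset.mem_Icc.2 ⟨S.wt_pos i, (hmem i).1 hi⟩
    _ = ∑ d ∈ Finset.Icc 1 n, ∑ k ∈ (Finset.Icc 1 n).filter (d ∣ ·),
          d * Nat.card {i // S.wt i = d} * A (n - k) := by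
        refine Finset.sum_congr rfl fun d hd => ?_
        rw [Finset.mem_Icc] at hd
        have hc : Nat.card {i // S.wt i = d} = (I.filter fun i => S.wt i = d).card := by
          rw [Nat.subtype_card]
          intro i
          rw [Finset.mem_filter, hmem]
          omega
        rw [Finset.sum_congr rfl (g := fun _ => d * ∑ k ∈ (Finset.Icc 1 n).filter (d ∣ ·), A (n - k))
          (fun i hi => by rw [(Finset.mem_filter.1 hi).2]), Finset.sum_const, ← hc,
          Finset.mul_sum, Finset.smul_sum]
        refine Finset.sum_congr rfl fun k _ => ?_
        rw [smul_eq_mul]; ring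
    _ = ∑ k ∈ Finset.Icc 1 n, ∑ d ∈ k.divisors, d * Nat.card {i // S.wt i = d} * A (n - k) := by
        refine Finset.sum_comm' fun d k => ?_
        simp only [Finset.mem_filter, Finset.mem_Icc, Nat.mem_divisors]
        constructor
        · rintro ⟨_, ⟨h1, h2⟩, h3⟩
          exact ⟨⟨h3, by omega⟩, h1, h2⟩
        · rintro ⟨⟨h3, h4⟩, h1, h2⟩
          have := Nat.le_of_dvd h1 h3
          have := Nat.pos_of_dvd_of_pos h3 h1
          exact ⟨⟨by omega, by omega⟩, ⟨h1, h2⟩, h3⟩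
    _ = _ := by
        refine Finset.sum_congr rfl fun k _ => ?_
        rw [Finset.sum_mul]

theorem sum_pow_sub_one_mul (q : ℚ) (A : ℕ → ℚ) (hA0 : A 0 = 1)
    (hA : ∀ n, A (n + 1) = (q - 1) * q ^ n) (n : ℕ) :
    ∑ k ∈ Finset.Icc 1 (n + 1), (q ^ k - 1) * A (n + 1 - k) = (n + 1) * A (n + 1) := by
  have h : ∀ n, ∑ k ∈ Finset.range n, (q ^ (k + 1) - 1) * ((q - 1) * q ^ (n - 1 - k)) +
      (q ^ (n + 1) - 1) = (n + 1) * ((q - 1) * q ^ n) := by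
    intro n
    induction n with
    | zero => simp
    | succ n ih =>
      rw [Finset.sum_range_succ]
      have : ∑ k ∈ Finset.range n, (q ^ (k + 1) - 1) * ((q - 1) * q ^ (n + 1 - 1 - k)) =
          q * ∑ k ∈ Finset.range n, (q ^ (k + 1) - 1) * ((q - 1) * q ^ (n - 1 - k)) := by
        rw [Finset.mul_sum]
        refine Finset.sum_congr rfl fun k hk => ?_
        have hk' := Finset.mem_range.1 hk
        rw [show n + 1 - 1 - k = (n - 1 - k) + 1 by omega]
        ring
      rw [this, eq_sub_of_add_eq ih]
      simp only [Nat.add_sub_cancel, Nat.sub_self, Nat.cast_add, Nat.cast_one]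
      ring
  rw [← Finset.Ico_add_one_right_eq_Icc, Finset.sum_Ico_eq_sum_range, hA, ← h n]
  rw [show n + 1 + 1 - 1 = n + 1 by omega, Finset.sum_range_succ]
  simp only [add_comm 1, Nat.sub_self, hA0, mul_one]
  congr 1
  refine Finset.sum_congr rfl fun k hk => ?_
  have hk' := Finset.mem_range.1 hk
  rw [show n + 1 - (k + 1) = (n - 1 - k) + 1 by omega, hA]

theorem sum_divisors_card (q : ℕ) (hq : 2 ≤ q) (h0 : Nat.card {x : X // S.deg x = 0} = 1)
    (h : ∀ n, Nat.card {x : X // S.deg x = n + 1} = (q - 1) * q ^ n) (n : ℕ) (hn : 0 < n) :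
    ∑ d ∈ n.divisors, (d * Nat.card {i // S.wt i = d} : ℚ) = (q : ℚ) ^ n - 1 := by
  have hfin : ∀ n, Finite {x : X // S.deg x = n} := by
    intro n
    refine (Nat.finite_of_card_ne_zero ?_)
    cases n with
    | zero => simp [h0]
    | succ n =>
      rw [h]
      have : 0 < q - 1 := by omega
      positivity
  have hX0 : ∃ x, S.deg x = 0 := by
    obtain ⟨⟨x, hx⟩⟩ := (Nat.card_eq_one_iff_unique.1 h0).2
    exact ⟨x, hx⟩
  set A : ℕ → ℚ := fun n => Nat.card {x : X // S.deg x = n} with hA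
  have hA0 : A 0 = 1 := by simp [hA, h0]
  have hA1 : ∀ n, A (n + 1) = ((q : ℚ) - 1) * (q : ℚ) ^ n := fun n => by
    simp only [hA, h]
    rw [Nat.cast_mul, Nat.cast_sub (by omega)]
    simp
  induction n using Nat.strong_induction_on with
  | _ n ih =>
    obtain ⟨m, rfl⟩ : ∃ m, n = m + 1 := ⟨n - 1, by omega⟩
    have h1 := sum_pow_sub_one_mul (q : ℚ) A hA0 hA1 m
    have h2 := congrArg (Nat.cast (R := ℚ)) (S.deg_mul_card hfin hX0 (m + 1))
    push_cast at h2
    change _ * A (m + 1) = _ at h2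
    have hs : ∀ g : ℕ → ℚ, ∑ k ∈ Finset.Icc 1 (m + 1), g k =
        ∑ k ∈ Finset.Ico 1 (m + 1), g k + g (m + 1) := fun g => by
      rw [← Finset.Ico_add_one_right_eq_Icc, Finset.sum_Ico_succ_top (by omega)]
    have hz : A (m + 1 - (m + 1)) = 1 := by rw [Nat.sub_self, hA0]
    have hz' : (Nat.card {x : X // S.deg x = m + 1 - (m + 1)} : ℚ) = 1 := hz
    rw [h2, hs, hs, hz, hz', mul_one, mul_one] at h1
    refine (add_left_cancel (h1.trans ?_)).symm
    congr 1
    refine Finset.sum_congr rfl fun k hk => ?_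
    rw [Finset.mem_Ico] at hk
    rw [ih k (by omega) (by omega)]

theorem card_wt (q : ℕ) (hq : 2 ≤ q) (h0 : Nat.card {x : X // S.deg x = 0} = 1)
    (h : ∀ n, Nat.card {x : X // S.deg x = n + 1} = (q - 1) * q ^ n) (n : ℕ) (hn : 0 < n) :
    (Nat.card {i // S.wt i = n} : ℚ) = (1 / (n : ℚ)) *
      ∑ d ∈ n.divisors, ((ArithmeticFunction.moebius d : ℤ) : ℚ) * ((q : ℚ) ^ (n / d) - 1) := by
  have := (ArithmeticFunction.sum_eq_iff_sum_mul_moebius_eq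
    (f := fun d => (d * Nat.card {i // S.wt i = d} : ℚ)) (g := fun n => (q : ℚ) ^ n - 1)).1
    (fun n hn => S.sum_divisors_card q hq h0 h n hn) n hn
  rw [Nat.sum_divisorsAntidiagonal
    (fun a b => ((ArithmeticFunction.moebius a : ℤ) : ℚ) * ((q : ℚ) ^ b - 1))] at this
  rw [this]
  have : (n : ℚ) ≠ 0 := by exact_mod_cast hn.ne'
  field_simp

end FreeAction
end Counting

section Characters

theorem isIrreducible_of_rep {G V : Type*} [Group G] [AddCommGroup V] [Module ℂ V]
    {ρ : Representation ℂ G V} (h : IsIrreducibleRep ρ) : ρ.IsIrreducible := by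
  refine { exists_pair_ne := ⟨⊥, ⊤, fun h' => h.1 ?_⟩, eq_bot_or_eq_top := fun W => ?_ }
  · exact congrArg Subrepresentation.toSubmodule h'
  · rcases h.2 W.toSubmodule (fun g v hv => W.apply_mem_toSubmodule g hv) with h1 | h1
    · left; exact Subrepresentation.toSubmodule_injective h1
    · right; exact Subrepresentation.toSubmodule_injective h1

variable {G : Type} [Group G]

/-- The characters of the irreducible representations of `G`. -/
def Irr (G : Type) [Group G] : Set (G → ℂ) :=
  {χ | ∃ (V : Type) (_ : AddCommGroup V) (_ : Module ℂ V) (_ : FiniteDimensional ℂ V)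
    (ρ : Representation ℂ G V), IsIrreducibleRep ρ ∧ ρ.character = χ}

/-- The bilinear pairing `(f, g) ↦ |G|⁻¹ ∑ f(x) g(x⁻¹)`. -/
noncomputable def cip [Fintype G] (f g : G → ℂ) : ℂ :=
  (Nat.card G : ℂ)⁻¹ * ∑ x, f x * g x⁻¹

theorem card_ne_zero [Finite G] : (Nat.card G : ℂ) ≠ 0 := by
  simp [Nat.card_pos.ne']

theorem cip_character [Fintype G] {V W : Type} [AddCommGroup V] [Module ℂ V]
    [FiniteDimensional ℂ V] [AddCommGroup W] [Module ℂ W] [FiniteDimensional ℂ W]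
    (ρ : Representation ℂ G V) (σ : Representation ℂ G W) :
    cip σ.character ρ.character =
      (Module.finrank ℂ (Representation.IntertwiningMap ρ σ) : ℂ) := by
  have := invertibleOfNonzero (card_ne_zero (G := G))
  exact Representation.card_inv_mul_sum_char_mul_char_eq_finrank ρ σ

theorem nonempty_equiv_of_character_eq [Finite G] {V W : Type} [AddCommGroup V] [Module ℂ V]
    [FiniteDimensional ℂ V] [AddCommGroup W] [Module ℂ W] [FiniteDimensional ℂ W]
    {ρ : Representation ℂ G V} {σ : Representation ℂ G W}
    (hρ : IsIrreducibleRep ρ) (hσ : IsIrreducibleRep σ) (h : ρ.character = σ.character) :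
    Nonempty (ρ.Equiv σ) := by
  have := Fintype.ofFinite G
  have := invertibleOfNonzero (card_ne_zero (G := G))
  have := isIrreducible_of_rep hρ
  have := isIrreducible_of_rep hσ
  by_contra hne
  have h1 := Representation.char_orthonormal σ ρ
  have h2 := Representation.char_orthonormal ρ ρ
  rw [if_neg hne] at h1
  rw [if_pos ⟨Representation.Equiv.refl ρ⟩, h] at h2
  rw [h] at h1
  exact one_ne_zero (h2.symm.trans h1)

open Classical in
theorem cip_irr [Fintype G] {χ χ' : G → ℂ} (h : χ ∈ Irr G) (h' : χ' ∈ Irr G) :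
    cip χ χ' = if χ = χ' then 1 else 0 := by
  obtain ⟨V, _, _, _, ρ, hρ, rfl⟩ := h
  obtain ⟨W, _, _, _, σ, hσ, rfl⟩ := h'
  have := invertibleOfNonzero (card_ne_zero (G := G))
  have := isIrreducible_of_rep hρ
  have := isIrreducible_of_rep hσ
  have h1 := Representation.char_orthonormal ρ σ
  unfold cip
  rw [h1]
  congr 1
  refine propext ⟨fun ⟨e⟩ => (Representation.char_iso e).symm, fun h => ?_⟩
  exact nonempty_equiv_of_character_eq hσ hρ h.symm

theorem schur {V : Type} [AddCommGroup V] [Module ℂ V] [FiniteDimensional ℂ V]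
    {ρ : Representation ℂ G V} (hρ : IsIrreducibleRep ρ) (T : V →ₗ[ℂ] V)
    (hT : ∀ g, T ∘ₗ ρ g = ρ g ∘ₗ T) : ∃ c : ℂ, T = c • LinearMap.id := by
  have := isIrreducible_of_rep hρ
  obtain ⟨c, hc⟩ := (Representation.IsIrreducible.algebraMap_intertwiningMap_bijective_of_isAlgClosed
    (ρ := ρ)).2 ⟨T, hT⟩
  refine ⟨c, ?_⟩
  have := congrArg Representation.IntertwiningMap.toLinearMap hc
  exact this.symm

theorem finrank_pos_of_irr {V : Type} [AddCommGroup V] [Module ℂ V] [FiniteDimensional ℂ V]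
    {ρ : Representation ℂ G V} (hρ : IsIrreducibleRep ρ) : 0 < Module.finrank ℂ V := by
  rw [Module.finrank_pos_iff]
  by_contra h
  rw [not_nontrivial_iff_subsingleton] at h
  exact hρ.1 (Subsingleton.elim _ _)

/-- A subspace fixed by a representation, as a representation. -/
def restrictRep {V : Type} [AddCommGroup V] [Module ℂ V] (ρ : Representation ℂ G V)
    (W : Submodule ℂ V) (hW : RepInvariant ρ W) : Representation ℂ G W :=
  (⟨W, fun g _ hv => hW g _ hv⟩ : Subrepresentation ρ).toRepresentation

@[simp] theorem restrictRep_coe {V : Type} [AddCommGroup V] [Module ℂ V]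
    (ρ : Representation ℂ G V) (W : Submodule ℂ V) (hW : RepInvariant ρ W) (g : G) (w : W) :
    (restrictRep ρ W hW g w : V) = ρ g w := rfl

theorem exists_invariant_compl [Finite G] {V : Type} [AddCommGroup V] [Module ℂ V]
    (ρ : Representation ℂ G V) (W : Submodule ℂ V) (hW : RepInvariant ρ W) :
    ∃ W' : Submodule ℂ V, RepInvariant ρ W' ∧ IsCompl W W' := by
  have := Fintype.ofFinite G
  have : NeZero (Nat.card G : ℂ) := ⟨card_ne_zero⟩
  have : Representation.IsSemisimpleRepresentation ρ := inferInstance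
  obtain ⟨W', h'⟩ := exists_isCompl
    (⟨W, fun g _ hv => hW g _ hv⟩ : Subrepresentation ρ)
  refine ⟨W'.toSubmodule, fun g v hv => W'.apply_mem_toSubmodule g hv, ⟨?_, ?_⟩⟩
  · rw [disjoint_iff]
    exact congrArg Subrepresentation.toSubmodule h'.inf_eq_bot
  · rw [codisjoint_iff]
    exact congrArg Subrepresentation.toSubmodule h'.sup_eq_top

/-- Every nonzero invariant subspace contains an irreducible one. -/
theorem exists_irreducible_le {V : Type} [AddCommGroup V] [Module ℂ V]
    [FiniteDimensional ℂ V] (ρ : Representation ℂ G V) (W₀ : Submodule ℂ V)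
    (h₀ : RepInvariant ρ W₀) (hne : W₀ ≠ ⊥) :
    ∃ (W : Submodule ℂ V) (hW : RepInvariant ρ W), W ≤ W₀ ∧
      IsIrreducibleRep (restrictRep ρ W hW) := by
  induction h : Module.finrank ℂ W₀ using Nat.strong_induction_on generalizing W₀ with
  | _ d ih =>
    by_cases hirr : ∀ W : Submodule ℂ V, RepInvariant ρ W → W ≤ W₀ → W = ⊥ ∨ W = W₀
    · refine ⟨W₀, h₀, le_rfl, ?_, fun Y hY => ?_⟩
      · intro hbt
        apply hne
        rw [eq_bot_iff]
        intro x hx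
        have h2 : (⟨x, hx⟩ : W₀) ∈ (⊥ : Submodule ℂ W₀) := hbt ▸ trivial
        rw [Submodule.mem_bot] at h2 ⊢
        exact congrArg Subtype.val h2
      · have hYi : RepInvariant ρ (Y.map W₀.subtype) := by
          rintro g _ ⟨v, hv, rfl⟩
          exact ⟨_, hY g v hv, rfl⟩
        rcases hirr (Y.map W₀.subtype) hYi (Submodule.map_subtype_le _ _) with h1 | h1
        · left
          rw [eq_bot_iff]
          intro y hy
          have : W₀.subtype y ∈ Y.map W₀.subtype := ⟨y, hy, rfl⟩
          rw [h1, Submodule.mem_bot] at this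
          rw [Submodule.mem_bot]
          exact Subtype.ext this
        · right
          rw [eq_top_iff]
          rintro ⟨x, hx⟩ -
          have : x ∈ Y.map W₀.subtype := by rw [h1]; exact hx
          obtain ⟨y, hy, rfl⟩ := this
          exact hy
    · push Not at hirr
      obtain ⟨W, hW, hle, hb, ht⟩ := hirr
      obtain ⟨W', hW', hle', h'⟩ := ih _ (h ▸ Submodule.finrank_lt_finrank_of_lt
        (lt_of_le_of_ne hle ht)) W hW hb rfl
      exact ⟨W', hW', hle'.trans hle, h'⟩

theorem op_eq_zero_of_orthogonal [Fintype G] (f : G → ℂ)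
    (hf : ∀ x y, f (x * y * x⁻¹) = f y) (horth : ∀ χ ∈ Irr G, cip f χ = 0)
    {V : Type} [AddCommGroup V] [Module ℂ V] [FiniteDimensional ℂ V]
    (ρ : Representation ℂ G V) : ∑ g, f g • ρ g⁻¹ = 0 := by
  induction h : Module.finrank ℂ V using Nat.strong_induction_on generalizing V with
  | _ d ih =>
    by_cases hnt : Nontrivial V
    swap
    · rw [not_nontrivial_iff_subsingleton] at hnt
      exact Subsingleton.elim _ _
    by_cases hirr : ∀ W : Submodule ℂ V, RepInvariant ρ W → W = ⊥ ∨ W = ⊤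
    · have hρ : IsIrreducibleRep ρ := ⟨bot_ne_top, hirr⟩
      obtain ⟨c, hc⟩ := schur hρ (∑ g, f g • ρ g⁻¹) (by
        intro x
        rw [← Module.End.mul_eq_comp, ← Module.End.mul_eq_comp, Finset.sum_mul, Finset.mul_sum]
        rw [← Equiv.sum_comp (MulAut.conj x).toEquiv]
        refine Finset.sum_congr rfl fun g _ => ?_
        rw [smul_mul_assoc, mul_smul_comm, ← map_mul, ← map_mul]
        congr 1
        · exact hf _ _
        · simp [mul_assoc])
      have h1 := horth _ ⟨V, _, _, inferInstance, ρ, hρ, rfl⟩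
      unfold cip at h1
      rw [mul_eq_zero, or_iff_right (inv_ne_zero card_ne_zero)] at h1
      have h2 := congrArg (LinearMap.trace ℂ V) hc
      rw [map_sum, map_smul, LinearMap.trace_id] at h2
      simp only [map_smul, smul_eq_mul] at h2
      rw [show ∑ x, f x * (LinearMap.trace ℂ V) (ρ x⁻¹) = 0 from h1] at h2
      have h3 : (Module.finrank ℂ V : ℂ) ≠ 0 := by
        exact_mod_cast (finrank_pos_of_irr hρ).ne'
      rcases mul_eq_zero.1 h2.symm with h4 | h4
      · rw [hc, h4, zero_smul]
      · exact absurd h4 h3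
    · push Not at hirr
      obtain ⟨W, hW, hb, ht⟩ := hirr
      obtain ⟨W', hW', hc⟩ := exists_invariant_compl ρ W hW
      have hb' : W' ≠ ⊤ := by
        rintro rfl
        exact hb (by simpa using hc.inf_eq_bot)
      have key : ∀ U : Submodule ℂ V, RepInvariant ρ U → U ≠ ⊤ → ∀ u ∈ U,
          (∑ g, f g • ρ g⁻¹) u = 0 := by
        intro U hU hne u hu
        have h0 := ih _ (h ▸ Submodule.finrank_lt hne) (restrictRep ρ U hU) rfl
        have h1 := congrArg (fun T : U →ₗ[ℂ] U => (T ⟨u, hu⟩ : V)) h0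
        simpa [LinearMap.sum_apply] using h1
      ext v
      obtain ⟨w, hw, w', hw', rfl⟩ := Submodule.mem_sup.1
        (hc.sup_eq_top ▸ Submodule.mem_top : v ∈ W ⊔ W')
      rw [map_add, key W hW ht w hw, key W' hW' hb' w' hw']
      simp

/-- A class function orthogonal to all irreducible characters vanishes. -/
theorem eq_zero_of_orthogonal [Fintype G] (f : G → ℂ)
    (hf : ∀ x y, f (x * y * x⁻¹) = f y) (horth : ∀ χ ∈ Irr G, cip f χ = 0) : f = 0 := by
  classical
  let R : Representation ℂ G (G → ℂ) :=
    { toFun := fun g => LinearMap.funLeft ℂ ℂ fun x => g⁻¹ * x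
      map_one' := by ext; simp [LinearMap.funLeft]
      map_mul' := fun a b => by ext; simp [LinearMap.funLeft, mul_assoc] }
  have h := op_eq_zero_of_orthogonal f hf horth R
  funext x
  have h1 := congrFun (LinearMap.congr_fun h (Pi.single 1 1)) x⁻¹
  simp only [LinearMap.sum_apply, LinearMap.smul_apply, Finset.sum_apply, Pi.smul_apply,
    smul_eq_mul, LinearMap.zero_apply, Pi.zero_apply] at h1
  rw [Finset.sum_eq_single x] at h1
  · simpa [R, LinearMap.funLeft] using h1
  · intro b _ hb
    have : b * x⁻¹ ≠ 1 := fun h => hb (mul_inv_eq_one.1 h)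
    simp [R, LinearMap.funLeft, this]
  · simp

theorem irr_class {χ : G → ℂ} (h : χ ∈ Irr G) (x y : G) : χ (x * y * x⁻¹) = χ y := by
  obtain ⟨V, _, _, _, ρ, hρ, rfl⟩ := h
  exact Representation.char_conj ρ y x

theorem cip_smul_left [Fintype G] (c : ℂ) (f g : G → ℂ) : cip (c • f) g = c * cip f g := by
  unfold cip
  simp only [Pi.smul_apply, smul_eq_mul, mul_assoc, ← Finset.mul_sum]
  ring

theorem cip_sum_left [Fintype G] {ι : Type*} (s : Finset ι) (f : ι → G → ℂ) (g : G → ℂ) :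
    cip (∑ i ∈ s, f i) g = ∑ i ∈ s, cip (f i) g := by
  unfold cip
  simp only [Finset.sum_apply, Finset.sum_mul]
  rw [Finset.sum_comm, Finset.mul_sum]

theorem cip_sub_left [Fintype G] (f f' g : G → ℂ) : cip (f - f') g = cip f g - cip f' g := by
  unfold cip
  simp only [Pi.sub_apply, sub_mul, Finset.sum_sub_distrib, mul_sub]

instance irr_finite [Finite G] : Finite (Irr G) := by
  classical
  have := Fintype.ofFinite G
  have hli : LinearIndependent ℂ (fun χ : Irr G => (χ : G → ℂ)) := by
    rw [linearIndependent_iff']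
    intro s c h i hi
    have h1 := congrArg (fun f => cip f (i : G → ℂ)) h
    simp only [cip_sum_left, cip_smul_left, cip_irr (Subtype.mem _) i.2] at h1
    simpa [Subtype.coe_inj, hi, cip] using h1
  exact hli.finite

noncomputable instance irr_fintype [Finite G] : Fintype (Irr G) := Fintype.ofFinite _

theorem expansion [Fintype G] (f : G → ℂ) (hf : ∀ x y, f (x * y * x⁻¹) = f y) :
    f = ∑ χ : Irr G, cip f χ • (χ : G → ℂ) := by
  classical
  rw [← sub_eq_zero]
  apply eq_zero_of_orthogonal
  · intro x y
    simp only [Pi.sub_apply, hf, Finset.sum_apply, Pi.smul_apply, irr_class (Subtype.mem _)]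
  · intro χ hχ
    rw [cip_sub_left, cip_sum_left]
    simp only [cip_smul_left, cip_irr (Subtype.mem _) hχ]
    rw [Finset.sum_eq_single ⟨χ, hχ⟩]
    · simp
    · rintro ⟨b, hb⟩ - h
      simp only [ne_eq, Subtype.mk.injEq] at h
      simp [h]
    · simp

theorem second_orthogonality [Fintype G] [DecidableEq G] (x y : G) :
    ∑ χ : Irr G, (χ : G → ℂ) x * (χ : G → ℂ) y =
      ((Finset.univ.filter fun g : G => g * x * g⁻¹ = y⁻¹).card : ℂ) := by
  have h := congrFun (expansion
    (fun z => ((Finset.univ.filter fun g : G => g * x * g⁻¹ = z⁻¹).card : ℂ)) ?_) y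
  · rw [h, Finset.sum_apply]
    refine Finset.sum_congr rfl fun χ _ => ?_
    rw [Pi.smul_apply, smul_eq_mul]
    congr 1
    unfold cip
    simp only [Finset.card_filter, Nat.cast_sum, Finset.sum_mul]
    rw [Finset.sum_comm]
    have : ∀ g : G, ∑ z : G, ((if g * x * g⁻¹ = z⁻¹ then 1 else 0 : ℕ) : ℂ) * (χ : G → ℂ) z⁻¹ =
        (χ : G → ℂ) x := by
      intro g
      rw [← Equiv.sum_comp (Equiv.inv G)]
      simp [irr_class χ.2]
    simp only [this, Finset.sum_const, Finset.card_univ, nsmul_eq_mul, ← Nat.card_eq_fintype_card]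
    rw [inv_mul_cancel_left₀ card_ne_zero]
  · intro a z
    norm_cast
    refine Finset.card_bij' (fun g _ => a⁻¹ * g) (fun g _ => a * g) ?_ ?_ ?_ ?_
    · intro g hg
      simp only [Finset.mem_filter, Finset.mem_univ, true_and] at hg ⊢
      have := congrArg (fun t => a⁻¹ * t * a) hg
      simpa [mul_assoc] using this
    · intro g hg
      simp only [Finset.mem_filter, Finset.mem_univ, true_and] at hg ⊢
      have := congrArg (fun t => a * t * a⁻¹) hg
      simpa [mul_assoc] using this
    · simp
    · simp

/-- The characters of the finite-dimensional representations of `G`. -/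
def RepChar (G : Type) [Group G] : Set (G → ℂ) :=
  {χ | ∃ (V : Type) (_ : AddCommGroup V) (_ : Module ℂ V) (_ : FiniteDimensional ℂ V)
    (ρ : Representation ℂ G V), ρ.character = χ}

theorem irr_subset_repChar : Irr G ⊆ RepChar G := by
  rintro _ ⟨V, _, _, _, ρ, -, rfl⟩
  exact ⟨V, _, _, ‹_›, ρ, rfl⟩

theorem repChar_class {χ : G → ℂ} (h : χ ∈ RepChar G) (x y : G) : χ (x * y * x⁻¹) = χ y := by
  obtain ⟨V, _, _, _, ρ, rfl⟩ := h
  exact Representation.char_conj ρ y x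

theorem cip_repChar_nat [Fintype G] {f g : G → ℂ} (hf : f ∈ RepChar G) (hg : g ∈ RepChar G) :
    ∃ m : ℕ, cip f g = m := by
  obtain ⟨V, _, _, _, ρ, rfl⟩ := hf
  obtain ⟨W, _, _, _, σ, rfl⟩ := hg
  exact ⟨_, cip_character σ ρ⟩

/-- An irreducible representation averages rank-one operators to rank-one operators. -/
theorem schur_average [Fintype G] {V : Type} [AddCommGroup V] [Module ℂ V]
    [FiniteDimensional ℂ V] {ρ : Representation ℂ G V} (hρ : IsIrreducibleRep ρ) :
    ∃ c : ℂ, c ≠ 0 ∧ ∀ (l : V →ₗ[ℂ] ℂ) (v w : V),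
      ∑ g, l (ρ g⁻¹ w) • ρ g v = (c * l v) • w := by
  have hd : (Module.finrank ℂ V : ℂ) ≠ 0 := by exact_mod_cast (finrank_pos_of_irr hρ).ne'
  refine ⟨(Nat.card G : ℂ) / Module.finrank ℂ V, div_ne_zero card_ne_zero hd, fun l v w => ?_⟩
  obtain ⟨c, hc⟩ := schur hρ (∑ g, ρ g ∘ₗ (l.smulRight v) ∘ₗ ρ g⁻¹) (by
    intro x
    rw [← Module.End.mul_eq_comp, ← Module.End.mul_eq_comp, Finset.sum_mul, Finset.mul_sum]
    rw [← Equiv.sum_comp (Equiv.mulLeft x)]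
    refine Finset.sum_congr rfl fun g _ => ?_
    simp only [Equiv.coe_mulLeft, ← Module.End.mul_eq_comp, _root_.mul_inv_rev, map_mul, mul_assoc]
    have hx : ρ x⁻¹ * ρ x = 1 := by rw [← map_mul]; simp
    rw [hx, mul_one])
  have h1 := congrArg (LinearMap.trace ℂ V) hc
  rw [map_sum, map_smul, LinearMap.trace_id] at h1
  have h2 : ∀ g : G, LinearMap.trace ℂ V (ρ g ∘ₗ (l.smulRight v) ∘ₗ ρ g⁻¹) = l v := by
    intro g
    rw [← LinearMap.comp_assoc, LinearMap.trace_comp_comm', ← LinearMap.comp_assoc,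
      ← Module.End.mul_eq_comp (ρ g⁻¹), ← map_mul]
    rw [inv_mul_cancel, map_one, Module.End.one_eq_id, LinearMap.id_comp, LinearMap.trace_smulRight]
  simp only [h2, Finset.sum_const, Finset.card_univ, nsmul_eq_mul, ← Nat.card_eq_fintype_card,
    smul_eq_mul] at h1
  have h3 := congrArg (fun T : V →ₗ[ℂ] V => T w) hc
  simp only [LinearMap.sum_apply, LinearMap.comp_apply, LinearMap.smulRight_apply, map_smul,
    LinearMap.smul_apply, LinearMap.id_apply] at h3
  rw [h3]
  congr 1
  field_simp
  exact h1.symm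

/-- If a family of operators is multiplicative on the range of a commuting projection, the traces
cut down by the projection form a character. -/
theorem trace_proj_mem_repChar {L : Type} [AddCommGroup L] [Module ℂ L] [FiniteDimensional ℂ L]
    (ρ : Representation ℂ G L) (e : L →ₗ[ℂ] L) (he : e ∘ₗ e = e)
    (hcomm : ∀ g, ρ g ∘ₗ e = e ∘ₗ ρ g) : (fun g => LinearMap.trace ℂ L (e ∘ₗ ρ g)) ∈ RepChar G := by
  have hW : RepInvariant ρ (LinearMap.range e) := by
    rintro g _ ⟨v, rfl⟩
    exact ⟨ρ g v, (LinearMap.congr_fun (hcomm g) v).symm⟩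
  refine ⟨LinearMap.range e, _, _, inferInstance, restrictRep ρ _ hW, ?_⟩
  funext g
  have h1 : e ∘ₗ ρ g = (LinearMap.range e).subtype ∘ₗ (e.rangeRestrict ∘ₗ ρ g) := rfl
  rw [h1, LinearMap.trace_comp_comm']
  change LinearMap.trace ℂ _ _ = _
  congr 1
  ext ⟨_, ⟨v, rfl⟩⟩
  change ρ g (e v) = e (ρ g (e v))
  rw [← LinearMap.comp_apply, hcomm, ← LinearMap.comp_apply e, ← LinearMap.comp_assoc, he]

end Characters

section MatrixFunctions

variable {F : Type} [Field F] [Fintype F]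

noncomputable instance glFintype (N : Type) [Fintype N] [DecidableEq N] : Fintype (GL N F) :=
  Fintype.ofFinite _

variable {A B N : Type} [Fintype A] [DecidableEq A] [Fintype B] [DecidableEq B] [Fintype N]
  [DecidableEq N]

/-- Class functions on `GL_N`, extended by zero to all matrices. -/
structure IsCl (f : Matrix N N F → ℂ) : Prop where
  supp : ∀ M, ¬ IsUnit M → f M = 0
  conj : ∀ (x : GL N F) (M : Matrix N N F),
    f ((x : Matrix N N F) * M * ((x⁻¹ : GL N F) : Matrix N N F)) = f M

/-- Conjugation as a permutation of all matrices. -/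
def conjEquiv (x : GL N F) : Matrix N N F ≃ Matrix N N F where
  toFun M := (x : Matrix N N F) * M * ((x⁻¹ : GL N F) : Matrix N N F)
  invFun M := ((x⁻¹ : GL N F) : Matrix N N F) * M * (x : Matrix N N F)
  left_inv M := by simp [Matrix.mul_assoc]
  right_inv M := by simp [Matrix.mul_assoc]

theorem conjEquiv_apply (x : GL N F) (M : Matrix N N F) :
    conjEquiv x M = (x : Matrix N N F) * M * ((x⁻¹ : GL N F) : Matrix N N F) := rfl

theorem conjEquiv_mul (x y : GL N F) (M : Matrix N N F) :
    conjEquiv (x * y) M = conjEquiv x (conjEquiv y M) := by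
  simp [conjEquiv_apply, Matrix.mul_assoc, _root_.mul_inv_rev]

@[simp] theorem conjEquiv_one (M : Matrix N N F) : conjEquiv 1 M = M := by
  simp [conjEquiv_apply]

theorem isUnit_conjEquiv (x : GL N F) (M : Matrix N N F) :
    IsUnit (conjEquiv x M) ↔ IsUnit M := by
  rw [conjEquiv_apply, Units.isUnit_mul_units, Units.isUnit_units_mul]

open Classical in
/-- The indicator function of the invertible matrices. -/
noncomputable def un (M : Matrix N N F) : ℂ := if IsUnit M then 1 else 0

theorem un_isCl : IsCl (un : Matrix N N F → ℂ) where
  supp M h := by simp [un, h]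
  conj x M := by
    have := isUnit_conjEquiv x M
    rw [conjEquiv_apply] at this
    classical
    unfold un
    exact if_congr this rfl rfl

variable (F N) in
/-- The order of the general linear group. -/
noncomputable def glc : ℂ := Nat.card (GL N F)

theorem glc_ne_zero : glc F N ≠ 0 := card_ne_zero

theorem sum_units (φ : Matrix N N F → ℂ) (h : ∀ M, ¬ IsUnit M → φ M = 0) :
    ∑ M, φ M = ∑ x : GL N F, φ x := by
  classical
  symm
  apply Finset.sum_of_injOn (fun x : GL N F => (x : Matrix N N F))
  · intro x _ y _ h; exact Units.ext h
  · simp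
  · intro M _ hM
    apply h
    rintro ⟨x, rfl⟩
    exact hM ⟨x, by simp, rfl⟩
  · simp

theorem sum_un : ∑ M : Matrix N N F, un M = glc F N := by
  rw [sum_units _ un_isCl.supp]
  simp [un, glc]

/-- The bilinear pairing of class functions. -/
noncomputable def pr (f g : Matrix N N F → ℂ) : ℂ := (glc F N)⁻¹ * ∑ M, f M * g M

theorem pr_comm (f g : Matrix N N F → ℂ) : pr f g = pr g f := by
  simp [pr, mul_comm]

/-- The matrix with given blocks in a frame. -/
def blk (e : A ⊕ B ≃ N) (a : Matrix A A F) (b : Matrix A B F) (c : Matrix B A F)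
    (d : Matrix B B F) : Matrix N N F := (fromBlocks a b c d).submatrix e.symm e.symm

theorem blk_mul (e : A ⊕ B ≃ N) (a a' : Matrix A A F) (b b' : Matrix A B F) (c c' : Matrix B A F)
    (d d' : Matrix B B F) : blk e a b c d * blk e a' b' c' d' =
      blk e (a * a' + b * c') (a * b' + b * d') (c * a' + d * c') (c * b' + d * d') := by
  unfold blk
  rw [Matrix.submatrix_mul_equiv, fromBlocks_multiply]

theorem blk_one (e : A ⊕ B ≃ N) : blk e (1 : Matrix A A F) 0 0 1 = 1 := by
  simp [blk]

theorem exists_blk (e : A ⊕ B ≃ N) (M : Matrix N N F) : ∃ a b c d, M = blk e a b c d := by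
  refine ⟨(M.submatrix e e).toBlocks₁₁, (M.submatrix e e).toBlocks₁₂,
    (M.submatrix e e).toBlocks₂₁, (M.submatrix e e).toBlocks₂₂, ?_⟩
  simp [blk, fromBlocks_toBlocks]

theorem blk_inj (e : A ⊕ B ≃ N) {a a' : Matrix A A F} {b b' : Matrix A B F} {c c' : Matrix B A F}
    {d d' : Matrix B B F} (h : blk e a b c d = blk e a' b' c' d') :
    a = a' ∧ b = b' ∧ c = c' ∧ d = d' := by
  have := congrArg (fun M => M.submatrix e e) h
  simpa [blk, fromBlocks_inj] using this

theorem isUnit_blk (e : A ⊕ B ≃ N) (a : Matrix A A F) (b : Matrix A B F) (d : Matrix B B F) :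
    IsUnit (blk e a b 0 d) ↔ IsUnit a ∧ IsUnit d := by
  unfold blk
  rw [Matrix.isUnit_submatrix_equiv, Matrix.isUnit_fromBlocks_zero₂₁]

theorem sum_blk (e : A ⊕ B ≃ N) (φ : Matrix N N F → ℂ) :
    ∑ M, φ M = ∑ a, ∑ b, ∑ c, ∑ d, φ (blk e a b c d) := by
  simp only [← Fintype.sum_prod_type']
  symm
  refine Fintype.sum_bijective
    (fun p : Matrix A A F × Matrix A B F × Matrix B A F × Matrix B B F =>
      blk e p.1 p.2.1 p.2.2.1 p.2.2.2) ⟨?_, ?_⟩ _ _ fun _ => rfl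
  · rintro ⟨a, b, c, d⟩ ⟨a', b', c', d'⟩ h
    obtain ⟨rfl, rfl, rfl, rfl⟩ := blk_inj e h
    rfl
  · intro M
    obtain ⟨a, b, c, d, rfl⟩ := exists_blk e M
    exact ⟨⟨a, b, c, d⟩, rfl⟩

open Classical in
/-- Inflation of `σ ⊗ f` from the Levi subgroup to the parabolic subgroup, extended by zero. -/
noncomputable def bl (e : A ⊕ B ≃ N) (σ : Matrix A A F → ℂ) (f : Matrix B B F → ℂ)
    (M : Matrix N N F) : ℂ :=
  if (M.submatrix e e).toBlocks₂₁ = 0 then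
    σ (M.submatrix e e).toBlocks₁₁ * f (M.submatrix e e).toBlocks₂₂ else 0

@[simp] theorem bl_blk (e : A ⊕ B ≃ N) (σ : Matrix A A F → ℂ) (f : Matrix B B F → ℂ)
    (a : Matrix A A F) (b : Matrix A B F) (d : Matrix B B F) :
    bl e σ f (blk e a b 0 d) = σ a * f d := by
  simp [bl, blk]

theorem bl_blk_of_ne (e : A ⊕ B ≃ N) (σ : Matrix A A F → ℂ) (f : Matrix B B F → ℂ)
    (a : Matrix A A F) (b : Matrix A B F) {c : Matrix B A F} (d : Matrix B B F) (hc : c ≠ 0) :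
    bl e σ f (blk e a b c d) = 0 := by
  simp [bl, blk, hc]

theorem sum_bl_mul (e : A ⊕ B ≃ N) (σ : Matrix A A F → ℂ) (f : Matrix B B F → ℂ)
    (φ : Matrix N N F → ℂ) :
    ∑ M, bl e σ f M * φ M = ∑ a, ∑ b, ∑ d, σ a * f d * φ (blk e a b 0 d) := by
  rw [sum_blk e]
  refine Finset.sum_congr rfl fun a _ => Finset.sum_congr rfl fun b _ => ?_
  rw [Finset.sum_eq_single 0]
  · simp
  · intro c _ hc
    simp [bl_blk_of_ne e σ f a b _ hc]
  · simp

theorem bl_supp (e : A ⊕ B ≃ N) {σ : Matrix A A F → ℂ} {f : Matrix B B F → ℂ} (hσ : IsCl σ)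
    (hf : IsCl f) (M : Matrix N N F) (hM : ¬ IsUnit M) : bl e σ f M = 0 := by
  obtain ⟨a, b, c, d, rfl⟩ := exists_blk e M
  by_cases hc : c = 0
  · subst hc
    rw [isUnit_blk, not_and_or] at hM
    rw [bl_blk]
    rcases hM with h | h
    · rw [hσ.supp _ h, zero_mul]
    · rw [hf.supp _ h, mul_zero]
  · exact bl_blk_of_ne e σ f a b d hc

/-- The parabolic subgroup attached to a frame. -/
def Par (e : A ⊕ B ≃ N) : Subgroup (GL N F) where
  carrier := {g | ∃ a b d, (g : Matrix N N F) = blk e a b 0 d}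
  one_mem' := ⟨1, 0, 1, (blk_one e).symm⟩
  mul_mem' := by
    rintro g h ⟨a, b, d, hg⟩ ⟨a', b', d', hh⟩
    refine ⟨a * a', a * b' + b * d', d * d', ?_⟩
    rw [Units.val_mul, hg, hh, blk_mul]
    simp
  inv_mem' := by
    rintro g ⟨a, b, d, hg⟩
    obtain ⟨a', b', c', d', hi⟩ := exists_blk e ((g⁻¹ : GL N F) : Matrix N N F)
    have h1 : (g : Matrix N N F) * ((g⁻¹ : GL N F) : Matrix N N F) = 1 := by simp
    rw [hg, hi, blk_mul, ← blk_one e] at h1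
    obtain ⟨-, -, h3, h4⟩ := blk_inj e h1
    simp only [Matrix.zero_mul, zero_add] at h3 h4
    have hc : c' = 0 := by
      rw [← Matrix.one_mul c', ← mul_eq_one_comm.1 h4, Matrix.mul_assoc, h3, Matrix.mul_zero]
    subst hc
    exact ⟨_, _, _, hi⟩

theorem mem_Par (e : A ⊕ B ≃ N) (g : GL N F) :
    g ∈ Par e ↔ ∃ a b d, (g : Matrix N N F) = blk e a b 0 d := Iff.rfl

theorem bl_conj (e : A ⊕ B ≃ N) {σ : Matrix A A F → ℂ} {f : Matrix B B F → ℂ} (hσ : IsCl σ)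
    (hf : IsCl f) (p : GL N F) (hp : p ∈ Par e) (M : Matrix N N F) :
    bl e σ f (conjEquiv p M) = bl e σ f M := by
  obtain ⟨a, b, d, hg⟩ := hp
  obtain ⟨a', b', d', hi⟩ := (Par e).inv_mem ⟨a, b, d, hg⟩
  obtain ⟨x, y, z, w, rfl⟩ := exists_blk e M
  have h1 : (p : Matrix N N F) * ((p⁻¹ : GL N F) : Matrix N N F) = 1 := by simp
  rw [hg, hi, blk_mul, ← blk_one e] at h1
  obtain ⟨ha, -, -, hd⟩ := blk_inj e h1
  simp only [Matrix.zero_mul, Matrix.mul_zero, zero_add, add_zero] at ha hd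
  rw [conjEquiv_apply, hg, hi, blk_mul, blk_mul]
  simp only [Matrix.zero_mul, Matrix.mul_zero, zero_add, add_zero]
  by_cases hz : z = 0
  · subst hz
    simp only [Matrix.zero_mul, Matrix.mul_zero, zero_add, add_zero, bl_blk]
    congr 1
    · exact hσ.conj ⟨a, a', ha, mul_eq_one_comm.1 ha⟩ x
    · exact hf.conj ⟨d, d', hd, mul_eq_one_comm.1 hd⟩ w
  · rw [bl_blk_of_ne _ _ _ _ _ _ hz, bl_blk_of_ne]
    intro h
    apply hz
    have : d' * (d * z * a') * a = z := by
      rw [← Matrix.mul_assoc, ← Matrix.mul_assoc, mul_eq_one_comm.1 hd, Matrix.one_mul,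
        Matrix.mul_assoc, mul_eq_one_comm.1 ha, Matrix.mul_one]
    rw [← this, h]
    simp

theorem bl_un (e : A ⊕ B ≃ N) (g : GL N F) [Decidable (g ∈ Par e)] :
    bl e un un (g : Matrix N N F) = if g ∈ Par e then 1 else 0 := by
  split_ifs with h
  · obtain ⟨a, b, d, hg⟩ := h
    have hu := g.isUnit
    rw [hg, isUnit_blk] at hu
    rw [hg, bl_blk]
    simp [un, hu.1, hu.2]
  · obtain ⟨a, b, c, d, hg⟩ := exists_blk e (g : Matrix N N F)
    rw [hg, bl_blk_of_ne]
    rintro rfl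
    exact h ⟨_, _, _, hg⟩

/-- The order of a parabolic subgroup. -/
noncomputable def pc (e : A ⊕ B ≃ N) : ℂ := Nat.card (Par (F := F) e)

theorem pc_ne_zero (e : A ⊕ B ≃ N) : pc (F := F) e ≠ 0 := card_ne_zero

theorem pc_eq_sum (e : A ⊕ B ≃ N) : pc (F := F) e = ∑ M : Matrix N N F, bl e un un M := by
  classical
  rw [sum_units _ (bl_supp e un_isCl un_isCl)]
  simp only [bl_un, Finset.sum_boole]
  rw [pc]
  congr 1
  exact Nat.subtype_card _ (by simp)

theorem pc_eq (e : A ⊕ B ≃ N) :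
    pc (F := F) e = glc F A * glc F B * Nat.card (Matrix A B F) := by
  have h := sum_bl_mul (F := F) e un un fun _ => 1
  simp only [mul_one] at h
  rw [pc_eq_sum, h, ← sum_un (N := A), ← sum_un (N := B), Finset.sum_mul_sum, Finset.sum_mul]
  refine Finset.sum_congr rfl fun a _ => ?_
  rw [Finset.sum_const, Finset.card_univ, nsmul_eq_mul, mul_comm, Nat.card_eq_fintype_card]

/-- Parabolic induction of class functions. -/
noncomputable def Tf (e : A ⊕ B ≃ N) (σ : Matrix A A F → ℂ) (f : Matrix B B F → ℂ)
    (M : Matrix N N F) : ℂ := (pc (F := F) e)⁻¹ * ∑ x : GL N F, bl e σ f (conjEquiv x M)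

theorem Tf_isCl (e : A ⊕ B ≃ N) {σ : Matrix A A F → ℂ} {f : Matrix B B F → ℂ} (hσ : IsCl σ)
    (hf : IsCl f) : IsCl (Tf e σ f) where
  supp M hM := by
    unfold Tf
    rw [Finset.sum_eq_zero, mul_zero]
    intro x _
    exact bl_supp e hσ hf _ (by rwa [isUnit_conjEquiv])
  conj y M := by
    unfold Tf
    congr 1
    rw [← conjEquiv_apply, ← Equiv.sum_comp (Equiv.mulRight y)
      fun x => bl e σ f (conjEquiv x M)]
    simp [conjEquiv_mul]

theorem pr_Tf (e : A ⊕ B ≃ N) (σ : Matrix A A F → ℂ) (f : Matrix B B F → ℂ)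
    {π : Matrix N N F → ℂ} (hπ : IsCl π) :
    pr (Tf e σ f) π = (pc (F := F) e)⁻¹ * ∑ M, bl e σ f M * π M := by
  unfold pr Tf
  simp only [mul_assoc, Finset.sum_mul, ← Finset.mul_sum]
  rw [Finset.sum_comm]
  have : ∀ x : GL N F, ∑ M, bl e σ f (conjEquiv x M) * π M = ∑ M, bl e σ f M * π M := by
    intro x
    rw [← Equiv.sum_comp (conjEquiv x) fun M => bl e σ f M * π M]
    refine Finset.sum_congr rfl fun M _ => ?_
    rw [conjEquiv_apply, hπ.conj]
  simp only [this, Finset.sum_const, Finset.card_univ, nsmul_eq_mul,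
    ← Nat.card_eq_fintype_card]
  change _ * (_ * (glc F N * _)) = _
  have := glc_ne_zero (F := F) (N := N)
  field_simp

/-- Parabolic restriction of class functions, twisted by `σ`. -/
noncomputable def Ef (e : A ⊕ B ≃ N) (σ : Matrix A A F → ℂ) (f : Matrix N N F → ℂ)
    (k : Matrix B B F) : ℂ :=
  (glc F A * Nat.card (Matrix A B F))⁻¹ * ∑ a, ∑ b, σ a * f (blk e a b 0 k)

theorem pr_Tf_eq_pr_Ef (e : A ⊕ B ≃ N) (σ : Matrix A A F → ℂ) (f : Matrix B B F → ℂ)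
    {π : Matrix N N F → ℂ} (hπ : IsCl π) : pr (Tf e σ f) π = pr f (Ef e σ π) := by
  rw [pr_Tf e σ f hπ, sum_bl_mul, pc_eq]
  unfold pr Ef
  rw [_root_.mul_inv_rev, _root_.mul_inv_rev, _root_.mul_inv_rev]
  have : ∑ M, f M * ((Nat.card (Matrix A B F) : ℂ)⁻¹ * (glc F A)⁻¹ *
      ∑ a, ∑ b, σ a * π (blk e a b 0 M)) = ((Nat.card (Matrix A B F) : ℂ)⁻¹ * (glc F A)⁻¹) *
      ∑ a, ∑ b, ∑ d, σ a * f d * π (blk e a b 0 d) := by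
    simp only [Finset.mul_sum]
    rw [Finset.sum_comm]
    refine Finset.sum_congr rfl fun a _ => ?_
    rw [Finset.sum_comm]
    refine Finset.sum_congr rfl fun a _ => ?_
    refine Finset.sum_congr rfl fun a _ => ?_
    ring
  rw [this]
  ring

theorem Ef_isCl (e : A ⊕ B ≃ N) {σ : Matrix A A F → ℂ} {f : Matrix N N F → ℂ}
    (hf : IsCl f) : IsCl (Ef e σ f) where
  supp M hM := by
    unfold Ef
    rw [Finset.sum_eq_zero, mul_zero]
    intro a _
    refine Finset.sum_eq_zero fun b _ => ?_
    rw [hf.supp, mul_zero]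
    rw [isUnit_blk]
    exact fun h => hM h.2
  conj y M := by
    unfold Ef
    congr 1
    refine Finset.sum_congr rfl fun a _ => ?_
    have h1 : blk e 1 0 0 (y : Matrix B B F) * blk e 1 0 0 ((y⁻¹ : GL B F) : Matrix B B F) = 1 := by
      rw [blk_mul, ← blk_one e]
      simp
    let z : GL N F := ⟨_, _, h1, mul_eq_one_comm.1 h1⟩
    refine Fintype.sum_bijective (fun b : Matrix A B F => b * (y : Matrix B B F)) ⟨?_, ?_⟩ _ _ ?_
    · intro b b' h
      simpa [Matrix.mul_assoc] using congrArg (fun t => t * ((y⁻¹ : GL B F) : Matrix B B F)) h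
    · intro b
      exact ⟨b * ((y⁻¹ : GL B F) : Matrix B B F), by simp [Matrix.mul_assoc]⟩
    · intro b
      rw [← hf.conj z (blk e a (b * (y : Matrix B B F)) 0 M)]
      congr 2
      change _ = blk e 1 0 0 (y : Matrix B B F) * _ *
        blk e 1 0 0 ((y⁻¹ : GL B F) : Matrix B B F)
      rw [blk_mul, blk_mul]
      simp [Matrix.mul_assoc]

end MatrixFunctions

section Frames

variable {F : Type} [Field F] [Fintype F]
variable {A B N A' B' N' : Type} [Fintype A] [DecidableEq A] [Fintype B] [DecidableEq B] [Fintype N]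
  [DecidableEq N] [Fintype A'] [DecidableEq A'] [Fintype B'] [DecidableEq B'] [Fintype N']
  [DecidableEq N']

/-- The permutation matrix as an element of the general linear group. -/
def permGL (s : N ≃ N) : GL N F where
  val := (1 : Matrix N N F).submatrix s id
  inv := (1 : Matrix N N F).submatrix id s
  val_inv := by
    have := Matrix.submatrix_mul_equiv (1 : Matrix N N F) (1 : Matrix N N F) s (Equiv.refl N) s
    simpa using this
  inv_val := by
    have := Matrix.submatrix_mul_equiv (1 : Matrix N N F) (1 : Matrix N N F) id s id
    simpa using this

theorem conjEquiv_permGL (s : N ≃ N) (M : Matrix N N F) :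
    conjEquiv (permGL s) M = M.submatrix s s := by
  have h1 := Matrix.submatrix_mul_equiv (1 : Matrix N N F) M s (Equiv.refl N) id
  have h2 := Matrix.submatrix_mul_equiv M (1 : Matrix N N F) s (Equiv.refl N) s
  simp only [Matrix.one_mul, Matrix.mul_one, Equiv.coe_refl, Matrix.submatrix_id_id] at h1 h2
  rw [conjEquiv_apply, ← h2]
  change (1 : Matrix N N F).submatrix s id * M * (1 : Matrix N N F).submatrix id s = _
  rw [h1]

theorem IsCl.submatrix {f : Matrix N N F → ℂ} (hf : IsCl f) (s : N ≃ N) (M : Matrix N N F) :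
    f (M.submatrix s s) = f M := by
  rw [← conjEquiv_permGL, conjEquiv_apply, hf.conj]

/-- Transport of functions along a bijection of index types. -/
def tp (e : B ≃ B') (f : Matrix B B F → ℂ) (M : Matrix B' B' F) : ℂ := f (M.submatrix e e)

/-- Transport of invertible matrices along a bijection of index types. -/
def glRe (c : N ≃ N') : GL N' F ≃* GL N F :=
  Units.mapEquiv (Matrix.reindexAlgEquiv F F c.symm).toMulEquiv

theorem glRe_coe (c : N ≃ N') (x : GL N' F) :
    (glRe c x : Matrix N N F) = (x : Matrix N' N' F).submatrix c c := rfl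

theorem conjEquiv_glRe (c : N ≃ N') (x : GL N' F) (M : Matrix N' N' F) :
    conjEquiv (glRe c x) (M.submatrix c c) = (conjEquiv x M).submatrix c c := by
  rw [conjEquiv_apply, ← map_inv, glRe_coe, glRe_coe, conjEquiv_apply]
  simp [Matrix.submatrix_mul_equiv]

theorem tp_isCl (e : B ≃ B') {f : Matrix B B F → ℂ} (hf : IsCl f) : IsCl (tp e f) where
  supp M hM := hf.supp _ (by rwa [Matrix.isUnit_submatrix_equiv])
  conj x M := by
    rw [← conjEquiv_apply]
    unfold tp
    rw [← conjEquiv_glRe, conjEquiv_apply, hf.conj]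

theorem glc_congr (c : N ≃ N') : glc F N = glc F N' := by
  unfold glc
  rw [Nat.card_congr (glRe (F := F) c).toEquiv]

theorem pr_tp (e : B ≃ B') (f g : Matrix B B F → ℂ) : pr (tp e f) (tp e g) = pr f g := by
  unfold pr tp
  rw [glc_congr e]
  congr 1
  exact Equiv.sum_comp (Matrix.reindexAlgEquiv F F e.symm).toEquiv fun M => f M * g M

theorem bl_perm (e e' : A ⊕ B ≃ N) (σ : Matrix A A F → ℂ) (f : Matrix B B F → ℂ)
    (M : Matrix N N F) :
    bl e' σ f M = bl e σ f (conjEquiv (permGL (e.symm.trans e')) M) := by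
  have h : (M.submatrix (e.symm.trans e') (e.symm.trans e')).submatrix e e = M.submatrix e' e' := by
    ext i j
    simp
  rw [conjEquiv_permGL]
  unfold bl
  rw [h]

theorem blk_sumCongr (e : A' ⊕ B' ≃ N) (a : A ≃ A') (b : B ≃ B') (p : Matrix A' A' F)
    (q : Matrix A' B' F) (r : Matrix B' A' F) (s : Matrix B' B' F) :
    blk e p q r s = blk ((Equiv.sumCongr a b).trans e) (p.submatrix a a) (q.submatrix a b)
      (r.submatrix b a) (s.submatrix b b) := by
  unfold blk
  ext i j
  simp only [submatrix_apply, Equiv.symm_trans_apply]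
  rcases e.symm i with i | i <;> rcases e.symm j with j | j <;> simp

theorem bl_tp (e : A' ⊕ B' ≃ N) (a : A ≃ A') (b : B ≃ B') (σ : Matrix A A F → ℂ)
    (f : Matrix B B F → ℂ) (M : Matrix N N F) :
    bl e (tp a σ) (tp b f) M = bl ((Equiv.sumCongr a b).trans e) σ f M := by
  obtain ⟨p, q, r, t, rfl⟩ := exists_blk e M
  have h := blk_sumCongr e a b p q r t
  by_cases hr : r = 0
  · subst hr
    rw [bl_blk, h, submatrix_zero, Pi.zero_apply, Pi.zero_apply, bl_blk]
    rfl
  · rw [bl_blk_of_ne _ _ _ _ _ _ hr, h, bl_blk_of_ne]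
    intro h0
    apply hr
    ext i j
    simpa using congrFun (congrFun h0 (b.symm i)) (a.symm j)

theorem ext_mulVec {M M' : Matrix A B F} (h : ∀ v, M *ᵥ v = M' *ᵥ v) : M = M' :=
  Matrix.mulVec_injective (funext h)

theorem eq_zero_of_mulVec {M : Matrix A B F} (h : ∀ v, M *ᵥ v = 0) : M = 0 :=
  ext_mulVec fun v => by rw [h, Matrix.zero_mulVec]

theorem pc_congr (e : A ⊕ B ≃ N) (e' : A ⊕ B ≃ N') : pc (F := F) e = pc (F := F) e' := by
  rw [pc_eq, pc_eq]

theorem Tf_frame (e e' : A ⊕ B ≃ N) (σ : Matrix A A F → ℂ) (f : Matrix B B F → ℂ) :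
    Tf e σ f = Tf e' σ f := by
  funext M
  unfold Tf
  rw [pc_congr e e', ← Equiv.sum_comp (Equiv.mulLeft (permGL (e.symm.trans e')))]
  simp only [Equiv.coe_mulLeft, conjEquiv_mul]
  simp only [← bl_perm]

theorem Tf_tp (e : A ⊕ B ≃ N) (e' : A' ⊕ B' ≃ N') (a : A ≃ A') (b : B ≃ B') (c : N ≃ N')
    (σ : Matrix A A F → ℂ) (f : Matrix B B F → ℂ) :
    Tf e' (tp a σ) (tp b f) = tp c (Tf e σ f) := by
  have h1 : Tf e' (tp a σ) (tp b f) = Tf ((Equiv.sumCongr a b).trans e') σ f := by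
    funext M
    unfold Tf
    rw [pc_eq, pc_eq, glc_congr a, glc_congr b]
    have : Nat.card (Matrix A' B' F) = Nat.card (Matrix A B F) :=
      Nat.card_congr (Matrix.reindex a.symm b.symm)
    rw [this]
    simp only [bl_tp]
  rw [h1, Tf_frame _ (e.trans c)]
  funext M
  unfold tp Tf
  rw [pc_congr (e.trans c) e]
  congr 1
  rw [← Equiv.sum_comp (glRe c).toEquiv]
  refine Finset.sum_congr rfl fun x _ => ?_
  change _ = bl e σ f (conjEquiv (glRe c x) (M.submatrix c c))
  rw [conjEquiv_glRe]
  rfl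

end Frames

section Mackey

variable {F : Type} [Field F] [Fintype F]
variable {A B N A' B' : Type} [Fintype A] [DecidableEq A] [Fintype B] [DecidableEq B] [Fintype N]
  [DecidableEq N] [Fintype A'] [DecidableEq A'] [Fintype B'] [DecidableEq B']

/-- The contribution of a double coset representative to the pairing of two induced functions. -/
noncomputable def Mk (e : A ⊕ B ≃ N) (e' : A' ⊕ B' ≃ N) (σ : Matrix A A F → ℂ)
    (f : Matrix B B F → ℂ) (σ' : Matrix A' A' F → ℂ) (f' : Matrix B' B' F → ℂ) (z : GL N F) : ℂ :=
  ∑ M, bl e σ f M * bl e' σ' f' (conjEquiv z M)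

theorem pr_Tf_Tf (e : A ⊕ B ≃ N) (e' : A' ⊕ B' ≃ N) {σ : Matrix A A F → ℂ}
    {f : Matrix B B F → ℂ} {σ' : Matrix A' A' F → ℂ} {f' : Matrix B' B' F → ℂ}
    (hσ' : IsCl σ') (hf' : IsCl f') :
    pr (Tf e σ f) (Tf e' σ' f') =
      (pc (F := F) e)⁻¹ * (pc (F := F) e')⁻¹ * ∑ z, Mk e e' σ f σ' f' z := by
  rw [pr_Tf e σ f (Tf_isCl e' hσ' hf'), mul_assoc]
  congr 1
  unfold Tf Mk
  rw [Finset.sum_comm, Finset.mul_sum]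
  refine Finset.sum_congr rfl fun M _ => ?_
  rw [Finset.mul_sum, Finset.mul_sum, Finset.mul_sum]
  refine Finset.sum_congr rfl fun x _ => ?_
  ring

theorem Mk_mul (e : A ⊕ B ≃ N) (e' : A' ⊕ B' ≃ N) {σ : Matrix A A F → ℂ}
    {f : Matrix B B F → ℂ} {σ' : Matrix A' A' F → ℂ} {f' : Matrix B' B' F → ℂ} (hσ : IsCl σ)
    (hf : IsCl f) (hσ' : IsCl σ') (hf' : IsCl f') (p' p z : GL N F) (hp' : p' ∈ Par e')
    (hp : p ∈ Par e) : Mk e e' σ f σ' f' (p' * z * p) = Mk e e' σ f σ' f' z := by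
  unfold Mk
  rw [← Equiv.sum_comp (conjEquiv p⁻¹)]
  refine Finset.sum_congr rfl fun M _ => ?_
  rw [bl_conj e hσ hf _ ((Par e).inv_mem hp), conjEquiv_mul, conjEquiv_mul,
    bl_conj e' hσ' hf' _ hp', ← conjEquiv_mul p, mul_inv_cancel, conjEquiv_one]

theorem Mk_symm (e : A ⊕ B ≃ N) (e' : A' ⊕ B' ≃ N) (σ : Matrix A A F → ℂ)
    (f : Matrix B B F → ℂ) (σ' : Matrix A' A' F → ℂ) (f' : Matrix B' B' F → ℂ) (z : GL N F) :
    Mk e e' σ f σ' f' z = Mk e' e σ' f' σ f z⁻¹ := by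
  unfold Mk
  rw [← Equiv.sum_comp (conjEquiv z) (fun M => bl e' σ' f' M * _)]
  refine Finset.sum_congr rfl fun M _ => ?_
  rw [← conjEquiv_mul, inv_mul_cancel, conjEquiv_one, mul_comm]

/-- The inclusion of the first block of coordinates. -/
def inc (e : A ⊕ B ≃ N) : (A → F) →ₗ[F] (N → F) :=
  (LinearMap.funLeft F F e.symm) ∘ₗ (LinearEquiv.sumArrowLequivProdArrow A B F F).symm.toLinearMap ∘ₗ
    LinearMap.inl F (A → F) (B → F)

theorem inc_apply (e : A ⊕ B ≃ N) (v : A → F) : inc e v = Sum.elim v 0 ∘ e.symm := by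
  funext i
  simp only [inc, LinearMap.coe_comp, Function.comp_apply, LinearMap.funLeft_apply,
    LinearMap.inl_apply]
  cases e.symm i <;> simp [LinearEquiv.sumArrowLequivProdArrow]

theorem inc_injective (e : A ⊕ B ≃ N) : Function.Injective (inc (F := F) e) := by
  intro v w h
  funext i
  have := congrFun h (e (Sum.inl i))
  simpa [inc_apply] using this

theorem blk_mulVec_inc (e : A ⊕ B ≃ N) (a : Matrix A A F) (b : Matrix A B F) (c : Matrix B A F)
    (d : Matrix B B F) (v : A → F) :
    blk e a b c d *ᵥ inc e v = Sum.elim (a *ᵥ v) (c *ᵥ v) ∘ e.symm := by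
  rw [inc_apply]
  unfold blk
  rw [Matrix.submatrix_mulVec_equiv]
  simp [Function.comp_assoc, fromBlocks_mulVec]

/-- The coordinate subspace of a frame. -/
def VA (e : A ⊕ B ≃ N) : Submodule F (N → F) := LinearMap.range (inc e)

theorem elim_mem_VA (e : A ⊕ B ≃ N) (v : A → F) (w : B → F) :
    Sum.elim v w ∘ e.symm ∈ VA (F := F) e ↔ w = 0 := by
  constructor
  · rintro ⟨u, hu⟩
    funext i
    have := congrFun hu (e (Sum.inr i))
    simpa [inc_apply] using this.symm
  · rintro rfl
    exact ⟨v, inc_apply e v⟩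

theorem blk_maps_VA (e : A ⊕ B ≃ N) (a : Matrix A A F) (b : Matrix A B F) (c : Matrix B A F)
    (d : Matrix B B F) : (∀ v ∈ VA e, blk e a b c d *ᵥ v ∈ VA (F := F) e) ↔ c = 0 := by
  constructor
  · intro h
    refine eq_zero_of_mulVec fun v => ?_
    have := h _ ⟨v, rfl⟩
    rwa [blk_mulVec_inc, elim_mem_VA] at this
  · rintro rfl _ ⟨v, rfl⟩
    rw [blk_mulVec_inc, elim_mem_VA]
    simp

theorem mem_Par_iff (e : A ⊕ B ≃ N) (g : GL N F) :
    g ∈ Par e ↔ ∀ v ∈ VA e, (g : Matrix N N F) *ᵥ v ∈ VA (F := F) e := by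
  obtain ⟨a, b, c, d, h⟩ := exists_blk e (g : Matrix N N F)
  rw [h, blk_maps_VA, mem_Par]
  constructor
  · rintro ⟨a', b', d', h'⟩
    rw [h] at h'
    exact (blk_inj e h').2.2.1
  · rintro rfl
    exact ⟨_, _, _, h⟩

theorem exists_GL_map {X : Type} [AddCommGroup X] [Module F X] (f g : X →ₗ[F] (N → F))
    (hf : Function.Injective f) (hg : Function.Injective g) :
    ∃ q : GL N F, ∀ x, (q : Matrix N N F) *ᵥ f x = g x := by
  obtain ⟨h, hh⟩ := Submodule.exists_linearEquiv_restrict_eq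
    ((LinearEquiv.ofInjective f hf).symm ≪≫ₗ LinearEquiv.ofInjective g hg)
  refine ⟨⟨LinearMap.toMatrix' h.toLinearMap, LinearMap.toMatrix' h.symm.toLinearMap, ?_, ?_⟩,
    fun x => ?_⟩
  · rw [← LinearMap.toMatrix'_comp]
    simp
  · rw [← LinearMap.toMatrix'_comp]
    simp
  · change LinearMap.toMatrix' h.toLinearMap *ᵥ f x = g x
    rw [LinearMap.toMatrix'_mulVec]
    have := hh (LinearEquiv.ofInjective f hf x)
    simp at this
    exact this.symm

/-- The averaging property of cuspidal class functions. -/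
def CuspFn (σ : Matrix A A F → ℂ) : Prop :=
  ∀ S : Submodule F (A → F), S ≠ ⊥ → S ≠ ⊤ → ∃ s : Finset (Matrix A A F), s.Nonempty ∧
    (∀ Q ∈ s, (∀ v ∈ S, Q *ᵥ v = 0) ∧ ∀ v, Q *ᵥ v ∈ S) ∧ ∀ M, ∑ Q ∈ s, σ (M * (1 + Q)) = 0

theorem exists_extension (e : A ⊕ B ≃ N) (W : Submodule F (N → F)) (Q : Matrix A A F)
    (h1 : ∀ v ∈ W.comap (inc e), Q *ᵥ v = 0) (h2 : ∀ v, Q *ᵥ v ∈ W.comap (inc e)) :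
    ∃ R : Matrix N N F, (∀ v, R *ᵥ v ∈ W ∧ R *ᵥ v ∈ VA e) ∧
      (∀ v, R *ᵥ inc e v = inc e (Q *ᵥ v)) ∧ ∀ w ∈ W, R *ᵥ w = 0 := by
  let S := W.comap (inc e)
  let j : ((A → F) ⧸ S) →ₗ[F] ((N → F) ⧸ W) := S.mapQ W (inc e) le_rfl
  have hj : LinearMap.ker j = ⊥ := by
    rw [Submodule.ker_mapQ, Submodule.mkQ_map_self]
  obtain ⟨r, hr⟩ := j.exists_leftInverse_of_injective hj
  have hS : S ≤ LinearMap.ker (Matrix.toLin' Q) := fun v hv => by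
    rw [LinearMap.mem_ker, Matrix.toLin'_apply]
    exact h1 v hv
  let R' : (N → F) →ₗ[F] (N → F) := inc e ∘ₗ S.liftQ (Matrix.toLin' Q) hS ∘ₗ r ∘ₗ W.mkQ
  refine ⟨LinearMap.toMatrix' R', fun v => ?_, fun v => ?_, fun w hw => ?_⟩
  · rw [LinearMap.toMatrix'_mulVec]
    refine ⟨?_, ⟨_, rfl⟩⟩
    obtain ⟨y, hy⟩ := S.mkQ_surjective (r (W.mkQ v))
    change inc e (S.liftQ _ hS (r (W.mkQ v))) ∈ W
    rw [← hy, Submodule.mkQ_apply, Submodule.liftQ_apply]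
    exact h2 y
  · rw [LinearMap.toMatrix'_mulVec]
    change inc e (S.liftQ _ hS (r (j (S.mkQ v)))) = _
    rw [← LinearMap.comp_apply r, hr, LinearMap.id_apply, Submodule.mkQ_apply,
      Submodule.liftQ_apply, Matrix.toLin'_apply]
  · rw [LinearMap.toMatrix'_mulVec]
    change inc e (S.liftQ _ hS (r (W.mkQ w))) = _
    rw [Submodule.mkQ_apply, (Submodule.Quotient.mk_eq_zero W).2 hw]
    simp

theorem blk_add (e : A ⊕ B ≃ N) (a a' : Matrix A A F) (b b' : Matrix A B F) (c c' : Matrix B A F)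
    (d d' : Matrix B B F) : blk e a b c d + blk e a' b' c' d' =
      blk e (a + a') (b + b') (c + c') (d + d') := by
  unfold blk
  rw [← fromBlocks_add]
  rfl

theorem bl_mul_one_add (e : A ⊕ B ≃ N) (σ : Matrix A A F → ℂ) (f : Matrix B B F → ℂ)
    (Q : Matrix A A F) (T : Matrix A B F) (hQ : Q * Q = 0) (a : Matrix A A F) (b : Matrix A B F)
    (c : Matrix B A F) (d : Matrix B B F) :
    bl e σ f (blk e a b c d * (1 + blk e Q T 0 0)) =
      bl e (fun M => σ (M * (1 + Q))) f (blk e a b c d) := by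
  rw [mul_add, mul_one, blk_mul, blk_add]
  simp only [Matrix.mul_zero, add_zero]
  rw [show a + a * Q = a * (1 + Q) by rw [Matrix.mul_add, Matrix.mul_one],
    show c + c * Q = c * (1 + Q) by rw [Matrix.mul_add, Matrix.mul_one]]
  by_cases hc : c = 0
  · subst hc
    simp
  · rw [bl_blk_of_ne _ _ _ _ _ _ hc, bl_blk_of_ne]
    intro h0
    apply hc
    have h1 := congrArg (fun t => t * (1 - Q)) h0
    simp only [Matrix.zero_mul, Matrix.mul_assoc] at h1
    rwa [show (1 + Q) * (1 - Q) = 1 by rw [add_mul, mul_sub, mul_sub, hQ]; simp,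
      Matrix.mul_one] at h1

theorem eq_blk_of_range (e : A ⊕ B ≃ N) (R : Matrix N N F) (h : ∀ v, R *ᵥ v ∈ VA e)
    (Q : Matrix A A F) (hQ : ∀ v, R *ᵥ inc e v = inc e (Q *ᵥ v)) :
    ∃ T, R = blk e Q T 0 0 := by
  obtain ⟨a, b, c, d, rfl⟩ := exists_blk e R
  have hc : c = 0 := (blk_maps_VA e a b c d).1 fun v _ => h v
  have ha : a = Q := by
    refine ext_mulVec fun v => ?_
    have := hQ v
    rw [blk_mulVec_inc, inc_apply] at this
    funext k
    simpa using congrFun this (e (Sum.inl k))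
  have hd : d = 0 := by
    refine eq_zero_of_mulVec fun v => ?_
    have := h (Sum.elim 0 v ∘ e.symm)
    unfold blk at this
    rw [Matrix.submatrix_mulVec_equiv] at this
    simp only [Function.comp_assoc, Equiv.symm_symm, Equiv.symm_comp_self, Function.comp_id,
      fromBlocks_mulVec] at this
    rw [elim_mem_VA, Sum.elim_comp_inl, Sum.elim_comp_inr, Matrix.mulVec_zero, zero_add] at this
    exact this
  subst hc ha hd
  exact ⟨b, rfl⟩

theorem Mk_eq_zero (e : A ⊕ B ≃ N) (e' : A' ⊕ B' ≃ N) {σ : Matrix A A F → ℂ}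
    (f : Matrix B B F → ℂ) (σ' : Matrix A' A' F → ℂ) (f' : Matrix B' B' F → ℂ) (hσ : CuspFn σ)
    (z : GL N F) (h1 : ∃ v ∈ VA (F := F) e, v ≠ 0 ∧ (z : Matrix N N F) *ᵥ v ∈ VA e')
    (h2 : ∃ v ∈ VA (F := F) e, (z : Matrix N N F) *ᵥ v ∉ VA e') : Mk e e' σ f σ' f' z = 0 := by
  let W : Submodule F (N → F) := (VA e').comap (Matrix.toLin' (z : Matrix N N F))
  have hW : ∀ v, v ∈ W ↔ (z : Matrix N N F) *ᵥ v ∈ VA e' := fun v => by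
    simp [W]
  obtain ⟨s, hs, hs1, hs2⟩ := hσ (W.comap (inc e)) (by
    obtain ⟨_, ⟨v, rfl⟩, hv, hv'⟩ := h1
    intro h
    have : v ∈ W.comap (inc e) := (hW _).2 hv'
    rw [h, Submodule.mem_bot] at this
    exact hv (by simp [this])) (by
    obtain ⟨_, ⟨v, rfl⟩, hv'⟩ := h2
    intro h
    have : v ∈ W.comap (inc e) := h ▸ trivial
    exact hv' ((hW _).1 this))
  have key : ∀ Q ∈ s, Mk e e' σ f σ' f' z =
      ∑ M, bl e (fun M => σ (M * (1 + Q))) f M * bl e' σ' f' (conjEquiv z M) := by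
    intro Q hQ
    obtain ⟨R, hR1, hR2, hR3⟩ := exists_extension e W Q (hs1 Q hQ).1 (hs1 Q hQ).2
    have hRR : R * R = 0 := by
      refine eq_zero_of_mulVec fun v => ?_
      rw [← Matrix.mulVec_mulVec, hR3 _ (hR1 _).1]
    have hQQ : Q * Q = 0 := by
      refine eq_zero_of_mulVec fun v => ?_
      rw [← Matrix.mulVec_mulVec, (hs1 Q hQ).1 _ ((hs1 Q hQ).2 _)]
    obtain ⟨T, hT⟩ := eq_blk_of_range e R (fun v => (hR1 v).2) Q hR2
    obtain ⟨T', hT'⟩ := eq_blk_of_range e' (conjEquiv z R) (by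
      intro v
      rw [conjEquiv_apply, Matrix.mul_assoc, ← Matrix.mulVec_mulVec, ← Matrix.mulVec_mulVec]
      exact (hW _).1 (hR1 _).1) 0 (by
      intro v
      rw [conjEquiv_apply, Matrix.mul_assoc, ← Matrix.mulVec_mulVec, ← Matrix.mulVec_mulVec, hR3]
      · simp
      · rw [hW, Matrix.mulVec_mulVec]
        simp [VA])
    let u : Matrix N N F ≃ Matrix N N F :=
      { toFun := fun M => M * (1 + R)
        invFun := fun M => M * (1 - R)
        left_inv := fun M => by
          simp only [Matrix.mul_assoc]
          rw [show (1 + R) * (1 - R) = 1 by rw [add_mul, mul_sub, mul_sub, hRR]; simp,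
            Matrix.mul_one]
        right_inv := fun M => by
          simp only [Matrix.mul_assoc]
          rw [show (1 - R) * (1 + R) = 1 by rw [sub_mul, mul_add, mul_add, hRR]; simp,
            Matrix.mul_one] }
    unfold Mk
    rw [← Equiv.sum_comp u]
    refine Finset.sum_congr rfl fun M _ => ?_
    congr 1
    · change bl e σ f (M * (1 + R)) = _
      obtain ⟨a, b, c, d, rfl⟩ := exists_blk e M
      rw [hT, bl_mul_one_add e σ f Q T hQQ]
    · have : conjEquiv z (u M) = conjEquiv z M * (1 + blk e' 0 T' 0 0) := by
        rw [← hT', mul_add, mul_one]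
        change conjEquiv z (M * (1 + R)) = _
        rw [conjEquiv_apply, conjEquiv_apply, conjEquiv_apply, mul_add, mul_one, mul_add, add_mul]
        simp [Matrix.mul_assoc]
      rw [this]
      obtain ⟨a, b, c, d, h⟩ := exists_blk e' (conjEquiv z M)
      rw [h, bl_mul_one_add e' σ' f' 0 T' (by simp)]
      simp
  have hsum : (s.card : ℂ) * Mk e e' σ f σ' f' z = 0 := by
    rw [← nsmul_eq_mul, ← Finset.sum_const, Finset.sum_congr rfl key, Finset.sum_comm]
    refine Finset.sum_eq_zero fun M _ => ?_
    rw [← Finset.sum_mul]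
    obtain ⟨a, b, c, d, rfl⟩ := exists_blk e M
    by_cases hc : c = 0
    · subst hc
      simp only [bl_blk, ← Finset.sum_mul, hs2, zero_mul]
    · simp [bl_blk_of_ne _ _ _ _ _ _ hc]
  rcases mul_eq_zero.1 hsum with h | h
  · exact absurd h (by exact_mod_cast hs.card_pos.ne')
  · exact h

end Mackey

section Mackey

variable {F : Type} [Field F] [Fintype F]
variable {A B N A' B' K : Type} [Fintype A] [DecidableEq A] [Fintype B] [DecidableEq B] [Fintype N]
  [DecidableEq N] [Fintype A'] [DecidableEq A'] [Fintype B'] [DecidableEq B'] [Fintype K]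
  [DecidableEq K]

/-- The group element matches the coordinate subspaces of the two frames. -/
def Same (e : A ⊕ B ≃ N) (e' : A' ⊕ B' ≃ N) (z : GL N F) : Prop :=
  ∀ v, v ∈ VA (F := F) e ↔ (z : Matrix N N F) *ᵥ v ∈ VA e'

/-- The group element moves the first coordinate subspace off the second one. -/
def Apart (e : A ⊕ B ≃ N) (e' : A' ⊕ B' ≃ N) (z : GL N F) : Prop :=
  ∀ v ∈ VA (F := F) e, (z : Matrix N N F) *ᵥ v ∈ VA e' → v = 0

theorem Mk_eq_zero_of_not (e : A ⊕ B ≃ N) (e' : A' ⊕ B' ≃ N) {σ : Matrix A A F → ℂ}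
    (f : Matrix B B F → ℂ) {σ' : Matrix A' A' F → ℂ} (f' : Matrix B' B' F → ℂ) (hσ : CuspFn σ)
    (hσ' : CuspFn σ') (z : GL N F) (h1 : ¬ Same e e' z) (h2 : ¬ Apart e e' z) :
    Mk e e' σ f σ' f' z = 0 := by
  unfold Apart at h2
  push Not at h2
  obtain ⟨v, hv, hv', hv0⟩ := h2
  by_cases h3 : ∃ v ∈ VA (F := F) e, (z : Matrix N N F) *ᵥ v ∉ VA e'
  · exact Mk_eq_zero e e' f σ' f' hσ z ⟨v, hv, hv0, hv'⟩ h3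
  · push Not at h3
    have h4 : ∃ w, w ∉ VA (F := F) e ∧ (z : Matrix N N F) *ᵥ w ∈ VA e' := by
      by_contra h4
      push Not at h4
      exact h1 fun w => ⟨h3 w, fun h => by_contra fun hw => h4 w hw h⟩
    obtain ⟨w, hw, hw'⟩ := h4
    have hz : ∀ v : N → F, ((z⁻¹ : GL N F) : Matrix N N F) *ᵥ (z : Matrix N N F) *ᵥ v = v := by
      intro v
      rw [Matrix.mulVec_mulVec, ← Units.val_mul, inv_mul_cancel]
      simp
    rw [Mk_symm]
    refine Mk_eq_zero e' e f' σ f hσ' z⁻¹ ⟨_, hv', ?_, ?_⟩ ⟨_, hw', ?_⟩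
    · intro h
      apply hv0
      rw [← hz v, h, Matrix.mulVec_zero]
    · rwa [hz]
    · rwa [hz]

theorem not_apart_of_same [Nonempty A] (e : A ⊕ B ≃ N) (e' : A' ⊕ B' ≃ N) {z : GL N F}
    (h : Same e e' z) : ¬ Apart e e' z := by
  intro h'
  have a := Classical.arbitrary A
  have h1 := h' (inc e (Pi.single a 1)) ⟨_, rfl⟩ ((h _).1 ⟨_, rfl⟩)
  have h2 := inc_injective (F := F) e (h1.trans (map_zero _).symm)
  have h3 := congrFun h2 a
  simp at h3

open Classical in
theorem sum_Mk [Nonempty A] (e : A ⊕ B ≃ N) (e' : A' ⊕ B' ≃ N) {σ : Matrix A A F → ℂ}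
    (f : Matrix B B F → ℂ) {σ' : Matrix A' A' F → ℂ} (f' : Matrix B' B' F → ℂ) (hσ : CuspFn σ)
    (hσ' : CuspFn σ') : ∑ z, Mk e e' σ f σ' f' z =
      (∑ z with Same e e' z, Mk e e' σ f σ' f' z) +
        ∑ z with Apart e e' z, Mk e e' σ f σ' f' z := by
  rw [← Finset.sum_union]
  · symm
    apply Finset.sum_subset (Finset.subset_univ _)
    intro z _ hz
    simp only [Finset.mem_union, Finset.mem_filter, Finset.mem_univ, true_and, not_or] at hz
    exact Mk_eq_zero_of_not e e' f f' hσ hσ' z hz.1 hz.2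
  · rw [Finset.disjoint_filter]
    exact fun z _ h => not_apart_of_same e e' h

theorem finrank_VA (e : A ⊕ B ≃ N) : Module.finrank F (VA (F := F) e) = Fintype.card A := by
  rw [VA, LinearMap.finrank_range_of_inj (inc_injective e), Module.finrank_pi]

theorem mulVec_injective_GL (z : GL N F) :
    Function.Injective fun v : N → F => (z : Matrix N N F) *ᵥ v :=
  Matrix.mulVec_injective_of_isUnit z.isUnit

theorem card_eq_of_same (e : A ⊕ B ≃ N) (e' : A' ⊕ B' ≃ N) {z : GL N F} (h : Same e e' z) :
    Fintype.card A = Fintype.card A' := by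
  rw [← finrank_VA (F := F) e, ← finrank_VA (F := F) e']
  have : VA (F := F) e = (VA e').comap (Matrix.toLin' (z : Matrix N N F)) := by
    ext v
    rw [h v, Submodule.mem_comap, Matrix.toLin'_apply]
  let t : (N → F) ≃ₗ[F] (N → F) := LinearEquiv.ofBijective (Matrix.toLin' (z : Matrix N N F))
    ((LinearMap.injective_iff_surjective.1 (mulVec_injective_GL z)) |> fun h =>
      ⟨mulVec_injective_GL z, h⟩)
  have h2 : (VA (F := F) e).map t.toLinearMap = VA e' := by
    rw [this]
    exact Submodule.map_comap_eq_of_surjective t.surjective _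
  rw [← h2]
  exact (LinearEquiv.finrank_eq (t.submoduleMap (VA e)))

theorem inj_of_apart (e : A ⊕ B ≃ N) (e' : A' ⊕ B' ≃ N) {z : GL N F} (h : Apart e e' z) :
    Function.Injective (((Matrix.toLin' (z : Matrix N N F)) ∘ₗ inc e).coprod (inc e')) := by
  rw [← LinearMap.ker_eq_bot, LinearMap.ker_eq_bot']
  rintro ⟨u, u'⟩ hu
  simp only [LinearMap.coprod_apply, LinearMap.comp_apply, Matrix.toLin'_apply] at hu
  have h1 := h (inc e u) ⟨u, rfl⟩ (by
    rw [eq_neg_of_add_eq_zero_left hu]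
    exact neg_mem (LinearMap.mem_range_self (inc e') u'))
  have hu0 : u = 0 := inc_injective e (h1.trans (map_zero _).symm)
  subst hu0
  simp only [map_zero, Matrix.mulVec_zero, zero_add] at hu
  rw [inc_injective e' (hu.trans (map_zero _).symm), Prod.mk_zero_zero]

theorem card_le_of_apart (e : A ⊕ B ≃ N) (e' : A' ⊕ B' ≃ N) {z : GL N F} (h : Apart e e' z) :
    Fintype.card A + Fintype.card A' ≤ Fintype.card N := by
  have := LinearMap.finrank_le_finrank_of_injective (inj_of_apart e e' h)
  simpa using this

theorem same_iff_mem_Par (e : A ⊕ B ≃ N) (z : GL N F) : Same e e z ↔ z ∈ Par e := by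
  rw [mem_Par_iff]
  constructor
  · exact fun h v => (h v).1
  · intro h v
    refine ⟨h v, fun hv => ?_⟩
    have h1 := (mem_Par_iff e z⁻¹).1 ((Par e).inv_mem ((mem_Par_iff e z).2 h)) _ hv
    rwa [Matrix.mulVec_mulVec, ← Units.val_mul, inv_mul_cancel, Units.val_one,
      Matrix.one_mulVec] at h1

theorem Mk_one_self (e : A ⊕ B ≃ N) (σ : Matrix A A F → ℂ)
    (f : Matrix B B F → ℂ) (σ' : Matrix A A F → ℂ) (f' : Matrix B B F → ℂ) :
    Mk e e σ f σ' f' 1 = pc (F := F) e * (pr σ σ' * pr f f') := by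
  unfold Mk
  simp only [conjEquiv_one]
  rw [sum_bl_mul, pc_eq]
  unfold pr
  simp only [bl_blk, Finset.sum_const, Finset.card_univ, nsmul_eq_mul, ← Finset.mul_sum,
    ← Nat.card_eq_fintype_card]
  have h1 := glc_ne_zero (F := F) (N := A)
  have h2 := glc_ne_zero (F := F) (N := B)
  have h3 : ∑ a, ∑ d, σ a * f d * (σ' a * f' d) = (∑ a, σ a * σ' a) * ∑ d, f d * f' d := by
    rw [Finset.sum_mul_sum]
    refine Finset.sum_congr rfl fun a _ => Finset.sum_congr rfl fun d _ => ?_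
    ring
  rw [h3]
  field_simp

open Classical in
theorem sum_same (e : A ⊕ B ≃ N) {σ : Matrix A A F → ℂ} {f : Matrix B B F → ℂ}
    {σ' : Matrix A A F → ℂ} {f' : Matrix B B F → ℂ} (hσ : IsCl σ)
    (hf : IsCl f) (hσ' : IsCl σ') (hf' : IsCl f') :
    (pc (F := F) e)⁻¹ * (pc (F := F) e)⁻¹ * ∑ z with Same e e z, Mk e e σ f σ' f' z =
      pr σ σ' * pr f f' := by
  have h : ∀ z ∈ (Finset.univ.filter (Same e e) : Finset (GL N F)), Mk e e σ f σ' f' z =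
      pc (F := F) e * (pr σ σ' * pr f f') := by
    intro z hz
    simp only [Finset.mem_filter, Finset.mem_univ, true_and, same_iff_mem_Par] at hz
    rw [← Mk_one_self e, ← Mk_mul e e hσ hf hσ' hf' z 1 1 hz (Par e).one_mem, mul_one, mul_one]
  rw [Finset.sum_congr rfl h, Finset.sum_const]
  have h2 : ((Finset.univ.filter (Same e e) : Finset (GL N F)).card : ℂ) = pc (F := F) e := by
    rw [pc]
    congr 1
    symm
    refine Nat.subtype_card _ fun z => ?_
    simp only [Finset.mem_filter, Finset.mem_univ, true_and, same_iff_mem_Par]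
  have h3 := pc_ne_zero (F := F) e
  rw [nsmul_eq_mul, h2]
  field_simp

end Mackey

section GenericPart

variable {F : Type} [Field F] [Fintype F]
variable {A A' K : Type} [Fintype A] [DecidableEq A] [Fintype A'] [DecidableEq A'] [Fintype K]
  [DecidableEq K]

variable (A A' K) in
/-- The frame in which the first two blocks are exchanged. -/
def swapFrame : A' ⊕ (A ⊕ K) ≃ A ⊕ (A' ⊕ K) where
  toFun := Sum.elim (fun a => Sum.inr (Sum.inl a)) (Sum.elim Sum.inl fun k => Sum.inr (Sum.inr k))
  invFun := Sum.elim (fun a => Sum.inr (Sum.inl a)) (Sum.elim Sum.inl fun k => Sum.inr (Sum.inr k))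
  left_inv := by rintro (i | i | i) <;> rfl
  right_inv := by rintro (i | i | i) <;> rfl

theorem blk_swap (a : Matrix A A F) (b₁ : Matrix A A' F) (b₂ : Matrix A K F) (p : Matrix A' A' F)
    (q : Matrix A' K F) (r : Matrix K A' F) (s : Matrix K K F) :
    blk (Equiv.refl _) a (fromCols b₁ b₂) 0 (blk (Equiv.refl _) p q r s) =
      blk (swapFrame A A' K) p (fromCols 0 q) (fromRows b₁ r) (blk (Equiv.refl _) a b₂ 0 s) := by
  ext (i | i | i) (j | j | j) <;> rfl

theorem bl_blk_swap (σ' : Matrix A' A' F → ℂ) (f' : Matrix (A ⊕ K) (A ⊕ K) F → ℂ)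
    (a : Matrix A A F) (b₁ : Matrix A A' F) (b₂ : Matrix A K F) (p : Matrix A' A' F)
    (q : Matrix A' K F) (r : Matrix K A' F) (s : Matrix K K F) (h : ¬ (b₁ = 0 ∧ r = 0)) :
    bl (swapFrame A A' K) σ' f'
      (blk (Equiv.refl _) a (fromCols b₁ b₂) 0 (blk (Equiv.refl _) p q r s)) = 0 := by
  rw [blk_swap, bl_blk_of_ne]
  intro h0
  apply h
  constructor
  · ext i j
    exact congrFun (congrFun h0 (Sum.inl i)) j
  · ext i j
    exact congrFun (congrFun h0 (Sum.inr i)) j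

theorem sum_fromCols (φ : Matrix A (A' ⊕ K) F → ℂ) :
    ∑ b, φ b = ∑ b₁, ∑ b₂, φ (fromCols b₁ b₂) := by
  rw [← Fintype.sum_prod_type']
  symm
  refine Fintype.sum_bijective (fun p : Matrix A A' F × Matrix A K F => fromCols p.1 p.2)
    ⟨?_, ?_⟩ _ _ fun _ => rfl
  · rintro ⟨a, b⟩ ⟨a', b'⟩ h
    refine Prod.ext ?_ ?_
    · ext i j
      exact congrFun (congrFun h i) (Sum.inl j)
    · ext i j
      exact congrFun (congrFun h i) (Sum.inr j)
  · intro M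
    exact ⟨(M.toCols₁, M.toCols₂), fromCols_toCols M⟩

/-- The number of matrices in the intersection of the two parabolic subgroups, up to
the order of the last block. -/
noncomputable def ic (F A A' K : Type) [Field F] [Fintype F] [Fintype A] [DecidableEq A]
    [Fintype A'] [DecidableEq A'] [Fintype K] [DecidableEq K] : ℂ :=
  glc F K * (glc F A * Nat.card (Matrix A K F)) * (glc F A' * Nat.card (Matrix A' K F))

theorem Mk_one_swap (σ : Matrix A A F → ℂ) (f : Matrix (A' ⊕ K) (A' ⊕ K) F → ℂ)
    (σ' : Matrix A' A' F → ℂ) (f' : Matrix (A ⊕ K) (A ⊕ K) F → ℂ) :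
    Mk (Equiv.refl _) (swapFrame A A' K) σ f σ' f' 1 =
      ic F A A' K * pr (Ef (Equiv.refl _) σ' f) (Ef (Equiv.refl _) σ f') := by
  unfold Mk
  simp only [conjEquiv_one]
  rw [sum_bl_mul]
  have h : ∀ a : Matrix A A F, ∑ b, ∑ d, σ a * f d *
      bl (swapFrame A A' K) σ' f' (blk (Equiv.refl _) a b 0 d) =
      ∑ b₂ : Matrix A K F, ∑ p, ∑ q, ∑ s, σ a * f (blk (Equiv.refl _) p q 0 s) *
        (σ' p * f' (blk (Equiv.refl _) a b₂ 0 s)) := by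
    intro a
    rw [sum_fromCols, Finset.sum_eq_single 0]
    · refine Finset.sum_congr rfl fun b₂ _ => ?_
      rw [sum_blk (Equiv.refl _)]
      refine Finset.sum_congr rfl fun p _ => Finset.sum_congr rfl fun q _ => ?_
      rw [Finset.sum_eq_single 0]
      · refine Finset.sum_congr rfl fun s _ => ?_
        rw [blk_swap]
        have : fromRows (0 : Matrix A A' F) (0 : Matrix K A' F) = 0 := by
          ext (i | i) j <;> rfl
        rw [this, bl_blk]
      · intro r _ hr
        refine Finset.sum_eq_zero fun s _ => ?_
        rw [bl_blk_swap _ _ _ _ _ _ _ _ _ (fun h => hr h.2), mul_zero]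
      · simp
    · intro b₁ _ hb
      refine Finset.sum_eq_zero fun b₂ _ => ?_
      rw [sum_blk (Equiv.refl _)]
      refine Finset.sum_eq_zero fun p _ => Finset.sum_eq_zero fun q _ =>
        Finset.sum_eq_zero fun r _ => Finset.sum_eq_zero fun s _ => ?_
      rw [bl_blk_swap _ _ _ _ _ _ _ _ _ (fun h => hb h.1), mul_zero]
    · simp
  rw [Finset.sum_congr rfl fun a _ => h a]
  unfold pr Ef ic
  have h1 := glc_ne_zero (F := F) (N := A)
  have h2 := glc_ne_zero (F := F) (N := A')
  have h3 := glc_ne_zero (F := F) (N := K)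
  have h4 : (Nat.card (Matrix A K F) : ℂ) ≠ 0 := by exact_mod_cast Nat.card_pos.ne'
  have h5 : (Nat.card (Matrix A' K F) : ℂ) ≠ 0 := by exact_mod_cast Nat.card_pos.ne'
  have h6 : ∀ s : Matrix K K F, ((glc F A' * Nat.card (Matrix A' K F) : ℂ)⁻¹ *
        ∑ p, ∑ q, σ' p * f (blk (Equiv.refl _) p q 0 s)) *
      ((glc F A * Nat.card (Matrix A K F) : ℂ)⁻¹ *
        ∑ a, ∑ b, σ a * f' (blk (Equiv.refl _) a b 0 s)) =
      ((glc F A' * Nat.card (Matrix A' K F) : ℂ)⁻¹ * (glc F A * Nat.card (Matrix A K F) : ℂ)⁻¹) *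
      ∑ a, ∑ b, ∑ p, ∑ q, σ a * f (blk (Equiv.refl _) p q 0 s) *
        (σ' p * f' (blk (Equiv.refl _) a b 0 s)) := by
    intro s
    rw [mul_mul_mul_comm]
    congr 1
    rw [mul_comm, Finset.sum_mul]
    refine Finset.sum_congr rfl fun a _ => ?_
    rw [Finset.sum_mul]
    refine Finset.sum_congr rfl fun b _ => ?_
    rw [Finset.mul_sum]
    refine Finset.sum_congr rfl fun p _ => ?_
    rw [Finset.mul_sum]
    refine Finset.sum_congr rfl fun q _ => ?_
    ring
  rw [Finset.sum_congr rfl fun s _ => h6 s, ← Finset.mul_sum]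
  have h7 : ∑ s : Matrix K K F, ∑ a, ∑ b, ∑ p, ∑ q, σ a * f (blk (Equiv.refl _) p q 0 s) *
        (σ' p * f' (blk (Equiv.refl _) a b 0 s)) =
      ∑ a, ∑ b, ∑ p, ∑ q, ∑ s : Matrix K K F, σ a * f (blk (Equiv.refl _) p q 0 s) *
        (σ' p * f' (blk (Equiv.refl _) a b 0 s)) := by
    rw [Finset.sum_comm]
    refine Finset.sum_congr rfl fun a _ => ?_
    rw [Finset.sum_comm]
    refine Finset.sum_congr rfl fun b _ => ?_
    rw [Finset.sum_comm]
    refine Finset.sum_congr rfl fun p _ => ?_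
    rw [Finset.sum_comm]
  rw [h7]
  field_simp

theorem Ef_un : Ef (Equiv.refl (A ⊕ K)) un un = (un : Matrix K K F → ℂ) := by
  classical
  funext k
  unfold Ef
  have : ∀ (a : Matrix A A F) (b : Matrix A K F), (un a : ℂ) * un (blk (Equiv.refl _) a b 0 k) =
      un a * un k := by
    intro a b
    unfold un
    simp only [isUnit_blk]
    by_cases h : IsUnit a <;> simp [h]
  have h1 := glc_ne_zero (F := F) (N := A)
  have h4 : (Nat.card (Matrix A K F) : ℂ) ≠ 0 := by exact_mod_cast Nat.card_pos.ne'
  simp only [this, Finset.sum_const, Finset.card_univ, nsmul_eq_mul, ← Nat.card_eq_fintype_card]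
  rw [← Finset.mul_sum, ← Finset.sum_mul, sum_un]
  field_simp

theorem pr_un_un : pr (un : Matrix K K F → ℂ) un = 1 := by
  classical
  unfold pr
  have : ∀ M : Matrix K K F, (un M * un M : ℂ) = un M := by
    intro M
    unfold un
    split_ifs <;> simp
  simp only [this, sum_un]
  exact inv_mul_cancel₀ glc_ne_zero

theorem ic_eq : ic F A A' K =
    Nat.card (Par (F := F) (Equiv.refl (A ⊕ (A' ⊕ K))) ⊓ Par (swapFrame A A' K) :
      Subgroup (GL (A ⊕ (A' ⊕ K)) F)) := by
  classical
  have h := Mk_one_swap (F := F) (A := A) (A' := A') (K := K) un un un un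
  rw [Ef_un, Ef_un, pr_un_un, mul_one] at h
  rw [← h]
  unfold Mk
  rw [sum_units]
  · simp only [conjEquiv_one, bl_un, ← ite_and, mul_ite, mul_one, mul_zero]
    rw [Finset.sum_boole]
    congr 1
    symm
    refine Nat.subtype_card _ fun z => ?_
    simp [Subgroup.mem_inf, and_comm]
  · intro M hM
    rw [bl_supp _ un_isCl un_isCl _ hM, zero_mul]

theorem apart_iff (z : GL (A ⊕ (A' ⊕ K)) F) : Apart (Equiv.refl _) (swapFrame A A' K) z ↔
    ∃ p' ∈ Par (swapFrame A A' K), ∃ p ∈ Par (Equiv.refl (A ⊕ (A' ⊕ K))), p' * p = z := by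
  constructor
  · intro h
    have h1 : Apart (F := F) (Equiv.refl (A ⊕ (A' ⊕ K))) (swapFrame A A' K) 1 := by
      rintro v ⟨u, rfl⟩ hv
      rw [Units.val_one, Matrix.one_mulVec] at hv
      obtain ⟨w, hw⟩ := hv
      have : u = 0 := by
        funext i
        have := congrFun hw (Sum.inl i)
        rw [inc_apply, inc_apply] at this
        exact this.symm
      rw [this, map_zero]
    obtain ⟨g, hg⟩ := exists_GL_map _ _ (inj_of_apart _ _ h) (inj_of_apart _ _ h1)
    have hg1 : ∀ u, (g : Matrix (A ⊕ (A' ⊕ K)) (A ⊕ (A' ⊕ K)) F) *ᵥ inc (swapFrame A A' K) u = inc (swapFrame A A' K) u := by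
      intro u
      simpa using hg (0, u)
    have hg2 : ∀ u, (g : Matrix (A ⊕ (A' ⊕ K)) (A ⊕ (A' ⊕ K)) F) *ᵥ
        (z : Matrix (A ⊕ (A' ⊕ K)) (A ⊕ (A' ⊕ K)) F) *ᵥ inc (Equiv.refl (A ⊕ (A' ⊕ K))) u =
        inc (Equiv.refl (A ⊕ (A' ⊕ K))) u := by
      intro u
      simpa using hg (u, 0)
    refine ⟨g⁻¹, (Par _).inv_mem ?_, g * z, ?_, by simp⟩
    · rw [mem_Par_iff]
      rintro _ ⟨u, rfl⟩
      exact ⟨u, (hg1 u).symm⟩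
    · rw [mem_Par_iff]
      rintro _ ⟨u, rfl⟩
      refine ⟨u, ?_⟩
      rw [Units.val_mul, ← Matrix.mulVec_mulVec, hg2]
  · rintro ⟨p', hp', p, hp, rfl⟩ v hv hv'
    have h1 := (mem_Par_iff _ _).1 hp v hv
    have h2 := (mem_Par_iff _ _).1 ((Par _).inv_mem hp') _ hv'
    rw [Units.val_mul, ← Matrix.mulVec_mulVec, Matrix.mulVec_mulVec, ← Units.val_mul,
      inv_mul_cancel, Units.val_one, Matrix.one_mulVec] at h2
    have h3 : (p : Matrix (A ⊕ (A' ⊕ K)) (A ⊕ (A' ⊕ K)) F) *ᵥ v = 0 := by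
      obtain ⟨u, hu⟩ := h1
      obtain ⟨w, hw⟩ := h2
      rw [← hu, inc_apply, inc_apply] at hw
      have : u = 0 := by
        funext i
        exact (congrFun hw (Sum.inl i)).symm
      rw [← hu, this, map_zero]
    exact mulVec_injective_GL p (h3.trans (Matrix.mulVec_zero _).symm)

theorem card_inf_mul_card_mul {G : Type} [Group G] [Fintype G] (H L : Subgroup G) (s : Finset G)
    (hs : ∀ z, z ∈ s ↔ ∃ x ∈ H, ∃ y ∈ L, x * y = z) :
    Nat.card (L ⊓ H : Subgroup G) * s.card = Nat.card L * Nat.card H := by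
  classical
  have h1 : Fintype.card (H × L) = ∑ z ∈ s, (Finset.univ.filter
      fun p : H × L => (p.1 : G) * p.2 = z).card := by
    rw [← Finset.card_univ]
    exact Finset.card_eq_sum_card_fiberwise fun p _ => (hs _).2 ⟨_, p.1.2, _, p.2.2, rfl⟩
  have h2 : ∀ z ∈ s, (Finset.univ.filter fun p : H × L => (p.1 : G) * p.2 = z).card =
      Nat.card (L ⊓ H : Subgroup G) := by
    intro z hz
    obtain ⟨x, hx, y, hy, rfl⟩ := (hs z).1 hz
    rw [Nat.card_eq_fintype_card, ← Finset.card_univ]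
    symm
    refine Finset.card_bij (fun k _ => (⟨x * k, H.mul_mem hx k.2.2⟩,
      ⟨(k : G)⁻¹ * y, L.mul_mem (L.inv_mem k.2.1) hy⟩)) ?_ ?_ ?_
    · intro k _
      simp [mul_assoc]
    · intro k _ k' _ h
      have := congrArg (fun p : H × L => (p.1 : G)) h
      exact Subtype.ext (mul_left_cancel this)
    · rintro ⟨p, q⟩ h
      simp only [Finset.mem_filter, Finset.mem_univ, true_and] at h
      have h3 : x⁻¹ * (p : G) = y * (q : G)⁻¹ := by
        rw [inv_mul_eq_iff_eq_mul, ← mul_assoc, ← h, mul_inv_cancel_right]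
      refine ⟨⟨x⁻¹ * p, ?_, H.mul_mem (H.inv_mem hx) p.2⟩, Finset.mem_univ _, ?_⟩
      · rw [SetLike.mem_coe, h3]
        exact L.mul_mem hy (L.inv_mem q.2)
      · refine Prod.ext (Subtype.ext ?_) (Subtype.ext ?_)
        · simp
        · simp only
          rw [h3]
          simp
  rw [Finset.sum_congr rfl h2, Finset.sum_const, smul_eq_mul, Fintype.card_prod,
    ← Nat.card_eq_fintype_card, ← Nat.card_eq_fintype_card] at h1
  rw [mul_comm, ← h1, mul_comm]

open Classical in
theorem sum_apart {σ : Matrix A A F → ℂ} {f : Matrix (A' ⊕ K) (A' ⊕ K) F → ℂ}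
    {σ' : Matrix A' A' F → ℂ} {f' : Matrix (A ⊕ K) (A ⊕ K) F → ℂ} (hσ : IsCl σ)
    (hf : IsCl f) (hσ' : IsCl σ') (hf' : IsCl f') :
    (pc (F := F) (Equiv.refl (A ⊕ (A' ⊕ K))))⁻¹ * (pc (F := F) (swapFrame A A' K))⁻¹ *
      ∑ z with Apart (Equiv.refl _) (swapFrame A A' K) z,
        Mk (Equiv.refl _) (swapFrame A A' K) σ f σ' f' z =
      pr (Ef (Equiv.refl _) σ' f) (Ef (Equiv.refl _) σ f') := by
  have h : ∀ z ∈ (Finset.univ.filter (Apart (Equiv.refl _) (swapFrame A A' K)) :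
      Finset (GL (A ⊕ (A' ⊕ K)) F)), Mk (Equiv.refl _) (swapFrame A A' K) σ f σ' f' z =
      ic F A A' K * pr (Ef (Equiv.refl _) σ' f) (Ef (Equiv.refl _) σ f') := by
    intro z hz
    simp only [Finset.mem_filter, Finset.mem_univ, true_and, apart_iff] at hz
    obtain ⟨p', hp', p, hp, rfl⟩ := hz
    rw [← Mk_one_swap, ← Mk_mul _ _ hσ hf hσ' hf' p' p 1 hp' hp, mul_one]
  rw [Finset.sum_congr rfl h, Finset.sum_const]
  have h2 := card_inf_mul_card_mul (Par (swapFrame A A' K)) (Par (Equiv.refl (A ⊕ (A' ⊕ K))))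
    (Finset.univ.filter (Apart (F := F) (Equiv.refl _) (swapFrame A A' K)))
    (by
      intro z
      simp only [Finset.mem_filter, Finset.mem_univ, true_and, apart_iff])
  have h3 := pc_ne_zero (F := F) (Equiv.refl (A ⊕ (A' ⊕ K)))
  have h4 := pc_ne_zero (F := F) (swapFrame A A' K)
  have h5 : ic F A A' K * ((Finset.univ.filter (Apart (Equiv.refl _) (swapFrame A A' K)) :
      Finset (GL (A ⊕ (A' ⊕ K)) F)).card : ℂ) =
      pc (F := F) (Equiv.refl (A ⊕ (A' ⊕ K))) * pc (F := F) (swapFrame A A' K) := by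
    rw [ic_eq]
    unfold pc
    exact_mod_cast h2
  rw [nsmul_eq_mul, ← mul_assoc _ (ic F A A' K), mul_comm _ (ic F A A' K), h5]
  field_simp

end GenericPart

section Pairing

variable {F : Type} [Field F] [Fintype F]
variable {A A' B B' N K : Type} [Fintype A] [DecidableEq A] [Fintype A'] [DecidableEq A']
  [Fintype K] [DecidableEq K] [Fintype B] [DecidableEq B] [Fintype B'] [DecidableEq B']
  [Fintype N] [DecidableEq N]

theorem permGL_mulVec (s : N ≃ N) (v : N → F) :
    ((permGL s : GL N F) : Matrix N N F) *ᵥ v = v ∘ s := by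
  change (1 : Matrix N N F).submatrix s id *ᵥ v = _
  funext i
  have := congrFun (Matrix.one_mulVec v) (s i)
  exact this

theorem permGL_mulVec_mem (e e' : A ⊕ B ≃ N) (v : N → F) :
    ((permGL (e.symm.trans e') : GL N F) : Matrix N N F) *ᵥ v ∈ VA e ↔ v ∈ VA (F := F) e' := by
  rw [permGL_mulVec]
  constructor
  · rintro ⟨u, hu⟩
    refine ⟨u, ?_⟩
    rw [inc_apply] at hu ⊢
    funext i
    have := congrFun hu (e (e'.symm i))
    simpa using this
  · rintro ⟨u, rfl⟩
    refine ⟨u, ?_⟩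
    rw [inc_apply, inc_apply]
    funext i
    simp

open Classical in
theorem sum_same_perm (e e' : A ⊕ B ≃ N) (σ : Matrix A A F → ℂ) (f : Matrix B B F → ℂ)
    (σ' : Matrix A A F → ℂ) (f' : Matrix B B F → ℂ) :
    ∑ z with Same e e' z, Mk e e' σ f σ' f' z = ∑ z with Same e e z, Mk e e σ f σ' f' z := by
  refine Finset.sum_equiv (Equiv.mulLeft (permGL (e.symm.trans e'))) (fun z => ?_) fun z _ => ?_
  · rw [Finset.mem_filter, Finset.mem_filter]
    simp only [Finset.mem_univ, true_and, Equiv.coe_mulLeft, Same, Units.val_mul, ← Matrix.mulVec_mulVec, permGL_mulVec_mem]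
  · unfold Mk
    refine Finset.sum_congr rfl fun M _ => ?_
    rw [Equiv.coe_mulLeft, conjEquiv_mul, ← bl_perm]

theorem pr_Tf_Tf_eq_zero [Nonempty A] (e : A ⊕ B ≃ N) (e' : A' ⊕ B' ≃ N) {σ : Matrix A A F → ℂ}
    {f : Matrix B B F → ℂ} {σ' : Matrix A' A' F → ℂ} {f' : Matrix B' B' F → ℂ}
    (hσ' : IsCl σ') (hf' : IsCl f') (cσ : CuspFn σ) (cσ' : CuspFn σ')
    (h1 : Fintype.card A ≠ Fintype.card A')
    (h2 : Fintype.card N < Fintype.card A + Fintype.card A') :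
    pr (Tf e σ f) (Tf e' σ' f') = 0 := by
  classical
  rw [pr_Tf_Tf e e' hσ' hf', sum_Mk e e' f f' cσ cσ', Finset.sum_eq_zero, Finset.sum_eq_zero]
  · simp
  · intro z hz
    have := card_le_of_apart e e' (by simpa using hz)
    omega
  · intro z hz
    exact absurd (card_eq_of_same e e' (by simpa using hz)) h1

theorem pr_Tf_Tf_of_card_lt [Nonempty A] (e : A ⊕ B ≃ N) {σ : Matrix A A F → ℂ}
    {f : Matrix B B F → ℂ} {σ' : Matrix A A F → ℂ} {f' : Matrix B B F → ℂ} (hσ : IsCl σ)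
    (hf : IsCl f) (hσ' : IsCl σ') (hf' : IsCl f') (cσ : CuspFn σ) (cσ' : CuspFn σ')
    (h2 : Fintype.card N < Fintype.card A + Fintype.card A) :
    pr (Tf e σ f) (Tf e σ' f') = pr σ σ' * pr f f' := by
  classical
  rw [pr_Tf_Tf e e hσ' hf', sum_Mk e e f f' cσ cσ', mul_add, sum_same e hσ hf hσ' hf',
    Finset.sum_eq_zero, mul_zero, add_zero]
  intro z hz
  have := card_le_of_apart e e (by simpa using hz)
  omega

theorem pr_Tf_Tf_of_ne [Nonempty A] {σ : Matrix A A F → ℂ} {f : Matrix (A' ⊕ K) (A' ⊕ K) F → ℂ}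
    {σ' : Matrix A' A' F → ℂ} {f' : Matrix (A ⊕ K) (A ⊕ K) F → ℂ} (hσ : IsCl σ)
    (hf : IsCl f) (hσ' : IsCl σ') (hf' : IsCl f') (cσ : CuspFn σ) (cσ' : CuspFn σ')
    (h1 : Fintype.card A ≠ Fintype.card A') :
    pr (Tf (Equiv.refl _) σ f) (Tf (swapFrame A A' K) σ' f') =
      pr (Ef (Equiv.refl _) σ' f) (Ef (Equiv.refl _) σ f') := by
  classical
  rw [pr_Tf_Tf _ _ hσ' hf', sum_Mk _ _ f f' cσ cσ', mul_add, sum_apart hσ hf hσ' hf',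
    Finset.sum_eq_zero, mul_zero, zero_add]
  intro z hz
  exact absurd (card_eq_of_same _ _ (by simpa using hz)) h1

theorem pr_Tf_Tf_of_eq [Nonempty A] {σ : Matrix A A F → ℂ} {f : Matrix (A ⊕ K) (A ⊕ K) F → ℂ}
    {σ' : Matrix A A F → ℂ} {f' : Matrix (A ⊕ K) (A ⊕ K) F → ℂ} (hσ : IsCl σ)
    (hf : IsCl f) (hσ' : IsCl σ') (hf' : IsCl f') (cσ : CuspFn σ) (cσ' : CuspFn σ') :
    pr (Tf (Equiv.refl (A ⊕ (A ⊕ K))) σ f) (Tf (Equiv.refl _) σ' f') =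
      pr σ σ' * pr f f' + pr (Ef (Equiv.refl _) σ' f) (Ef (Equiv.refl _) σ f') := by
  classical
  have h := pr_Tf_Tf (Equiv.refl (A ⊕ (A ⊕ K))) (swapFrame A A K) (σ := σ) (f := f) hσ' hf'
  rw [sum_Mk _ _ f f' cσ cσ', mul_add, sum_apart hσ hf hσ' hf'] at h
  rw [Tf_frame (Equiv.refl (A ⊕ (A ⊕ K))) (swapFrame A A K) σ' f', h]
  congr 1
  rw [← sum_same (Equiv.refl (A ⊕ (A ⊕ K))) hσ hf hσ' hf', pc_congr (swapFrame A A K)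
    (Equiv.refl (A ⊕ (A ⊕ K)))]
  congr 1
  exact sum_same_perm _ _ σ f σ' f'

end Pairing

section Star

variable {F : Type} [Field F] [Fintype F]
variable {A B N : Type} [Fintype A] [DecidableEq A] [Fintype B] [DecidableEq B] [Fintype N]
  [DecidableEq N]

/-- The function `M ↦ f M⁻¹`. -/
noncomputable def st (f : Matrix N N F → ℂ) (M : Matrix N N F) : ℂ := f M⁻¹

theorem st_isCl {f : Matrix N N F → ℂ} (hf : IsCl f) : IsCl (st f) where
  supp M hM := hf.supp _ (by rwa [Matrix.isUnit_nonsing_inv_iff])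
  conj x M := by
    unfold st
    rw [Matrix.mul_inv_rev, Matrix.mul_inv_rev, ← Matrix.coe_units_inv, inv_inv,
      ← Matrix.coe_units_inv, ← Matrix.mul_assoc, hf.conj]

theorem st_st {f : Matrix N N F → ℂ} (hf : IsCl f) : st (st f) = f := by
  funext M
  unfold st
  by_cases hM : IsUnit M
  · rw [Matrix.nonsing_inv_nonsing_inv _ ((Matrix.isUnit_iff_isUnit_det M).1 hM)]
  · rw [hf.supp M hM, hf.supp]
    rwa [Matrix.isUnit_nonsing_inv_iff, Matrix.isUnit_nonsing_inv_iff]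

theorem st_coe (f : Matrix N N F → ℂ) (x : GL N F) :
    st f (x : Matrix N N F) = f ((x⁻¹ : GL N F) : Matrix N N F) := by
  rw [Matrix.coe_units_inv]
  rfl

theorem pr_st_st {f : Matrix N N F → ℂ} (hf : IsCl f) (g : Matrix N N F → ℂ) :
    pr (st f) (st g) = pr f g := by
  unfold pr
  congr 1
  rw [sum_units, sum_units (fun M => f M * g M), ← Equiv.sum_comp (Equiv.inv (GL N F))]
  · refine Finset.sum_congr rfl fun x _ => ?_
    rw [st_coe, st_coe]
    simp
  · intro M hM
    rw [hf.supp M hM, zero_mul]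
  · intro M hM
    rw [(st_isCl hf).supp M hM, zero_mul]

theorem blk_inv (e : A ⊕ B ≃ N) (a : Matrix A A F) (b : Matrix A B F) (d : Matrix B B F)
    (ha : IsUnit a) (hd : IsUnit d) :
    (blk e a b 0 d)⁻¹ = blk e a⁻¹ (-(a⁻¹ * b * d⁻¹)) 0 d⁻¹ := by
  apply Matrix.inv_eq_right_inv
  have h1 := Matrix.mul_nonsing_inv _ ((Matrix.isUnit_iff_isUnit_det a).1 ha)
  have h2 := Matrix.mul_nonsing_inv _ ((Matrix.isUnit_iff_isUnit_det d).1 hd)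
  rw [blk_mul]
  simp only [Matrix.mul_zero, Matrix.zero_mul, add_zero, zero_add, h1, h2, Matrix.mul_neg]
  rw [← Matrix.mul_assoc, ← Matrix.mul_assoc, h1, Matrix.one_mul, neg_add_cancel, neg_zero, zero_add, blk_one]

theorem bl_st (e : A ⊕ B ≃ N) {σ : Matrix A A F → ℂ} {f : Matrix B B F → ℂ} (hσ : IsCl σ)
    (hf : IsCl f) : bl e (st σ) (st f) = st (bl e σ f) := by
  have key : ∀ (σ : Matrix A A F → ℂ) (f : Matrix B B F → ℂ) (M : Matrix N N F), IsUnit M →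
      (M.submatrix e e).toBlocks₂₁ = 0 → bl e (st σ) (st f) M = bl e σ f M⁻¹ := by
    intro σ f M hM h
    obtain ⟨a, b, c, d, rfl⟩ := exists_blk e M
    have hc : c = 0 := by simpa [blk] using h
    subst hc
    rw [isUnit_blk] at hM
    rw [blk_inv e a b d hM.1 hM.2, bl_blk, bl_blk]
    rfl
  funext M
  by_cases hM : IsUnit M
  · by_cases h : (M.submatrix e e).toBlocks₂₁ = 0
    · exact key σ f M hM h
    · have h1 : bl e (st σ) (st f) M = 0 := by simp [bl, h]
      rw [h1]
      by_cases h' : (M⁻¹.submatrix e e).toBlocks₂₁ = 0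
      · have hM' := Matrix.isUnit_nonsing_inv_iff.2 hM
        have h2 := key (st σ) (st f) M⁻¹ hM' h'
        rw [Matrix.nonsing_inv_nonsing_inv _ ((Matrix.isUnit_iff_isUnit_det M).1 hM), st_st hσ,
          st_st hf] at h2
        unfold st at h2 ⊢
        rw [h2]
        simp [bl, h]
      · simp [st, bl, h']
  · rw [bl_supp e (st_isCl hσ) (st_isCl hf) M hM]
    unfold st
    rw [bl_supp e hσ hf]
    rwa [Matrix.isUnit_nonsing_inv_iff]

theorem conjEquiv_inv (x : GL N F) (M : Matrix N N F) :
    (conjEquiv x M)⁻¹ = conjEquiv x M⁻¹ := by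
  rw [conjEquiv_apply, conjEquiv_apply, Matrix.mul_inv_rev, Matrix.mul_inv_rev,
    ← Matrix.coe_units_inv, inv_inv, ← Matrix.coe_units_inv, ← Matrix.mul_assoc]

theorem Tf_st (e : A ⊕ B ≃ N) {σ : Matrix A A F → ℂ} {f : Matrix B B F → ℂ} (hσ : IsCl σ)
    (hf : IsCl f) : Tf e (st σ) (st f) = st (Tf e σ f) := by
  funext M
  unfold Tf
  rw [bl_st e hσ hf]
  unfold st
  simp only [conjEquiv_inv]

theorem Ef_st (e : A ⊕ B ≃ N) {σ : Matrix A A F → ℂ} {g : Matrix N N F → ℂ} (hσ : IsCl σ)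
    (hg : IsCl g) : Ef e σ (st g) = st (Ef e (st σ) g) := by
  funext k
  by_cases hk : IsUnit k
  · unfold Ef
    simp only [st, ← Finset.mul_sum]
    congr 1
    change _ = ∑ a, st σ a * ∑ b, g (blk e a b 0 k⁻¹)
    rw [sum_units, sum_units (fun a => st σ a * _), ← Equiv.sum_comp (Equiv.inv (GL A F))]
    · refine Finset.sum_congr rfl fun x _ => ?_
      simp only [Equiv.inv_apply, st_coe]
      congr 1
      let t : Matrix A B F ≃ Matrix A B F :=
        { toFun := fun b => -(((x⁻¹ : GL A F) : Matrix A A F) * b * k)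
          invFun := fun b => -((x : Matrix A A F) * b * k⁻¹)
          left_inv := fun b => by
            have h2 := Matrix.mul_nonsing_inv _ ((Matrix.isUnit_iff_isUnit_det k).1 hk)
            simp [Matrix.mul_assoc, h2]
          right_inv := fun b => by
            have h2 := Matrix.nonsing_inv_mul _ ((Matrix.isUnit_iff_isUnit_det k).1 hk)
            simp [Matrix.mul_assoc, h2] }
      rw [← Equiv.sum_comp t]
      refine Finset.sum_congr rfl fun b _ => ?_
      rw [blk_inv e _ _ _ (Units.isUnit _) hk]
      congr 2
      · rw [← Matrix.coe_units_inv, inv_inv]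
      · have h2 := Matrix.mul_nonsing_inv _ ((Matrix.isUnit_iff_isUnit_det k).1 hk)
        change -(_ * -(((x⁻¹ : GL A F) : Matrix A A F) * b * k) * k⁻¹) = b
        rw [← Matrix.coe_units_inv, inv_inv]
        simp [Matrix.mul_assoc, h2]
    · intro a ha
      rw [(st_isCl hσ).supp a ha, zero_mul]
    · intro a ha
      rw [hσ.supp a ha, zero_mul]
  · rw [(Ef_isCl e (st_isCl hg)).supp k hk, (st_isCl (Ef_isCl e hg)).supp k hk]

/-- The symmetric bilinear form on class functions. -/
noncomputable def bf (f g : Matrix N N F → ℂ) : ℂ := pr f (st g)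

theorem bf_comm {f g : Matrix N N F → ℂ} (hf : IsCl f) (hg : IsCl g) : bf f g = bf g f := by
  unfold bf
  rw [← pr_st_st hf (st g), st_st hg, pr_comm]

theorem bf_Tf (e : A ⊕ B ≃ N) {σ : Matrix A A F → ℂ} {f : Matrix B B F → ℂ}
    {g : Matrix N N F → ℂ} (hσ : IsCl σ) (hg : IsCl g) :
    bf (Tf e σ f) g = bf f (Ef e (st σ) g) := by
  unfold bf
  rw [pr_Tf_eq_pr_Ef e σ f (st_isCl hg), Ef_st e hσ hg]

/-- Functions with `f M⁻¹ = conj (f M)`, such as characters. -/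
def Herm (f : Matrix N N F → ℂ) : Prop := ∀ M, st f M = star (f M)

theorem eq_zero_of_bf_self {f : Matrix N N F → ℂ} (h : bf f (fun M => star (st f M)) = 0)
    (hf : IsCl f) : f = 0 := by
  unfold bf pr at h
  have h1 := (mul_eq_zero.1 h).resolve_left (inv_ne_zero glc_ne_zero)
  have h2 : ∀ M, f M * st (fun M => star (st f M)) M = ((‖f M‖ ^ 2 : ℝ) : ℂ) := by
    intro M
    have : st (fun M => star (st f M)) M = star (st (st f) M) := rfl
    rw [this, st_st hf, Complex.star_def, Complex.mul_conj, Complex.normSq_eq_norm_sq]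
  simp only [h2] at h1
  rw [← Complex.ofReal_sum, Complex.ofReal_eq_zero,
    Finset.sum_eq_zero_iff_of_nonneg fun M _ => by positivity] at h1
  funext M
  simpa using h1 M (Finset.mem_univ M)

end Star

section Families

variable {F : Type} [Field F] [Fintype F]

variable (F) in
/-- Families of functions on square matrices of all sizes. -/
abbrev Fam : Type := ∀ n : ℕ, Matrix (Fin n) (Fin n) F → ℂ

/-- Families of class functions. -/
def FCl (f : Fam F) : Prop := ∀ n, IsCl (f n)

/-- Multiplication by a class function on families, given by parabolic induction. -/
noncomputable def T (d : ℕ) (σ : Matrix (Fin d) (Fin d) F → ℂ) (f : Fam F) : Fam F := fun n =>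
  if h : d ≤ n then
    Tf (finSumFinEquiv.trans (finCongr (by omega : d + (n - d) = n))) σ (f (n - d)) else 0

theorem T_eq {d m n : ℕ} (e : Fin d ⊕ Fin m ≃ Fin n) (σ : Matrix (Fin d) (Fin d) F → ℂ)
    (f : Fam F) : T d σ f n = Tf e σ (f m) := by
  have h : d + m = n := by simpa using Fintype.card_congr e
  obtain rfl : m = n - d := by omega
  rw [T, dif_pos (by omega)]
  exact Tf_frame _ _ _ _

theorem T_of_lt {d n : ℕ} (h : n < d) (σ : Matrix (Fin d) (Fin d) F → ℂ)
    (f : Fam F) : T d σ f n = 0 := by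
  rw [T, dif_neg (by omega)]

/-- The operator on families adjoint to multiplication by a class function. -/
noncomputable def D (d : ℕ) (σ : Matrix (Fin d) (Fin d) F → ℂ) (f : Fam F) : Fam F := fun k =>
  Ef finSumFinEquiv (st σ) (f (d + k))

theorem isCl_zero {N : Type} [Fintype N] [DecidableEq N] : IsCl (0 : Matrix N N F → ℂ) :=
  ⟨fun _ _ => rfl, fun _ _ => rfl⟩

theorem IsCl.add {N : Type} [Fintype N] [DecidableEq N] {f g : Matrix N N F → ℂ} (hf : IsCl f)
    (hg : IsCl g) : IsCl (f + g) :=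
  ⟨fun M h => by simp [hf.supp M h, hg.supp M h], fun x M => by
    simp only [Pi.add_apply, hf.conj, hg.conj]⟩

theorem IsCl.smul {N : Type} [Fintype N] [DecidableEq N] {f : Matrix N N F → ℂ} (hf : IsCl f)
    (c : ℂ) : IsCl (c • f) :=
  ⟨fun M h => by simp [hf.supp M h], fun x M => by simp only [Pi.smul_apply, hf.conj]⟩

theorem FCl.T {d : ℕ} {σ : Matrix (Fin d) (Fin d) F → ℂ} {f : Fam F} (hσ : IsCl σ)
    (hf : FCl f) : FCl (T d σ f) := by
  intro n
  by_cases h : d ≤ n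
  · rw [GLCuspidal.T, dif_pos h]
    exact Tf_isCl _ hσ (hf _)
  · rw [T_of_lt (by omega)]
    exact isCl_zero

theorem FCl.D {d : ℕ} {σ : Matrix (Fin d) (Fin d) F → ℂ} {f : Fam F}
    (hf : FCl f) : FCl (D d σ f) := fun _ => Ef_isCl _ (hf _)

theorem bf_T_D {d : ℕ} {σ : Matrix (Fin d) (Fin d) F → ℂ} {f g : Fam F} (hσ : IsCl σ)
    (hg : FCl g) (m : ℕ) : bf (T d σ f (d + m)) (g (d + m)) = bf (f m) (D d σ g m) := by
  rw [T_eq finSumFinEquiv, bf_Tf _ hσ (hg _)]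
  rfl

theorem FCl.eq_zero {f : Fam F} (hf : FCl f) (n : ℕ) (h : ∀ g : Fam F, FCl g → bf (f n) (g n) = 0) :
    f n = 0 := by
  refine eq_zero_of_bf_self (h (fun n M => star (st (f n) M)) fun n => ⟨fun M hM => ?_,
    fun x M => ?_⟩) (hf n)
  · simp only
    rw [(st_isCl (hf n)).supp M hM, star_zero]
  · simp only
    rw [(st_isCl (hf n)).conj]

/-- The pairing of functions on matrices of possibly different sizes. -/
noncomputable def bd {d d' : ℕ} (σ : Matrix (Fin d) (Fin d) F → ℂ)
    (σ' : Matrix (Fin d') (Fin d') F → ℂ) : ℂ :=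
  if h : d' = d then bf σ (fun M => σ' (M.submatrix (Fin.cast h) (Fin.cast h))) else 0

theorem bd_same {d : ℕ} (σ σ' : Matrix (Fin d) (Fin d) F → ℂ) : bd σ σ' = bf σ σ' := by
  rw [bd, dif_pos rfl]
  rfl

theorem bd_ne {d d' : ℕ} (h : d' ≠ d) (σ : Matrix (Fin d) (Fin d) F → ℂ)
    (σ' : Matrix (Fin d') (Fin d') F → ℂ) : bd σ σ' = 0 := dif_neg h

/-- Cuspidal class functions. -/
structure Cu {d : ℕ} (σ : Matrix (Fin d) (Fin d) F → ℂ) : Prop where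
  pos : 0 < d
  isCl : IsCl σ
  cusp : CuspFn σ
  st_cusp : CuspFn (st σ)
  herm : Herm σ

theorem tp_refl {N : Type} (f : Matrix N N F → ℂ) : tp (Equiv.refl N) f = f := rfl

section

variable {A A' B B' N K : Type} [Fintype A] [DecidableEq A] [Fintype A'] [DecidableEq A']
  [Fintype K] [DecidableEq K] [Fintype B] [DecidableEq B] [Fintype B'] [DecidableEq B']
  [Fintype N] [DecidableEq N]

theorem Ef_tp (b : B ≃ A ⊕ K) (σ : Matrix A A F → ℂ) (f : Matrix B B F → ℂ) :
    Ef (Equiv.refl (A ⊕ K)) σ (tp b f) = Ef b.symm σ f := by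
  funext k
  unfold Ef tp
  congr 1

theorem pr_Tf_Tf_same [Nonempty A] (e : A ⊕ B ≃ N) (b : B ≃ A ⊕ K) {σ : Matrix A A F → ℂ}
    {f : Matrix B B F → ℂ} {σ' : Matrix A A F → ℂ} {f' : Matrix B B F → ℂ} (hσ : IsCl σ)
    (hf : IsCl f) (hσ' : IsCl σ') (hf' : IsCl f') (cσ : CuspFn σ) (cσ' : CuspFn σ') :
    pr (Tf e σ f) (Tf e σ' f') =
      pr σ σ' * pr f f' + pr (Ef b.symm σ' f) (Ef b.symm σ f') := by
  let c : N ≃ A ⊕ (A ⊕ K) := e.symm.trans ((Equiv.refl A).sumCongr b)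
  rw [← pr_tp c, ← Tf_tp e (Equiv.refl _) (Equiv.refl A) b c,
    ← Tf_tp e (Equiv.refl _) (Equiv.refl A) b c, tp_refl, tp_refl,
    pr_Tf_Tf_of_eq hσ (tp_isCl b hf) hσ' (tp_isCl b hf') cσ cσ', Ef_tp, Ef_tp, pr_tp]

theorem pr_Tf_Tf_distinct [Nonempty A] (e : A ⊕ B ≃ N) (e' : A' ⊕ B' ≃ N) (b : B ≃ A' ⊕ K)
    (b' : B' ≃ A ⊕ K) {σ : Matrix A A F → ℂ}
    {f : Matrix B B F → ℂ} {σ' : Matrix A' A' F → ℂ} {f' : Matrix B' B' F → ℂ} (hσ : IsCl σ)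
    (hf : IsCl f) (hσ' : IsCl σ') (hf' : IsCl f') (cσ : CuspFn σ) (cσ' : CuspFn σ')
    (h1 : Fintype.card A ≠ Fintype.card A') :
    pr (Tf e σ f) (Tf e' σ' f') = pr (Ef b.symm σ' f) (Ef b'.symm σ f') := by
  let c : N ≃ A ⊕ (A' ⊕ K) := e.symm.trans ((Equiv.refl A).sumCongr b)
  rw [← pr_tp c, ← Tf_tp e (Equiv.refl _) (Equiv.refl A) b c,
    ← Tf_tp e' (swapFrame A A' K) (Equiv.refl A') b' c, tp_refl, tp_refl,
    pr_Tf_Tf_of_ne hσ (tp_isCl b hf) hσ' (tp_isCl b' hf') cσ cσ' h1, Ef_tp, Ef_tp]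

end

theorem Cu.st {d : ℕ} {σ : Matrix (Fin d) (Fin d) F → ℂ} (h : Cu σ) : IsCl (st σ) := st_isCl h.isCl

theorem bf_T_T {d d' : ℕ} {σ : Matrix (Fin d) (Fin d) F → ℂ} {σ' : Matrix (Fin d') (Fin d') F → ℂ}
    (hσ : Cu σ) (hσ' : Cu σ') {f f' : Fam F} (hf : FCl f) (hf' : FCl f') (m : ℕ) :
    bf (T d σ f (d' + m)) (T d' σ' f' (d' + m)) =
      bd σ σ' * bf (f m) (f' m) + bf (T d σ (D d' σ' f) m) (f' m) := by
  have : Nonempty (Fin d) := ⟨⟨0, hσ.pos⟩⟩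
  have : Nonempty (Fin d') := ⟨⟨0, hσ'.pos⟩⟩
  have e' : Fin d' ⊕ Fin m ≃ Fin (d' + m) := finSumFinEquiv
  rw [T_eq e' σ' f']
  by_cases hm : d ≤ m
  · obtain ⟨k, rfl⟩ := Nat.exists_eq_add_of_le hm
    rw [bf_T_D hσ.isCl hf']
    by_cases hd : d' = d
    · subst hd
      rw [T_eq e' σ f, bd_same]
      unfold bf
      rw [← Tf_st e' hσ'.isCl (hf' _), pr_Tf_Tf_same e' finSumFinEquiv.symm hσ.isCl (hf _) hσ'.st
        (st_isCl (hf' _)) hσ.cusp hσ'.st_cusp, Equiv.symm_symm, Ef_st _ hσ.isCl (hf' _)]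
      rfl
    · have e : Fin d ⊕ Fin (d' + k) ≃ Fin (d' + (d + k)) :=
        finSumFinEquiv.trans (finCongr (by omega))
      rw [T_eq e σ f, bd_ne hd, zero_mul, zero_add]
      unfold bf
      rw [← Tf_st e' hσ'.isCl (hf' _), pr_Tf_Tf_distinct e e' finSumFinEquiv.symm
        finSumFinEquiv.symm hσ.isCl (hf _) hσ'.st (st_isCl (hf' _)) hσ.cusp hσ'.st_cusp
        (by simpa using fun h => hd h.symm), Equiv.symm_symm, Equiv.symm_symm,
        Ef_st _ hσ.isCl (hf' _)]
      rfl
  · have h0 : ∀ {N : Type} [Fintype N] [DecidableEq N] (g : Matrix N N F → ℂ), bf 0 g = 0 := by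
      intro N _ _ g
      simp [bf, pr]
    rw [T_of_lt (by omega : m < d), h0, add_zero]
    by_cases hd : d' = d
    · subst hd
      rw [T_eq e' σ f, bd_same]
      unfold bf
      rw [← Tf_st e' hσ'.isCl (hf' _), pr_Tf_Tf_of_card_lt e' hσ.isCl (hf _) hσ'.st
        (st_isCl (hf' _)) hσ.cusp hσ'.st_cusp (by simp; omega)]
    · rw [bd_ne hd, zero_mul]
      by_cases hn : d ≤ d' + m
      · have e : Fin d ⊕ Fin (d' + m - d) ≃ Fin (d' + m) :=
          finSumFinEquiv.trans (finCongr (by omega))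
        rw [T_eq e σ f]
        unfold bf
        rw [← Tf_st e' hσ'.isCl (hf' _)]
        exact pr_Tf_Tf_eq_zero e e' hσ'.st (st_isCl (hf' _)) hσ.cusp hσ'.st_cusp
          (by simpa using fun h => hd h.symm) (by simp; omega)
      · rw [T_of_lt (by omega), h0]

theorem bf_add_left {N : Type} [Fintype N] [DecidableEq N] (f f' g : Matrix N N F → ℂ) :
    bf (f + f') g = bf f g + bf f' g := by
  simp [bf, pr, add_mul, Finset.sum_add_distrib, mul_add]

theorem bf_smul_left {N : Type} [Fintype N] [DecidableEq N] (c : ℂ) (f g : Matrix N N F → ℂ) :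
    bf (c • f) g = c * bf f g := by
  simp only [bf, pr, Pi.smul_apply, smul_eq_mul, mul_assoc, ← Finset.mul_sum]
  ring

theorem D_T {d d' : ℕ} {σ : Matrix (Fin d) (Fin d) F → ℂ} {σ' : Matrix (Fin d') (Fin d') F → ℂ}
    (hσ : Cu σ) (hσ' : Cu σ') {f : Fam F} (hf : FCl f) :
    D d' σ' (T d σ f) = bd σ σ' • f + T d σ (D d' σ' f) := by
  have h1 : FCl (D d' σ' (T d σ f)) := FCl.D (FCl.T hσ.isCl hf)
  have h2 : FCl (bd σ σ' • f + T d σ (D d' σ' f)) := fun n =>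
    ((hf n).smul _).add (FCl.T hσ.isCl (FCl.D hf) n)
  have h3 : FCl (D d' σ' (T d σ f) + (-1 : ℂ) • (bd σ σ' • f + T d σ (D d' σ' f))) := fun n =>
    (h1 n).add ((h2 n).smul _)
  funext m
  have := h3.eq_zero m fun g hg => by
    have h4 := bf_T_T hσ hσ' hf hg m
    rw [bf_comm (FCl.T hσ.isCl hf _) (FCl.T hσ'.isCl hg _), bf_T_D hσ'.isCl (FCl.T hσ.isCl hf),
      bf_comm (hg _) (h1 _)] at h4
    simp only [Pi.add_apply, Pi.smul_apply, bf_add_left, bf_smul_left, h4]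
    ring
  have h5 : D d' σ' (T d σ f) m + (-1 : ℂ) • ((bd σ σ' • f + T d σ (D d' σ' f)) m) = 0 := this
  rwa [neg_one_smul, add_neg_eq_zero] at h5

theorem T_add {d : ℕ} (σ : Matrix (Fin d) (Fin d) F → ℂ) (f g : Fam F) :
    T d σ (f + g) = T d σ f + T d σ g := by
  funext n
  by_cases h : d ≤ n
  · funext M
    simp only [T, dif_pos h, Pi.add_apply, Tf, bl, mul_add, Finset.mul_sum,
      ← Finset.sum_add_distrib]
    refine Finset.sum_congr rfl fun x _ => ?_
    split_ifs <;> ring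
  · simp [T, h]

theorem T_smul {d : ℕ} (σ : Matrix (Fin d) (Fin d) F → ℂ) (c : ℂ) (f : Fam F) :
    T d σ (c • f) = c • T d σ f := by
  funext n
  by_cases h : d ≤ n
  · funext M
    simp only [T, dif_pos h, Pi.smul_apply, Tf, bl, Finset.mul_sum, Finset.smul_sum, smul_eq_mul]
    refine Finset.sum_congr rfl fun x _ => ?_
    split_ifs <;> ring
  · simp [T, h]

/-- The conjugate inverse of a family. -/
noncomputable def cst (f : Fam F) : Fam F := fun n M => star (st (f n) M)

theorem FCl.cst {f : Fam F} (hf : FCl f) : FCl (cst f) := fun n => ⟨fun M hM => by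
    rw [GLCuspidal.cst, (st_isCl (hf n)).supp M hM, star_zero], fun x M => by
    rw [GLCuspidal.cst, GLCuspidal.cst, (st_isCl (hf n)).conj]⟩

theorem T_cst {d : ℕ} {σ : Matrix (Fin d) (Fin d) F → ℂ} (hσ : Cu σ) {f : Fam F} (hf : FCl f) :
    T d σ (cst f) = cst (T d σ f) := by
  funext n M
  by_cases h : d ≤ n
  · simp only [T, dif_pos h, cst]
    rw [← Tf_st _ hσ.isCl (hf _)]
    simp only [Tf, bl, star_mul', star_inv₀, star_sum]
    congr 1
    · simp [pc]
    · refine Finset.sum_congr rfl fun x _ => ?_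
      split_ifs
      · rw [star_mul', hσ.herm, star_star, cst]
      · rw [star_zero]
  · simp [T, h, cst, st]

theorem T_comm {d d' : ℕ} {σ : Matrix (Fin d) (Fin d) F → ℂ} {σ' : Matrix (Fin d') (Fin d') F → ℂ}
    (hσ : Cu σ) (hσ' : Cu σ') {f : Fam F} (hf : FCl f) :
    T d σ (T d' σ' f) = T d' σ' (T d σ f) := by
  suffices H : ∀ n, ∀ f : Fam F, FCl f →
      (T d σ (T d' σ' f) + (-1 : ℂ) • T d' σ' (T d σ f)) n = 0 by
    funext n
    have := H n f hf
    rwa [Pi.add_apply, Pi.smul_apply, neg_one_smul, add_neg_eq_zero] at this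
  intro n
  induction n using Nat.strong_induction_on with
  | _ n ih =>
  intro f hf
  have hA := FCl.T hσ.isCl (FCl.T hσ'.isCl hf)
  have hB := FCl.T hσ'.isCl (FCl.T hσ.isCl hf)
  set Z := T d σ (T d' σ' f) + (-1 : ℂ) • T d' σ' (T d σ f) with hZ
  have hZc : FCl Z := fun k => (hA k).add ((hB k).smul _)
  have key : ∀ {c : ℕ} {τ : Matrix (Fin c) (Fin c) F → ℂ}, Cu τ → ∀ g : Fam F, FCl g →
      bf (Z n) (T c τ g n) = 0 := by
    intro c τ hτ g hg
    by_cases hc : c ≤ n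
    · obtain ⟨m, rfl⟩ := Nat.exists_eq_add_of_le hc
      rw [bf_comm (hZc _) (FCl.T hτ.isCl hg _), bf_T_D hτ.isCl hZc]
      have h1 : D c τ Z = T d σ (T d' σ' (D c τ f)) + (-1 : ℂ) • T d' σ' (T d σ (D c τ f)) := by
        have h2 : D c τ Z = D c τ (T d σ (T d' σ' f)) + (-1 : ℂ) • D c τ (T d' σ' (T d σ f)) := by
          funext k M
          simp only [hZ, D, Ef, Pi.add_apply, Pi.smul_apply, smul_eq_mul, mul_add,
            Finset.sum_add_distrib, Finset.mul_sum]
          congr 1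
          refine Finset.sum_congr rfl fun a _ => Finset.sum_congr rfl fun b _ => ?_
          ring
        rw [h2, D_T hσ hτ (FCl.T hσ'.isCl hf), D_T hσ' hτ hf, D_T hσ' hτ (FCl.T hσ.isCl hf),
          D_T hσ hτ hf, T_add, T_add, T_smul, T_smul]
        module
      rw [h1, ih m (by have := hτ.pos; omega) _ (FCl.D hf)]
      simp [bf, pr, st]
    · rw [T_of_lt (by omega)]
      simp [bf, pr, st]
  refine eq_zero_of_bf_self ?_ (hZc n)
  have h3 : (fun M => star (st (Z n) M)) =
      T d σ (T d' σ' (cst f)) n + (-1 : ℂ) • T d' σ' (T d σ (cst f)) n := by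
    rw [T_cst hσ' hf, T_cst hσ hf, T_cst hσ (FCl.T hσ'.isCl hf), T_cst hσ' (FCl.T hσ.isCl hf)]
    funext M
    simp [hZ, cst, st]
  rw [h3, bf_comm (hZc n), bf_add_left, bf_smul_left]
  · have k1 := key hσ _ (FCl.T hσ'.isCl hf.cst)
    have k2 := key hσ' _ (FCl.T hσ.isCl hf.cst)
    rw [bf_comm (hZc n) (FCl.T hσ.isCl (FCl.T hσ'.isCl hf.cst) n)] at k1
    rw [bf_comm (hZc n) (FCl.T hσ'.isCl (FCl.T hσ.isCl hf.cst) n)] at k2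
    rw [k1, k2]
    simp
  · exact (FCl.T hσ.isCl (FCl.T hσ'.isCl hf.cst) n).add
      ((FCl.T hσ'.isCl (FCl.T hσ.isCl hf.cst) n).smul _)

end Families

section Unipotent

variable {F : Type} [Field F] [Fintype F] {n : ℕ}

/-- Upper unitriangular matrices. -/
def Uni (M : Matrix (Fin n) (Fin n) F) : Prop :=
  ∀ i j, j ≤ i → M i j = (1 : Matrix (Fin n) (Fin n) F) i j

/-- The sum of the superdiagonal entries. -/
def su (M : Matrix (Fin n) (Fin n) F) : F :=
  ∑ i : Fin n, ∑ j : Fin n, if (i : ℕ) + 1 = (j : ℕ) then M i j else 0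

theorem Uni.one : Uni (1 : Matrix (Fin n) (Fin n) F) := fun _ _ _ => rfl

theorem Uni.mul_apply {M M' : Matrix (Fin n) (Fin n) F} (h : Uni M) (h' : Uni M') (i j : Fin n)
    (hij : j ≤ i) : (M * M') i j = (1 : Matrix (Fin n) (Fin n) F) i j := by
  rw [Matrix.mul_apply, Finset.sum_eq_single i]
  · rw [h i i le_rfl, h' i j hij, Matrix.one_apply_eq, one_mul]
  · intro k _ hk
    rcases lt_or_gt_of_ne hk with hk | hk
    · rw [h i k hk.le, Matrix.one_apply_ne hk.ne', zero_mul]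
    · rw [h' k j (hij.trans hk.le), Matrix.one_apply_ne (hij.trans_lt hk).ne', mul_zero]
  · simp

theorem Uni.mul {M M' : Matrix (Fin n) (Fin n) F} (h : Uni M) (h' : Uni M') : Uni (M * M') :=
  fun i j hij => h.mul_apply h' i j hij

theorem Uni.su_mul {M M' : Matrix (Fin n) (Fin n) F} (h : Uni M) (h' : Uni M') :
    su (M * M') = su M + su M' := by
  unfold su
  simp only [← Finset.sum_add_distrib]
  refine Finset.sum_congr rfl fun i _ => Finset.sum_congr rfl fun j _ => ?_
  split_ifs with hij
  · have hne : i ≠ j := by rintro rfl; omega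
    rw [Matrix.mul_apply, Finset.sum_eq_add i j hne]
    · rw [h i i le_rfl, h' j j le_rfl, Matrix.one_apply_eq, Matrix.one_apply_eq, one_mul, mul_one,
        add_comm]
    · intro k _ hk
      rcases lt_or_gt_of_ne hk.1 with hk' | hk'
      · rw [h i k hk'.le, Matrix.one_apply_ne hk'.ne', zero_mul]
      · have : j < k := by
          have := hk.2
          rw [ne_eq, Fin.ext_iff] at this
          rw [Fin.lt_def] at hk' ⊢
          omega
        rw [h' k j this.le, Matrix.one_apply_ne this.ne', mul_zero]
    · simp
    · simp
  · simp

theorem su_one : su (1 : Matrix (Fin n) (Fin n) F) = 0 := by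
  refine Finset.sum_eq_zero fun i _ => Finset.sum_eq_zero fun j _ => ?_
  split_ifs with hij
  · exact Matrix.one_apply_ne (by rintro rfl; omega)
  · rfl

theorem Uni.det {M : Matrix (Fin n) (Fin n) F} (h : Uni M) : M.det = 1 := by
  rw [Matrix.det_of_isUpperTriangular]
  · exact Finset.prod_eq_one fun i _ => by rw [h i i le_rfl, Matrix.one_apply_eq]
  · intro i j hij
    exact (h i j (le_of_lt hij)).trans (Matrix.one_apply_ne (ne_of_gt hij))

variable (F n) in
/-- The group of upper unitriangular matrices. -/
def U : Subgroup (GL (Fin n) F) where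
  carrier := {g | Uni (g : Matrix (Fin n) (Fin n) F)}
  one_mem' := Uni.one
  mul_mem' {g h} hg hh := by
    rw [Set.mem_ofPred_eq, Units.val_mul]
    exact Uni.mul hg hh
  inv_mem' {g} hg := by
    have h1 : g⁻¹ = g ^ (orderOf g - 1) := by
      refine inv_eq_of_mul_eq_one_right ?_
      rw [← pow_succ', Nat.sub_add_cancel (orderOf_pos g), pow_orderOf_eq_one]
    have h2 : ∀ k : ℕ, Uni ((g ^ k : GL (Fin n) F) : Matrix (Fin n) (Fin n) F) := by
      intro k
      induction k with
      | zero => exact Uni.one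
      | succ k ih =>
        rw [pow_succ, Units.val_mul]
        exact ih.mul hg
    rw [Set.mem_ofPred_eq, h1]
    exact h2 _

theorem mem_U (g : GL (Fin n) F) : g ∈ U F n ↔ Uni (g : Matrix (Fin n) (Fin n) F) := Iff.rfl

theorem U_uni (u : U F n) : Uni ((u : GL (Fin n) F) : Matrix (Fin n) (Fin n) F) := u.2

theorem Uni.exists_U {M : Matrix (Fin n) (Fin n) F} (h : Uni M) :
    ∃ u : U F n, ((u : GL (Fin n) F) : Matrix (Fin n) (Fin n) F) = M :=
  ⟨⟨Matrix.GeneralLinearGroup.mkOfDetNeZero M (by rw [h.det]; exact one_ne_zero), h⟩, rfl⟩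

noncomputable instance fintypeU : Fintype (U F n) := Fintype.ofFinite _

/-- The superdiagonal sum as a homomorphism. -/
def suU (u : U F n) : F := su ((u : GL (Fin n) F) : Matrix (Fin n) (Fin n) F)

theorem suU_mul (u v : U F n) : suU (u * v) = suU u + suU v := by
  unfold suU
  rw [Subgroup.coe_mul, Units.val_mul]
  exact (U_uni u).su_mul (U_uni v)

theorem suU_one : suU (1 : U F n) = 0 := su_one

theorem suU_inv (u : U F n) : suU u⁻¹ = -suU u := by
  rw [eq_neg_iff_add_eq_zero, ← suU_mul, inv_mul_cancel, suU_one]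

theorem uni_one_add (y l : Fin n → F) (h : ∀ a b, b ≤ a → y a * l b = 0) :
    Uni (1 + vecMulVec y l) := by
  intro a b hab
  rw [Matrix.add_apply, vecMulVec_apply, h a b hab, add_zero]

theorem su_one_add (y l : Fin n → F) (i j : Fin n) (hij : (i : ℕ) + 1 = j)
    (hy : ∀ a, i < a → y a = 0) (hl : ∀ b, b ≤ i → l b = 0) :
    su (1 + vecMulVec y l) = y i * l j := by
  unfold su
  rw [Finset.sum_eq_single i, Finset.sum_eq_single j]
  · have : i ≠ j := by rintro rfl; omega
    rw [if_pos hij, Matrix.add_apply, vecMulVec_apply, Matrix.one_apply_ne this, zero_add]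
  · intro b _ hb
    rw [if_neg]
    intro h
    exact hb (Fin.ext (by omega))
  · simp
  · intro a _ ha
    refine Finset.sum_eq_zero fun b _ => ?_
    split_ifs with hab
    · rw [Matrix.add_apply, vecMulVec_apply, Matrix.one_apply_ne (by rintro rfl; omega), zero_add]
      rcases lt_or_gt_of_ne ha with h | h
      · rw [hl b (by rw [Fin.le_def]; rw [Fin.lt_def] at h; omega), mul_zero]
      · rw [hy a h, zero_mul]
    · rfl
  · simp

theorem uni_split (y l : Fin n → F) (i : Fin n)
    (hy : ∀ a, i < a → y a = 0) (hl : ∀ b, b ≤ i → l b = 0) : Uni (1 + vecMulVec y l) := by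
  refine uni_one_add y l fun a b hab => ?_
  rcases le_or_gt a i with h | h
  · rw [hl b (hab.trans h), mul_zero]
  · rw [hy a h, zero_mul]

theorem sum_U_eq_zero (ψ : AddChar F ℂ) (φ : U F n → ℂ) (u₀ : U F n) (h : ∀ u, φ (u * u₀) = φ u)
    (h₀ : ψ (suU u₀) ≠ 1) : ∑ u : U F n, φ u * ψ (-suU u) = 0 := by
  have h1 : ∑ u : U F n, φ u * ψ (-suU u) = (∑ u : U F n, φ u * ψ (-suU u)) * ψ (-suU u₀) := by
    conv_lhs => rw [← Equiv.sum_comp (Equiv.mulRight u₀)]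
    rw [Finset.sum_mul]
    refine Finset.sum_congr rfl fun u _ => ?_
    rw [Equiv.coe_mulRight, h, suU_mul, neg_add, AddChar.map_add_eq_mul]
    ring
  have h2 : ψ (-suU u₀) ≠ 1 := by
    intro h
    apply h₀
    have h3 := AddChar.map_add_eq_mul ψ (-suU u₀) (suU u₀)
    rwa [neg_add_cancel, AddChar.map_zero_eq_one, h, one_mul, eq_comm] at h3
  by_contra h3
  exact h2 (mul_left_cancel₀ h3 (by rw [← h1, mul_one]))

/-- The Whittaker multiplicity of a class function. -/
noncomputable def wh (ψ : AddChar F ℂ) (f : Matrix (Fin n) (Fin n) F → ℂ) : ℂ :=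
  (Nat.card (U F n) : ℂ)⁻¹ * ∑ u : U F n,
    f ((u : GL (Fin n) F) : Matrix (Fin n) (Fin n) F) * ψ (-suU u)

/-- The vectors supported in the first `k` coordinates. -/
def Fl (F : Type) [Field F] (n k : ℕ) : Submodule F (Fin n → F) where
  carrier := {v | ∀ j : Fin n, k ≤ j → v j = 0}
  zero_mem' _ _ := rfl
  add_mem' {v w} hv hw j hj := by rw [Pi.add_apply, hv j hj, hw j hj, add_zero]
  smul_mem' c v hv j hj := by rw [Pi.smul_apply, hv j hj, smul_zero]

theorem exists_form {p : Submodule F (Fin n → F)} {v : Fin n → F} (hv : v ∉ p) :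
    ∃ l : Fin n → F, l ⬝ᵥ v = 1 ∧ ∀ w ∈ p, l ⬝ᵥ w = 0 := by
  obtain ⟨f, hf, hp⟩ := Submodule.exists_le_ker_of_notMem hv
  have h : ∀ w, (fun i => (f v)⁻¹ * f (Pi.single i 1)) ⬝ᵥ w = (f v)⁻¹ * f w := by
    intro w
    conv_rhs => rw [← Finset.univ_sum_single w]
    rw [map_sum, Finset.mul_sum, dotProduct]
    refine Finset.sum_congr rfl fun i _ => ?_
    rw [show Pi.single i (w i) = w i • (Pi.single i 1 : Fin n → F) by
      rw [← Pi.single_smul, smul_eq_mul, mul_one], map_smul, smul_eq_mul]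
    ring
  refine ⟨fun i => (f v)⁻¹ * f (Pi.single i 1), ?_, fun w hw => ?_⟩
  · rw [h, inv_mul_cancel₀ hf]
  · rw [h, LinearMap.mem_ker.1 (hp hw), mul_zero]

theorem finrank_Fl_le (k : ℕ) : Module.finrank F (Fl F n k) ≤ k := by
  let r : Fl F n k →ₗ[F] (Fin k → F) :=
    { toFun := fun v i => if h : (i : ℕ) < n then v.1 ⟨i, h⟩ else 0
      map_add' := fun v w => by
        funext i
        by_cases h : (i : ℕ) < n <;> simp [h]
      map_smul' := fun c v => by
        funext i
        by_cases h : (i : ℕ) < n <;> simp [h] }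
  have hr : Function.Injective r := by
    rw [injective_iff_map_eq_zero]
    intro v hv
    ext j
    by_cases hj : (j : ℕ) < k
    · have := congrFun hv ⟨j, hj⟩
      simpa [r] using this
    · exact v.2 j (not_lt.1 hj)
  simpa using LinearMap.finrank_le_finrank_of_injective hr

theorem exists_jump (W : Submodule F (Fin n → F)) (m : ℕ) (hW : Module.finrank F W + m ≤ n)
    (y₀ : Fin n → F) (hy₀ : y₀ ∈ W) (hne : y₀ ≠ 0) (hm : y₀ ∈ Fl F n m) :
    ∃ (i j : Fin n) (y l : Fin n → F), (i : ℕ) + 1 = j ∧ y ∈ W ∧ y i = 1 ∧ (∀ a, i < a → y a = 0) ∧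
      (∀ w ∈ W, l ⬝ᵥ w = 0) ∧ (∀ b, b ≤ i → l b = 0) ∧ l j = 1 := by
  classical
  by_contra hcon
  obtain ⟨i₀, hi₀, hmax⟩ : ∃ i₀, y₀ i₀ ≠ 0 ∧ ∀ a, i₀ < a → y₀ a = 0 := by
    have hs : (Finset.univ.filter fun i => y₀ i ≠ 0).Nonempty := by
      obtain ⟨i, hi⟩ := Function.ne_iff.1 hne
      exact ⟨i, by simpa using hi⟩
    refine ⟨_, (Finset.mem_filter.1 (Finset.max'_mem _ hs)).2, fun a ha => ?_⟩
    by_contra h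
    exact absurd (Finset.le_max' _ a (by simpa using h)) (not_le.2 ha)
  have him : (i₀ : ℕ) < m := by
    by_contra h
    exact hi₀ (hm i₀ (not_lt.1 h))
  have step : ∀ k : ℕ, (i₀ : ℕ) ≤ k → ∀ hk : k < n,
      (∃ y ∈ W, y ⟨k, hk⟩ = 1 ∧ ∀ a, (⟨k, hk⟩ : Fin n) < a → y a = 0) ∧
      Fl F n (k + 1) ≤ W ⊔ Fl F n i₀ := by
    have key : ∀ k : ℕ, ∀ hk : k < n, Fl F n k ≤ W ⊔ Fl F n i₀ →
        (∃ y ∈ W, y ⟨k, hk⟩ = 1 ∧ ∀ a, (⟨k, hk⟩ : Fin n) < a → y a = 0) →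
        Fl F n (k + 1) ≤ W ⊔ Fl F n i₀ := by
      rintro k hk hle ⟨y, hyW, hy1, hy0⟩ v hv
      rw [← sub_add_cancel v (v ⟨k, hk⟩ • y)]
      refine add_mem (hle ?_) (Submodule.mem_sup_left (W.smul_mem _ hyW))
      intro j hj
      rw [Pi.sub_apply, Pi.smul_apply, smul_eq_mul]
      rcases Nat.eq_or_lt_of_le hj with h | h
      · have : j = ⟨k, hk⟩ := Fin.ext h.symm
        rw [this, hy1, mul_one, sub_self]
      · rw [hv j h, hy0 j h, mul_zero, sub_zero]
    intro k hk
    induction k, hk using Nat.le_induction with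
    | base =>
      intro hk
      have h1 : ∃ y ∈ W, y ⟨(i₀ : ℕ), hk⟩ = 1 ∧ ∀ a, (⟨(i₀ : ℕ), hk⟩ : Fin n) < a → y a = 0 :=
        ⟨(y₀ i₀)⁻¹ • y₀, W.smul_mem _ hy₀, by simp [hi₀], fun a ha => by
          rw [Pi.smul_apply, hmax a ha, smul_zero]⟩
      exact ⟨h1, key _ hk le_sup_right h1⟩
    | succ k hk ih =>
      intro hk'
      obtain ⟨⟨y, hyW, hy1, hy0⟩, hle⟩ := ih (by omega)
      have h1 : (Pi.single (⟨k + 1, hk'⟩ : Fin n) 1 : Fin n → F) ∈ W ⊔ Fl F n (k + 1) := by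
        by_contra hnot
        obtain ⟨l, hl1, hl0⟩ := exists_form hnot
        refine hcon ⟨⟨k, by omega⟩, ⟨k + 1, hk'⟩, y, l, rfl, hyW, hy1, hy0,
          fun w hw => hl0 w (Submodule.mem_sup_left hw), fun b hb => ?_, by simpa using hl1⟩
        have := hl0 (Pi.single b 1) (Submodule.mem_sup_right fun j hj => by
          rw [Pi.single_eq_of_ne]
          rintro rfl
          rw [Fin.le_def] at hb
          simp at hb
          omega)
        simpa using this
      obtain ⟨z, hz, x, hx, hzx⟩ := Submodule.mem_sup.1 h1
      have h2 : ∀ a, z a = (Pi.single (⟨k + 1, hk'⟩ : Fin n) 1 : Fin n → F) a - x a := by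
        intro a
        rw [← hzx, Pi.add_apply, add_sub_cancel_right]
      have h3 : ∃ y ∈ W, y ⟨k + 1, hk'⟩ = 1 ∧ ∀ a, (⟨k + 1, hk'⟩ : Fin n) < a → y a = 0 :=
        ⟨z, hz, by rw [h2, hx _ (by simp)]; simp, fun a ha => by
          rw [h2, hx a (by rw [Fin.lt_def] at ha; exact ha.le), Pi.single_eq_of_ne ha.ne', sub_zero]⟩
      exact ⟨h3, key _ hk' hle h3⟩
  have htop : (⊤ : Submodule F (Fin n → F)) ≤ W ⊔ Fl F n i₀ := by
    obtain ⟨k, rfl⟩ : ∃ k, n = k + 1 := ⟨n - 1, by have := i₀.2; omega⟩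
    refine le_trans ?_ (step k (by have := i₀.2; omega) (Nat.lt_succ_self k)).2
    intro v _ j hj
    have := j.2
    omega
  have h1 := Submodule.finrank_add_le_finrank_add_finrank W (Fl F n i₀)
  have h2 := Submodule.finrank_mono htop
  rw [finrank_top, Module.finrank_fin_fun] at h2
  have h3 := finrank_Fl_le (F := F) (n := n) i₀
  omega

end Unipotent

section Multiplicativity

variable {F : Type} [Field F] [Fintype F] {d m : ℕ}

variable (d m) in
/-- The frame whose first block consists of the last `d` coordinates. -/
def lf : Fin d ⊕ Fin m ≃ Fin (m + d) := (Equiv.sumComm _ _).trans finSumFinEquiv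

theorem lf_inl (i : Fin d) : lf d m (Sum.inl i) = Fin.natAdd m i := by simp [lf]

theorem lf_inr (i : Fin m) : lf d m (Sum.inr i) = Fin.castAdd d i := by simp [lf]

theorem lf_symm_natAdd (i : Fin d) : (lf d m).symm (Fin.natAdd m i) = Sum.inl i := by
  rw [Equiv.symm_apply_eq, lf_inl]

theorem lf_symm_castAdd (i : Fin m) : (lf d m).symm (Fin.castAdd d i) = Sum.inr i := by
  rw [Equiv.symm_apply_eq, lf_inr]

theorem uni_blk (a : Matrix (Fin d) (Fin d) F) (b : Matrix (Fin d) (Fin m) F)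
    (c : Matrix (Fin m) (Fin d) F) (g : Matrix (Fin m) (Fin m) F) :
    Uni (blk (lf d m) a b c g) ↔ Uni a ∧ b = 0 ∧ Uni g := by
  unfold blk
  constructor
  · intro h
    refine ⟨fun i j hij => ?_, ?_, fun i j hij => ?_⟩
    · have := h (Fin.natAdd m i) (Fin.natAdd m j) (by simpa using hij)
      rw [Matrix.submatrix_apply, lf_symm_natAdd, lf_symm_natAdd, fromBlocks_apply₁₁] at this
      rw [this]
      simp [Matrix.one_apply]
    · ext i j
      have := h (Fin.natAdd m i) (Fin.castAdd d j) (by rw [Fin.le_def]; simp; omega)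
      rw [Matrix.submatrix_apply, lf_symm_natAdd, lf_symm_castAdd, fromBlocks_apply₁₂] at this
      rw [this, Matrix.one_apply_ne, Matrix.zero_apply]
      rw [ne_eq, Fin.ext_iff]
      simp
      omega
    · have := h (Fin.castAdd d i) (Fin.castAdd d j) hij
      rw [Matrix.submatrix_apply, lf_symm_castAdd, lf_symm_castAdd, fromBlocks_apply₂₂] at this
      rw [this]
      simp [Matrix.one_apply]
  · rintro ⟨ha, rfl, hg⟩ i j
    refine Fin.addCases (fun i => ?_) (fun i => ?_) i <;>
      refine Fin.addCases (fun j => ?_) (fun j => ?_) j <;> intro hij <;>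
      rw [Matrix.submatrix_apply]
    · rw [lf_symm_castAdd, lf_symm_castAdd, fromBlocks_apply₂₂, hg i j hij]
      simp [Matrix.one_apply]
    · rw [Fin.le_def] at hij
      simp at hij
      omega
    · rw [lf_symm_castAdd, lf_symm_natAdd, fromBlocks_apply₁₂, Matrix.one_apply_ne,
        Matrix.zero_apply]
      rw [ne_eq, Fin.ext_iff]
      simp
      omega
    · rw [lf_symm_natAdd, lf_symm_natAdd, fromBlocks_apply₁₁, ha i j (by simpa using hij)]
      simp [Matrix.one_apply]

theorem su_blk (a : Matrix (Fin d) (Fin d) F) (g : Matrix (Fin m) (Fin m) F) :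
    su (blk (lf d m) a 0 0 g) = su a + su g := by
  unfold su blk
  simp only [Fin.sum_univ_add, Matrix.submatrix_apply, lf_symm_castAdd, lf_symm_natAdd,
    fromBlocks_apply₁₁, fromBlocks_apply₁₂, fromBlocks_apply₂₁, fromBlocks_apply₂₂, Fin.val_castAdd,
    Fin.val_natAdd, Matrix.zero_apply, ite_self, Finset.sum_const_zero, add_zero, zero_add]
  rw [add_comm]
  congr 1
  refine Finset.sum_congr rfl fun i _ => Finset.sum_congr rfl fun j _ => ?_
  refine if_congr ?_ rfl rfl
  omega

/-- The twisted sum of an inflated function over a conjugate of the unitriangular group. -/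
noncomputable def whM (ψ : AddChar F ℂ) (σ : Matrix (Fin d) (Fin d) F → ℂ)
    (f : Matrix (Fin m) (Fin m) F → ℂ) (x : GL (Fin (m + d)) F) : ℂ :=
  ∑ u : U F (m + d), bl (lf d m) σ f (conjEquiv x ((u : GL (Fin (m + d)) F) :
    Matrix (Fin (m + d)) (Fin (m + d)) F)) * ψ (-suU u)

theorem whM_mul {ψ : AddChar F ℂ} {σ : Matrix (Fin d) (Fin d) F → ℂ}
    {f : Matrix (Fin m) (Fin m) F → ℂ} (hσ : IsCl σ) (hf : IsCl f) {p x : GL (Fin (m + d)) F}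
    (hp : p ∈ Par (lf d m)) (v : U F (m + d)) :
    whM ψ σ f (p * x * (v : GL (Fin (m + d)) F)) = whM ψ σ f x := by
  unfold whM
  rw [← Equiv.sum_comp (MulAut.conj v⁻¹).toEquiv]
  refine Finset.sum_congr rfl fun u _ => ?_
  have h1 : suU ((MulAut.conj v⁻¹).toEquiv u) = suU u := by
    simp only [MulEquiv.toEquiv_eq_coe, MulEquiv.coe_toEquiv, MulAut.conj_apply, suU_mul, suU_inv]
    ring
  have h2 : conjEquiv (p * x * (v : GL (Fin (m + d)) F)) ((((MulAut.conj v⁻¹).toEquiv u : U F (m + d)) :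
      GL (Fin (m + d)) F) : Matrix (Fin (m + d)) (Fin (m + d)) F) =
      conjEquiv p (conjEquiv x ((u : GL (Fin (m + d)) F) : Matrix (Fin (m + d)) (Fin (m + d)) F)) := by
    rw [conjEquiv_mul, conjEquiv_mul]
    congr 2
    simp only [MulEquiv.toEquiv_eq_coe, MulEquiv.coe_toEquiv, MulAut.conj_apply, conjEquiv_apply,
      Subgroup.coe_mul, Subgroup.coe_inv, inv_inv, Units.val_mul, Matrix.mul_assoc,
      Units.mul_inv, Matrix.mul_one]
    rw [← Matrix.mul_assoc, Units.mul_inv, Matrix.one_mul]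
  rw [h1, h2, bl_conj _ hσ hf p hp]

theorem whM_eq_zero {ψ : AddChar F ℂ} (hψ : ψ ≠ 1) {σ : Matrix (Fin d) (Fin d) F → ℂ}
    {f : Matrix (Fin m) (Fin m) F → ℂ} {x : GL (Fin (m + d)) F}
    (hx : ¬ ∃ p ∈ Par (lf d m), ∃ v ∈ U F (m + d), p * v = x) : whM ψ σ f x = 0 := by
  obtain ⟨a, b, c, g, hxi⟩ := exists_blk (lf d m) ((x⁻¹ : GL (Fin (m + d)) F) :
    Matrix (Fin (m + d)) (Fin (m + d)) F)
  by_cases ha : IsUnit a.det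
  · exfalso
    obtain ⟨u, hu⟩ := ((uni_blk (1 : Matrix (Fin d) (Fin d) F) 0 (c * a⁻¹) 1).2
      ⟨Uni.one, rfl, Uni.one⟩).exists_U
    have h1 : ((u : GL (Fin (m + d)) F) : Matrix (Fin (m + d)) (Fin (m + d)) F) *
        blk (lf d m) a b 0 (g - c * a⁻¹ * b) =
        ((x⁻¹ : GL (Fin (m + d)) F) : Matrix (Fin (m + d)) (Fin (m + d)) F) := by
      rw [hu, hxi, blk_mul]
      congr 1 <;> simp [Matrix.mul_assoc, Matrix.nonsing_inv_mul _ ha]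
    have h2 : (u : GL (Fin (m + d)) F)⁻¹ * x⁻¹ ∈ Par (lf d m) := by
      refine ⟨a, b, g - c * a⁻¹ * b, ?_⟩
      rw [Units.val_mul, ← h1, ← Matrix.mul_assoc, Units.inv_mul, Matrix.one_mul]
    refine hx ⟨_, inv_mem h2, _, inv_mem u.2, ?_⟩
    group
  · obtain ⟨v, hv, hav⟩ := Matrix.exists_mulVec_eq_zero_iff.2 (not_not.1 (isUnit_iff_ne_zero.not.1 ha))
    obtain ⟨t, ht⟩ : ∃ t, ψ t ≠ 1 := by
      by_contra h
      push Not at h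
      exact hψ (DFunLike.ext _ _ fun t => by rw [h t, AddChar.one_apply])
    set W := (VA (F := F) (lf d m)).map (Matrix.mulVecLin ((x⁻¹ : GL (Fin (m + d)) F) :
      Matrix (Fin (m + d)) (Fin (m + d)) F)) with hWdef
    have hW : Module.finrank F W + m ≤ m + d := by
      have := Submodule.finrank_map_le (Matrix.mulVecLin ((x⁻¹ : GL (Fin (m + d)) F) :
        Matrix (Fin (m + d)) (Fin (m + d)) F)) (VA (F := F) (lf d m))
      rw [finrank_VA, Fintype.card_fin] at this
      rw [hWdef]
      omega
    obtain ⟨i, j, y, l, hij, hy, hy1, hy0, hlW, hl0, hl1⟩ := exists_jump W m hW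
      (((x⁻¹ : GL (Fin (m + d)) F) : Matrix (Fin (m + d)) (Fin (m + d)) F) *ᵥ inc (lf d m) v)
      ⟨_, ⟨v, rfl⟩, rfl⟩
      (fun h => hv (inc_injective (lf d m) (mulVec_injective_GL x⁻¹
        (by simpa using h))))
      (by
        rw [hxi, blk_mulVec_inc, hav]
        intro j hj
        obtain ⟨j, rfl⟩ : ∃ j', j = Fin.natAdd m j' :=
          ⟨⟨j - m, by have := j.2; omega⟩, Fin.ext (by simp; omega)⟩
        rw [Function.comp_apply, lf_symm_natAdd]
        rfl)
    have hN := uni_split y (t • l) i hy0 (fun b hb => by rw [Pi.smul_apply, hl0 b hb, smul_zero])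
    obtain ⟨u₀, hu₀⟩ := hN.exists_U
    have hsu : suU u₀ = t := by
      rw [suU, hu₀, su_one_add y (t • l) i j hij hy0
        (fun b hb => by rw [Pi.smul_apply, hl0 b hb, smul_zero]), hy1, Pi.smul_apply, hl1]
      simp
    obtain ⟨_, hw, hwy⟩ := hy
    obtain ⟨T, hT⟩ := eq_blk_of_range (lf d m) (conjEquiv x (vecMulVec y (t • l)))
      (fun v => by
        rw [conjEquiv_apply, ← Matrix.mulVec_mulVec, ← Matrix.mulVec_mulVec, Matrix.vecMulVec_mulVec,
          ← hwy, Matrix.mulVecLin_apply]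
        simp only [op_smul_eq_smul, Matrix.mulVec_smul, Matrix.mulVec_mulVec,
          Units.mul_inv, Matrix.one_mulVec]
        exact Submodule.smul_mem _ _ hw) 0
      (fun v => by
        have hlv : l ⬝ᵥ (((x⁻¹ : GL (Fin (m + d)) F) : Matrix (Fin (m + d)) (Fin (m + d)) F) *ᵥ
          inc (lf d m) v) = 0 := hlW _ ⟨_, ⟨v, rfl⟩, rfl⟩
        rw [conjEquiv_apply, ← Matrix.mulVec_mulVec, ← Matrix.mulVec_mulVec, Matrix.vecMulVec_mulVec,
          smul_dotProduct, hlv]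
        simp)
    refine sum_U_eq_zero ψ _ u₀ (fun u => ?_) (by rwa [hsu])
    have h1 : conjEquiv x (((u * u₀ : U F (m + d)) : GL (Fin (m + d)) F) :
        Matrix (Fin (m + d)) (Fin (m + d)) F) =
        conjEquiv x ((u : GL (Fin (m + d)) F) : Matrix (Fin (m + d)) (Fin (m + d)) F) *
          (1 + blk (lf d m) 0 T 0 0) := by
      rw [← hT, Subgroup.coe_mul, Units.val_mul, hu₀]
      simp only [conjEquiv_apply, Matrix.mul_add, Matrix.add_mul, Matrix.mul_one]
      congr 1
      simp only [Matrix.mul_assoc]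
      rw [← Matrix.mul_assoc _ (x : Matrix (Fin (m + d)) (Fin (m + d)) F), Units.inv_mul,
        Matrix.one_mul]
    obtain ⟨a', b', c', g', hb⟩ := exists_blk (lf d m)
      (conjEquiv x ((u : GL (Fin (m + d)) F) : Matrix (Fin (m + d)) (Fin (m + d)) F))
    rw [h1, hb, bl_mul_one_add _ _ _ _ _ (by simp)]
    simp

/-- Block diagonal unitriangular matrices. -/
theorem exists_inf_equiv : ∃ E : U F d × U F m ≃ (U F (m + d) ⊓ Par (lf d m) : Subgroup _),
    ∀ p, (((E p : (U F (m + d) ⊓ Par (lf d m) : Subgroup _)) : GL (Fin (m + d)) F) :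
      Matrix (Fin (m + d)) (Fin (m + d)) F) = blk (lf d m)
        ((p.1 : GL (Fin d) F) : Matrix (Fin d) (Fin d) F) 0 0
        ((p.2 : GL (Fin m) F) : Matrix (Fin m) (Fin m) F) := by
  have h1 : ∀ p : U F d × U F m, ∃ z : (U F (m + d) ⊓ Par (lf d m) : Subgroup _),
      ((z : GL (Fin (m + d)) F) : Matrix (Fin (m + d)) (Fin (m + d)) F) = blk (lf d m)
        ((p.1 : GL (Fin d) F) : Matrix (Fin d) (Fin d) F) 0 0
        ((p.2 : GL (Fin m) F) : Matrix (Fin m) (Fin m) F) := by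
    intro p
    obtain ⟨u, hu⟩ := ((uni_blk ((p.1 : GL (Fin d) F) : Matrix (Fin d) (Fin d) F) 0 0
      ((p.2 : GL (Fin m) F) : Matrix (Fin m) (Fin m) F)).2 ⟨p.1.2, rfl, p.2.2⟩).exists_U
    exact ⟨⟨u, u.2, _, _, _, hu⟩, hu⟩
  choose E hE using h1
  refine ⟨Equiv.ofBijective E ⟨fun p p' h => ?_, fun z => ?_⟩, hE⟩
  · have := (hE p).symm.trans ((congrArg (fun z : (U F (m + d) ⊓ Par (lf d m) : Subgroup _) =>
      ((z : GL (Fin (m + d)) F) : Matrix (Fin (m + d)) (Fin (m + d)) F)) h).trans (hE p'))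
    obtain ⟨h2, -, -, h3⟩ := blk_inj _ this
    exact Prod.ext (Subtype.ext (Units.ext h2)) (Subtype.ext (Units.ext h3))
  · obtain ⟨z, hz, a, b, g, hzb⟩ := z
    have h2 := (uni_blk a b 0 g).1 (hzb ▸ hz)
    obtain ⟨u, hu⟩ := h2.1.exists_U
    obtain ⟨v, hv⟩ := h2.2.2.exists_U
    refine ⟨(u, v), Subtype.ext (Units.ext ?_)⟩
    rw [hE, hzb, hu, hv, h2.2.1]

theorem whM_one (ψ : AddChar F ℂ) (σ : Matrix (Fin d) (Fin d) F → ℂ)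
    (f : Matrix (Fin m) (Fin m) F → ℂ) : whM ψ σ f 1 =
      (Nat.card (U F (m + d) ⊓ Par (lf d m) : Subgroup _) : ℂ) * (wh ψ σ * wh ψ f) := by
  classical
  obtain ⟨E, hE⟩ := exists_inf_equiv (F := F) (d := d) (m := m)
  rw [← Nat.card_congr E, Nat.card_prod]
  unfold whM
  have h0 : ∀ u : U F (m + d), (u : GL (Fin (m + d)) F) ∉ Par (lf d m) →
      bl (lf d m) σ f ((u : GL (Fin (m + d)) F) : Matrix (Fin (m + d)) (Fin (m + d)) F) = 0 := by
    intro u hu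
    obtain ⟨a, b, c, g, hb⟩ := exists_blk (lf d m) ((u : GL (Fin (m + d)) F) :
      Matrix (Fin (m + d)) (Fin (m + d)) F)
    rw [hb]
    by_cases hc : c = 0
    · subst hc
      exact absurd ⟨a, b, g, hb⟩ hu
    · exact bl_blk_of_ne _ _ _ _ _ _ hc
  have h1 : ∑ u : U F (m + d), bl (lf d m) σ f (conjEquiv 1 ((u : GL (Fin (m + d)) F) :
      Matrix (Fin (m + d)) (Fin (m + d)) F)) * ψ (-suU u) = ∑ p : U F d × U F m,
      (σ ((p.1 : GL (Fin d) F) : Matrix (Fin d) (Fin d) F) * ψ (-suU p.1)) *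
      (f ((p.2 : GL (Fin m) F) : Matrix (Fin m) (Fin m) F) * ψ (-suU p.2)) := by
    symm
    refine Finset.sum_of_injOn (fun p => (⟨(E p).1, (E p).2.1⟩ : U F (m + d))) ?_ (by simp) ?_ ?_
    · intro p _ p' _ h
      exact E.injective (Subtype.ext (congrArg (fun z : U F (m + d) => (z : GL (Fin (m + d)) F)) h))
    · intro u _ hu
      rw [conjEquiv_one, h0 u, zero_mul]
      intro hp
      apply hu
      refine ⟨E.symm ⟨u, u.2, hp⟩, by simp, ?_⟩
      simp
    · intro p _
      have hs : suU (⟨(E p).1, (E p).2.1⟩ : U F (m + d)) = suU p.1 + suU p.2 := by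
        rw [suU, hE, su_blk]
        rfl
      rw [hs, conjEquiv_one, hE, bl_blk, neg_add, AddChar.map_add_eq_mul]
      ring
  rw [h1, Fintype.sum_prod_type]
  dsimp only
  rw [← Fintype.sum_mul_sum]
  unfold wh
  have := card_ne_zero (G := U F d)
  have := card_ne_zero (G := U F m)
  push_cast
  field_simp

theorem wh_Tf {ψ : AddChar F ℂ} (hψ : ψ ≠ 1) {σ : Matrix (Fin d) (Fin d) F → ℂ}
    {f : Matrix (Fin m) (Fin m) F → ℂ} (hσ : IsCl σ) (hf : IsCl f) :
    wh ψ (Tf (lf d m) σ f) = wh ψ σ * wh ψ f := by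
  classical
  have h1 : wh ψ (Tf (lf d m) σ f) = (Nat.card (U F (m + d)) : ℂ)⁻¹ *
      ((pc (F := F) (lf d m))⁻¹ * ∑ x : GL (Fin (m + d)) F, whM ψ σ f x) := by
    unfold wh whM Tf
    congr 1
    rw [Finset.sum_comm, Finset.mul_sum]
    refine Finset.sum_congr rfl fun u _ => ?_
    rw [← Finset.sum_mul]
    ring
  set s : Finset (GL (Fin (m + d)) F) :=
    Finset.univ.filter fun x => ∃ p ∈ Par (lf d m), ∃ v ∈ U F (m + d), p * v = x with hs
  have h2 : ∑ x : GL (Fin (m + d)) F, whM ψ σ f x = s.card * whM ψ σ f 1 := by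
    rw [← Finset.sum_subset (Finset.subset_univ s)]
    · rw [← nsmul_eq_mul, ← Finset.sum_const]
      refine Finset.sum_congr rfl fun x hx => ?_
      obtain ⟨p, hp, v, hv, rfl⟩ := (Finset.mem_filter.1 hx).2
      rw [← whM_mul hσ hf hp ⟨v, hv⟩ (x := 1), mul_one]
    · intro x _ hx
      exact whM_eq_zero hψ fun h => hx (Finset.mem_filter.2 ⟨Finset.mem_univ _, h⟩)
  have h3 := card_inf_mul_card_mul (Par (F := F) (lf d m)) (U F (m + d)) s (fun z => by
    rw [hs, Finset.mem_filter]
    simp)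
  have h4 : (Nat.card (U F (m + d) ⊓ Par (lf d m) : Subgroup _) : ℂ) * s.card =
      Nat.card (U F (m + d)) * pc (F := F) (lf d m) := by
    unfold pc
    exact_mod_cast h3
  rw [h1, h2, whM_one]
  have h5 := card_ne_zero (G := U F (m + d))
  have h6 := pc_ne_zero (F := F) (lf d m)
  calc _ = (Nat.card (U F (m + d)) : ℂ)⁻¹ * (pc (F := F) (lf d m))⁻¹ *
      ((Nat.card (U F (m + d) ⊓ Par (lf d m) : Subgroup _) : ℂ) * s.card) * (wh ψ σ * wh ψ f) := by
        ring
    _ = _ := by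
      rw [h4]
      field_simp

theorem wh_T {ψ : AddChar F ℂ} (hψ : ψ ≠ 1) {σ : Matrix (Fin d) (Fin d) F → ℂ}
    {f : Fam F} (hσ : IsCl σ) (hf : FCl f) {n : ℕ} (hn : n = m + d) :
    wh ψ (T d σ f n) = wh ψ σ * wh ψ (f m) := by
  subst hn
  rw [T_eq (lf d m), wh_Tf hψ hσ (hf m)]

end Multiplicativity

section Bimodule

variable {F : Type} [Field F] [Fintype F] {d m k n : ℕ}

theorem Uni.isUnit {u : Matrix (Fin n) (Fin n) F} (hu : Uni u) : IsUnit u := by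
  rw [Matrix.isUnit_iff_isUnit_det, hu.det]
  exact isUnit_one

/-- The bi-Whittaker functions on matrices, supported on the invertible ones. -/
def Bi (ψ : AddChar F ℂ) (n : ℕ) : Submodule ℂ (Matrix (Fin n) (Fin n) F → ℂ) where
  carrier := {φ | (∀ M, ¬ IsUnit M → φ M = 0) ∧
    ∀ u v M, Uni u → Uni v → φ (u * M * v) = ψ (su u + su v) * φ M}
  zero_mem' := ⟨fun _ _ => rfl, fun _ _ _ _ _ => by simp⟩
  add_mem' {φ φ'} h h' := ⟨fun M hM => by rw [Pi.add_apply, h.1 M hM, h'.1 M hM, add_zero],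
    fun u v M hu hv => by
      rw [Pi.add_apply, Pi.add_apply, h.2 u v M hu hv, h'.2 u v M hu hv, mul_add]⟩
  smul_mem' c φ h := ⟨fun M hM => by rw [Pi.smul_apply, h.1 M hM, smul_zero],
    fun u v M hu hv => by
      rw [Pi.smul_apply, Pi.smul_apply, h.2 u v M hu hv, smul_eq_mul, smul_eq_mul]
      ring⟩

/-- The frame of `Fin n` whose first block consists of the last `d` coordinates. -/
def lc (h : m + d = n) : Fin d ⊕ Fin m ≃ Fin n := (lf d m).trans (finCongr h)

theorem lc_inl (h : m + d = n) (i : Fin d) : ((lc h (Sum.inl i) : Fin n) : ℕ) = m + i := by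
  simp [lc, lf_inl]

theorem lc_inr (h : m + d = n) (i : Fin m) : ((lc h (Sum.inr i) : Fin n) : ℕ) = i := by
  simp [lc, lf_inr]

theorem uni_lc (h : m + d = n) (a : Matrix (Fin d) (Fin d) F) (b : Matrix (Fin d) (Fin m) F)
    (c : Matrix (Fin m) (Fin d) F) (g : Matrix (Fin m) (Fin m) F) :
    Uni (blk (lc h) a b c g) ↔ Uni a ∧ b = 0 ∧ Uni g := by
  subst h
  exact uni_blk a b c g

theorem su_lc (h : m + d = n) (a : Matrix (Fin d) (Fin d) F) (g : Matrix (Fin m) (Fin m) F) :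
    su (blk (lc h) a 0 0 g) = su a + su g := by
  subst h
  exact su_blk a g

/-- Rectangular block matrices: the rows are split into the last `k` and the first `m`,
the columns into the last `m` and the first `k`. -/
def rb (h : m + k = n) (a : Matrix (Fin k) (Fin m) F) (b : Matrix (Fin k) (Fin k) F)
    (c : Matrix (Fin m) (Fin m) F) (d : Matrix (Fin m) (Fin k) F) : Matrix (Fin n) (Fin n) F :=
  (fromBlocks a b c d).submatrix (lc h).symm (lc ((add_comm k m).trans h)).symm

theorem blk_mul_rb (h : m + k = n) (p : Matrix (Fin k) (Fin k) F) (q : Matrix (Fin k) (Fin m) F)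
    (r : Matrix (Fin m) (Fin k) F) (s : Matrix (Fin m) (Fin m) F) (a : Matrix (Fin k) (Fin m) F)
    (b : Matrix (Fin k) (Fin k) F) (c : Matrix (Fin m) (Fin m) F) (d : Matrix (Fin m) (Fin k) F) :
    blk (lc h) p q r s * rb h a b c d =
      rb h (p * a + q * c) (p * b + q * d) (r * a + s * c) (r * b + s * d) := by
  unfold blk rb
  rw [Matrix.submatrix_mul_equiv, fromBlocks_multiply]

theorem rb_mul_blk (h : m + k = n) (p : Matrix (Fin m) (Fin m) F) (q : Matrix (Fin m) (Fin k) F)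
    (r : Matrix (Fin k) (Fin m) F) (s : Matrix (Fin k) (Fin k) F) (a : Matrix (Fin k) (Fin m) F)
    (b : Matrix (Fin k) (Fin k) F) (c : Matrix (Fin m) (Fin m) F) (d : Matrix (Fin m) (Fin k) F) :
    rb h a b c d * blk (lc ((add_comm k m).trans h)) p q r s =
      rb h (a * p + b * r) (a * q + b * s) (c * p + d * r) (c * q + d * s) := by
  unfold blk rb
  rw [Matrix.submatrix_mul_equiv, fromBlocks_multiply]

theorem rb_inj (h : m + k = n) {a a' : Matrix (Fin k) (Fin m) F} {b b' : Matrix (Fin k) (Fin k) F}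
    {c c' : Matrix (Fin m) (Fin m) F} {d d' : Matrix (Fin m) (Fin k) F}
    (he : rb h a b c d = rb h a' b' c' d') : a = a' ∧ b = b' ∧ c = c' ∧ d = d' := by
  have := congrArg (fun M => M.submatrix (lc h) (lc ((add_comm k m).trans h))) he
  simpa [rb, fromBlocks_inj] using this

theorem rb_apply (h : m + k = n) (a : Matrix (Fin k) (Fin m) F) (b : Matrix (Fin k) (Fin k) F)
    (c : Matrix (Fin m) (Fin m) F) (d : Matrix (Fin m) (Fin k) F) (x : Fin k ⊕ Fin m)
    (y : Fin m ⊕ Fin k) : rb h a b c d (lc h x) (lc ((add_comm k m).trans h) y) =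
      fromBlocks a b c d x y := by
  simp [rb]

theorem exists_rb (h : m + k = n) (M : Matrix (Fin n) (Fin n) F) :
    ∃ a b c d, M = rb h a b c d := by
  set M' := M.submatrix (lc h) (lc ((add_comm k m).trans h)) with hM
  refine ⟨M'.toBlocks₁₁, M'.toBlocks₁₂, M'.toBlocks₂₁, M'.toBlocks₂₂, ?_⟩
  simp [rb, fromBlocks_toBlocks, hM]

/-- The antidiagonal block matrices with a scalar block of size `k`. -/
def an (h : m + k = n) (c : F) (g : Matrix (Fin m) (Fin m) F) : Matrix (Fin n) (Fin n) F :=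
  rb h 0 (c • 1) g 0

theorem an_isUnit (h : m + k = n) {c : F} (hc : c ≠ 0) {g : Matrix (Fin m) (Fin m) F}
    (hu : IsUnit (an h c g)) : IsUnit g := by
  obtain ⟨a, b, r, s, hi⟩ := exists_blk (lc h) hu.unit⁻¹.1
  have h1 : an h c g * hu.unit⁻¹.1 = 1 := hu.mul_val_inv
  by_contra hg
  obtain ⟨v, hv, hgv⟩ := Matrix.exists_vecMul_eq_zero_iff.2
    (not_not.1 (isUnit_iff_ne_zero.not.1 ((Matrix.isUnit_iff_isUnit_det g).not.1 hg)))
  have h2 : (Sum.elim (0 : Fin k → F) v ∘ (lc h).symm : Fin n → F) ᵥ* an h c g = 0 := by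
    funext y
    obtain ⟨y, rfl⟩ := (lc ((add_comm k m).trans h)).surjective y
    rw [Matrix.vecMul, dotProduct, ← Equiv.sum_comp (lc h), Fintype.sum_sum_type]
    simp only [an, rb_apply, Function.comp_apply, Equiv.symm_apply_apply, Sum.elim_inl,
      Sum.elim_inr, Pi.zero_apply, zero_mul, Finset.sum_const_zero, zero_add]
    rcases y with y | y
    · simpa [Matrix.vecMul, dotProduct] using congrFun hgv y
    · simp
  have h3 : (Sum.elim (0 : Fin k → F) v ∘ (lc h).symm) = (0 : Fin n → F) := by
    rw [← Matrix.vecMul_one (Sum.elim (0 : Fin k → F) v ∘ (lc h).symm), ← h1, ← Matrix.vecMul_vecMul, h2,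
      Matrix.zero_vecMul]
  apply hv
  funext i
  simpa using congrFun h3 (lc h (Sum.inr i))

theorem an_mul (h : m + k = n) (c : F) (g u v : Matrix (Fin m) (Fin m) F) :
    an h c (u * g * v) = blk (lc h) 1 0 0 u * an h c g *
      blk (lc ((add_comm k m).trans h)) v 0 0 1 := by
  rw [an, an, blk_mul_rb, rb_mul_blk]
  simp

theorem comp_mem_Bi {ψ : AddChar F ℂ} {φ : Matrix (Fin n) (Fin n) F → ℂ} (hφ : φ ∈ Bi ψ n)
    (h : m + k = n) {c : F} (hc : c ≠ 0) : (fun g => φ (an h c g)) ∈ Bi ψ m := by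
  refine ⟨fun g hg => hφ.1 _ fun hu => hg (an_isUnit h hc hu), fun u v g hu hv => ?_⟩
  show φ (an h c (u * g * v)) = ψ (su u + su v) * φ (an h c g)
  rw [an_mul, hφ.2 _ _ _ ((uni_lc h _ _ _ _).2 ⟨Uni.one, rfl, hu⟩)
    ((uni_lc _ _ _ _ _).2 ⟨hv, rfl, Uni.one⟩), su_lc, su_lc, su_one, zero_add, add_zero]

/-- The first `j` columns are `c` times consecutive standard basis vectors starting at `i`. -/
def Cols (x : Matrix (Fin n) (Fin n) F) (j i : ℕ) (c : F) : Prop :=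
  ∀ l : Fin n, (l : ℕ) < j → ∀ r : Fin n, x r l = if (r : ℕ) = i + l then c else 0

theorem Bi_left {ψ : AddChar F ℂ} {φ : Matrix (Fin n) (Fin n) F → ℂ} (hφ : φ ∈ Bi ψ n)
    {u : Matrix (Fin n) (Fin n) F} (hu : Uni u) (x : Matrix (Fin n) (Fin n) F) :
    φ (u * x) = ψ (su u) * φ x := by
  have := hφ.2 u 1 x hu Uni.one
  rwa [Matrix.mul_one, su_one, add_zero] at this

theorem Bi_right {ψ : AddChar F ℂ} {φ : Matrix (Fin n) (Fin n) F → ℂ} (hφ : φ ∈ Bi ψ n)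
    {u : Matrix (Fin n) (Fin n) F} (hu : Uni u) (x : Matrix (Fin n) (Fin n) F) :
    φ (x * u) = ψ (su u) * φ x := by
  have := hφ.2 1 u x Uni.one hu
  rwa [Matrix.one_mul, su_one, zero_add] at this

theorem addChar_ne_zero (ψ : AddChar F ℂ) (a : F) : ψ a ≠ 0 := by
  intro h
  have h1 := AddChar.map_add_eq_mul ψ a (-a)
  rw [add_neg_cancel, AddChar.map_zero_eq_one, h, zero_mul] at h1
  exact one_ne_zero h1

theorem exists_addChar_ne {ψ : AddChar F ℂ} (hψ : ψ ≠ 1) {a b : F} (hab : a ≠ b) :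
    ∃ t, ψ (t * a) ≠ ψ (t * b) := by
  by_contra h
  push Not at h
  refine hψ (DFunLike.ext _ _ fun s => ?_)
  have h1 := h (s * (a - b)⁻¹)
  have h2 := AddChar.map_add_eq_mul ψ (s * (a - b)⁻¹ * b) s
  rw [show s * (a - b)⁻¹ * b + s = s * (a - b)⁻¹ * a by
    field_simp [sub_ne_zero.2 hab]
    ring, h1] at h2
  rw [AddChar.one_apply]
  exact (mul_left_cancel₀ (addChar_ne_zero ψ _) (by rw [mul_one]; exact h2)).symm

/-- Clearing a column above a pivot. -/
theorem clear_column (x : Matrix (Fin n) (Fin n) F) (l p : Fin n) (c : F) (hc : c ≠ 0)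
    (hp : x p l = c) (h0 : ∀ r, p < r → x r l = 0) : ∃ u : Matrix (Fin n) (Fin n) F, Uni u ∧
      (∀ r, (u * x) r l = if r = p then c else 0) ∧
      ∀ l', x p l' = 0 → ∀ r, (u * x) r l' = x r l' := by
  set y : Fin n → F := fun r => if r < p then -c⁻¹ * x r l else 0 with hy
  have hmul : ∀ r l', ((1 + vecMulVec y (Pi.single p 1)) * x) r l' = x r l' + y r * x p l' := by
    intro r l'
    rw [Matrix.add_mul, Matrix.one_mul, Matrix.add_apply, Matrix.vecMulVec_mul,
      Matrix.single_one_vecMul, vecMulVec_apply]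
    rfl
  refine ⟨1 + vecMulVec y (Pi.single p 1), uni_one_add _ _ fun a b hab => ?_, fun r => ?_,
    fun l' hl' r => ?_⟩
  · by_cases hbp : b = p
    · subst hbp
      rw [hy]
      simp [not_lt.2 hab]
    · rw [Pi.single_eq_of_ne hbp, mul_zero]
  · rw [hmul, hp, hy]
    dsimp only
    rcases lt_trichotomy r p with h | h | h
    · rw [if_pos h, if_neg h.ne]
      field_simp
      ring
    · rw [if_neg (by rw [h]; exact lt_irrefl _), if_pos h, h, hp, zero_mul, add_zero]
    · rw [if_neg (not_lt.2 h.le), if_neg h.ne', h0 r h, zero_mul, add_zero]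
  · rw [hmul, hl', mul_zero, add_zero]

theorem Bi_cols {ψ : AddChar F ℂ} (hψ : ψ ≠ 1) {φ : Matrix (Fin n) (Fin n) F → ℂ}
    (hφ : φ ∈ Bi ψ n)
    (han : ∀ (m k : ℕ) (h : m + k = n), 1 ≤ k → ∀ c : F, c ≠ 0 → ∀ g, φ (an h c g) = 0) (t : ℕ) :
    ∀ (x : Matrix (Fin n) (Fin n) F) (j i : ℕ) (c : F), c ≠ 0 → 1 ≤ j → i + j + t = n →
      Cols x j i c → φ x = 0 := by
  induction t with
  | zero =>
    intro x j i c hc hj hn hx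
    rw [add_zero] at hn
    obtain ⟨a, b, g, d, rfl⟩ := exists_rb hn x
    have hb : b = c • 1 := by
      ext p q
      have := hx (lc ((add_comm j i).trans hn) (Sum.inr q)) (by rw [lc_inr]; exact q.2)
        (lc hn (Sum.inl p))
      rw [rb_apply, lc_inl, lc_inr, fromBlocks_apply₁₂] at this
      rw [this, Matrix.smul_apply, Matrix.one_apply, smul_eq_mul, mul_ite, mul_one, mul_zero]
      refine if_congr ?_ rfl rfl
      rw [Fin.ext_iff]
      omega
    have hd : d = 0 := by
      ext p q
      have := hx (lc ((add_comm j i).trans hn) (Sum.inr q)) (by rw [lc_inr]; exact q.2)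
        (lc hn (Sum.inr p))
      rw [rb_apply, lc_inr, lc_inr, fromBlocks_apply₂₂, if_neg (by omega)] at this
      exact this
    have hv := (uni_lc ((add_comm j i).trans hn) (1 : Matrix (Fin i) (Fin i) F) 0 (-c⁻¹ • a) 1).2
      ⟨Uni.one, rfl, Uni.one⟩
    have h1 := Bi_right hφ hv (rb hn a b g d)
    rw [rb_mul_blk, hb, hd] at h1
    have h2 : rb hn (a * (1 : Matrix (Fin i) (Fin i) F) +
        (c • (1 : Matrix (Fin j) (Fin j) F)) * (-c⁻¹ • a))
        (a * (0 : Matrix (Fin i) (Fin j) F) + (c • 1) * (1 : Matrix (Fin j) (Fin j) F))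
        (g * (1 : Matrix (Fin i) (Fin i) F) + (0 : Matrix (Fin i) (Fin j) F) * (-c⁻¹ • a))
        (g * (0 : Matrix (Fin i) (Fin j) F) +
          (0 : Matrix (Fin i) (Fin j) F) * (1 : Matrix (Fin j) (Fin j) F)) = an hn c g := by
      rw [an]
      congr 1 <;> simp [smul_smul, hc]
    rw [h2, han _ _ hn hj c hc, eq_comm, mul_eq_zero] at h1
    rw [hb, hd]
    exact h1.resolve_left (addChar_ne_zero ψ _)
  | succ t ih =>
    intro x j i c hc hj hn hx
    set p : Fin n := ⟨i + j, by omega⟩ with hp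
    set p' : Fin n := ⟨i + j - 1, by omega⟩ with hp'
    set l : Fin n := ⟨j, by omega⟩ with hl
    set l' : Fin n := ⟨j - 1, by omega⟩ with hl'
    by_contra hne
    have key : ∀ b : Fin n, p ≤ b → x b l = if b = p then c else 0 := by
      intro b hb
      by_contra hxb
      obtain ⟨s, hs⟩ := exists_addChar_ne hψ (a := if b = p then 1 else 0) (b := c⁻¹ * x b l) (by
        intro h
        apply hxb
        rw [eq_inv_mul_iff_mul_eq₀ hc] at h
        rw [← h]
        simp)
      have hrow : ∀ q : Fin n, q ≤ l' → x b q = 0 := by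
        intro q hq
        rw [hl', Fin.le_def] at hq
        rw [hp, Fin.le_def] at hb
        simp only at hq hb
        rw [hx q (by omega) b, if_neg (by omega)]
      have hu := uni_split (Pi.single p' 1) (s • Pi.single b 1 : Fin n → F) p'
        (fun a ha => Pi.single_eq_of_ne ha.ne' _) (fun a ha => by
          rw [Pi.smul_apply, Pi.single_eq_of_ne, smul_zero]
          rintro rfl
          rw [hp, Fin.le_def] at hb
          rw [hp', Fin.le_def] at ha
          simp only at hb ha
          omega)
      have hsu : su (1 + vecMulVec (Pi.single p' 1) (s • Pi.single b 1 : Fin n → F)) =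
          s * if b = p then 1 else 0 := by
        rw [su_one_add _ _ p' p (by rw [hp, hp']; simp only; omega)
          (fun a ha => Pi.single_eq_of_ne ha.ne' _) (fun a ha => by
          rw [Pi.smul_apply, Pi.single_eq_of_ne, smul_zero]
          rintro rfl
          rw [hp, Fin.le_def] at hb
          rw [hp', Fin.le_def] at ha
          simp only at hb ha
          omega)]
        simp [Pi.single_apply, eq_comm]
      have hv0 : ∀ a, a ≤ l' → ((s * c⁻¹) • x b) a = 0 := fun a ha => by
        rw [Pi.smul_apply, hrow a ha, smul_zero]
      have hv := uni_split (Pi.single l' 1) ((s * c⁻¹) • x b) l'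
        (fun a ha => Pi.single_eq_of_ne ha.ne' _) hv0
      have hsv : su (1 + vecMulVec (Pi.single l' 1) ((s * c⁻¹) • x b)) = s * (c⁻¹ * x b l) := by
        rw [su_one_add _ _ l' l (by rw [hl, hl']; simp only; omega)
          (fun a ha => Pi.single_eq_of_ne ha.ne' _) hv0]
        simp [mul_assoc]
      have hcol : x *ᵥ Pi.single l' 1 = c • Pi.single p' 1 := by
        funext r
        rw [Matrix.mulVec_single_one, Matrix.col_apply, hx l' (by rw [hl']; simp only; omega) r,
          Pi.smul_apply, Pi.single_apply, smul_eq_mul, mul_ite, mul_one, mul_zero]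
        refine if_congr ?_ rfl rfl
        rw [Fin.ext_iff, hl', hp']
        simp only
        omega
      have heq : (1 + vecMulVec (Pi.single p' 1) (s • Pi.single b 1 : Fin n → F)) * x =
          x * (1 + vecMulVec (Pi.single l' 1) ((s * c⁻¹) • x b)) := by
        rw [Matrix.add_mul, Matrix.mul_add, Matrix.one_mul, Matrix.mul_one, Matrix.vecMulVec_mul,
          Matrix.mul_vecMulVec, hcol, Matrix.smul_vecMul, Matrix.single_one_vecMul]
        congr 1
        ext r q
        simp only [vecMulVec_apply, Pi.smul_apply, smul_eq_mul, Matrix.row_apply]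
        field_simp
      have h1 := Bi_left hφ hu x
      rw [heq, Bi_right hφ hv x, hsu, hsv] at h1
      exact hs (mul_right_cancel₀ hne h1.symm)
    obtain ⟨u, hu, h1, h2⟩ := clear_column x l p c hc (by rw [key p le_rfl, if_pos rfl])
      (fun r hr => by rw [key r hr.le, if_neg hr.ne'])
    have h3 := ih (u * x) (j + 1) i c hc (by omega) (by omega) (by
      intro q hq r
      rcases Nat.lt_succ_iff_lt_or_eq.1 hq with hq | hq
      · rw [h2 q (by rw [hx q hq, if_neg]; rw [hp]; simp only; omega), hx q hq]
      · have : q = l := Fin.ext hq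
        rw [this, h1]
        refine if_congr ?_ rfl rfl
        rw [Fin.ext_iff])
    rw [Bi_left hφ hu, mul_eq_zero] at h3
    exact hne (h3.resolve_left (addChar_ne_zero ψ _))

theorem Bi_inj {ψ : AddChar F ℂ} (hψ : ψ ≠ 1) (hn : 1 ≤ n) {φ : Matrix (Fin n) (Fin n) F → ℂ}
    (hφ : φ ∈ Bi ψ n)
    (han : ∀ (m k : ℕ) (h : m + k = n), 1 ≤ k → ∀ c : F, c ≠ 0 → ∀ g, φ (an h c g) = 0) :
    φ = 0 := by
  classical
  funext x
  by_cases hx : IsUnit x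
  swap
  · exact hφ.1 x hx
  set l : Fin n := ⟨0, hn⟩ with hl
  have hs : (Finset.univ.filter fun r => x r l ≠ 0).Nonempty := by
    by_contra h
    rw [Finset.not_nonempty_iff_eq_empty] at h
    have h1 : x.det = 0 := Matrix.det_eq_zero_of_column_eq_zero l fun r => by
      by_contra hr
      exact Finset.notMem_empty r (h ▸ Finset.mem_filter.2 ⟨Finset.mem_univ _, hr⟩)
    rw [Matrix.isUnit_iff_isUnit_det, h1] at hx
    exact not_isUnit_zero hx
  set p := Finset.max' _ hs with hp
  have hpne : x p l ≠ 0 := (Finset.mem_filter.1 (Finset.max'_mem _ hs)).2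
  obtain ⟨u, hu, h1, -⟩ := clear_column x l p _ hpne rfl (fun r hr => by
    by_contra h
    exact absurd (Finset.le_max' _ r (by simpa using h)) (not_le.2 hr))
  have hp2 := p.2
  have h3 := Bi_cols hψ hφ han (n - p - 1) (u * x) 1 p _ hpne le_rfl (by omega) (by
    intro q hq r
    have : q = l := Fin.ext (by rw [hl]; simp only; omega)
    rw [this, h1]
    refine if_congr ?_ rfl rfl
    rw [Fin.ext_iff, hl]
    simp)
  rw [Bi_left hφ hu, mul_eq_zero] at h3
  exact h3.resolve_left (addChar_ne_zero ψ _)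

end Bimodule

section BimoduleDim

variable {F : Type} [Field F] [Fintype F] {d m k n : ℕ}

theorem isUnit_an (h : m + k = n) {c : F} (hc : c ≠ 0) {g : Matrix (Fin m) (Fin m) F}
    (hg : IsUnit g) : IsUnit (an h c g) := by
  obtain ⟨g, rfl⟩ := hg
  have h1 : an h c (g : Matrix (Fin m) (Fin m) F) *
      (fromBlocks 0 ((g⁻¹ : GL (Fin m) F) : Matrix (Fin m) (Fin m) F)
        (c⁻¹ • (1 : Matrix (Fin k) (Fin k) F)) 0).submatrix
        (lc ((add_comm k m).trans h)).symm (lc h).symm = 1 := by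
    rw [an, rb, Matrix.submatrix_mul_equiv, fromBlocks_multiply]
    simp [smul_smul, hc, fromBlocks_one]
  exact ⟨⟨_, _, h1, mul_eq_one_comm.1 h1⟩, rfl⟩

theorem an_last (h : m + k = n) (hk : 1 ≤ k) (c : F) (g : Matrix (Fin m) (Fin m) F)
    (r j : Fin n) (hr : (r : ℕ) + 1 = n) : an h c g r j = if (j : ℕ) + 1 = k then c else 0 := by
  have hr' : r = lc h (Sum.inl ⟨k - 1, by omega⟩) := by
    rw [Fin.ext_iff, lc_inl]
    simp only
    omega
  obtain ⟨y, rfl⟩ := (lc ((add_comm k m).trans h)).surjective j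
  rw [hr', an, rb_apply]
  rcases y with y | y
  · rw [lc_inl, fromBlocks_apply₁₁, if_neg (by omega)]
    rfl
  · rw [lc_inr, fromBlocks_apply₁₂, Matrix.smul_apply, Matrix.one_apply, smul_eq_mul, mul_ite,
      mul_one, mul_zero]
    refine if_congr ?_ rfl rfl
    rw [Fin.ext_iff]
    simp only
    omega

theorem Uni.lower {M : Matrix (Fin n) (Fin n) F} (hM : Uni M) {i j : Fin n} (h : j < i) :
    M i j = 0 := by
  rw [hM i j h.le, Matrix.one_apply_ne h.ne']

theorem Uni.diag {M : Matrix (Fin n) (Fin n) F} (hM : Uni M) (i : Fin n) : M i i = 1 := by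
  rw [hM i i le_rfl, Matrix.one_apply_eq]

theorem uni_mul_an_mul_last (h : m + k = n) (hk : 1 ≤ k) (c : F) (g : Matrix (Fin m) (Fin m) F)
    {u v : Matrix (Fin n) (Fin n) F} (hu : Uni u) (r p j : Fin n)
    (hr : (r : ℕ) + 1 = n) (hp : (p : ℕ) + 1 = k) : (u * an h c g * v) r j = c * v p j := by
  rw [Matrix.mul_assoc, Matrix.mul_apply, Finset.sum_eq_single r, hu.diag, one_mul,
    Matrix.mul_apply, Finset.sum_eq_single p, an_last h hk _ _ _ _ hr, if_pos hp]
  · intro b _ hb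
    rw [an_last h hk _ _ _ _ hr, if_neg, zero_mul]
    intro hb'
    exact hb (Fin.ext (by omega))
  · intro h
    exact absurd (Finset.mem_univ _) h
  · intro b _ hb
    rw [hu.lower, zero_mul]
    rw [Fin.lt_def]
    have := Fin.val_ne_of_ne hb
    omega
  · intro h
    exact absurd (Finset.mem_univ _) h

theorem an_disjoint (h : m + k = n) (hk : 1 ≤ k) {c : F} (hc : c ≠ 0)
    {m' k' : ℕ} (h' : m' + k' = n) (hk' : 1 ≤ k') {c' : F} (hc' : c' ≠ 0)
    {g : Matrix (Fin m) (Fin m) F} {g' : Matrix (Fin m') (Fin m') F}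
    {u v : Matrix (Fin n) (Fin n) F} (hu : Uni u) (hv : Uni v)
    (he : u * an h c g * v = an h' c' g') : k = k' ∧ c = c' := by
  have hl : ∀ j : Fin n, c * v ⟨k - 1, by omega⟩ j = if (j : ℕ) + 1 = k' then c' else 0 := by
    intro j
    rw [← uni_mul_an_mul_last h hk c g hu (v := v) ⟨n - 1, by omega⟩ ⟨k - 1, by omega⟩ j
      (by simp only; omega) (by simp only; omega), he, an_last h' hk' _ _ _ _ (by simp only; omega)]
  rcases lt_trichotomy k k' with hlt | heq | hlt
  · have := hl ⟨k - 1, by omega⟩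
    rw [hv.diag, mul_one, if_neg (by simp only; omega)] at this
    exact absurd this hc
  · refine ⟨heq, ?_⟩
    have := hl ⟨k - 1, by omega⟩
    rwa [hv.diag, mul_one, if_pos (by simp only; omega)] at this
  · have := hl ⟨k' - 1, by omega⟩
    rw [hv.lower (by rw [Fin.lt_def]; simp only; omega), mul_zero,
      if_pos (by simp only; omega)] at this
    exact absurd this.symm hc'

theorem exists_lc_of_uni (h : m + k = n) {u : Matrix (Fin n) (Fin n) F} (hu : Uni u) :
    ∃ (p : Matrix (Fin k) (Fin k) F) (q : Matrix (Fin m) (Fin k) F) (s : Matrix (Fin m) (Fin m) F),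
      u = blk (lc h) p 0 q s ∧ Uni p ∧ Uni s := by
  obtain ⟨p, b, q, s, rfl⟩ := exists_blk (lc h) u
  obtain ⟨hp, rfl, hs⟩ := (uni_lc h _ _ _ _).1 hu
  exact ⟨p, q, s, rfl, hp, hs⟩

theorem uni_mul_an_mul (h : m + k = n) {c : F} (hc : c ≠ 0) {u v : Matrix (Fin n) (Fin n) F}
    (hu : Uni u) (hv : Uni v) {g₀ g₁ : Matrix (Fin m) (Fin m) F}
    (he : u * an h c g₀ * v = an h c g₁) : ∃ s p : Matrix (Fin m) (Fin m) F, Uni s ∧ Uni p ∧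
      su s + su p = su u + su v ∧ ∀ g, u * an h c g * v = an h c (s * g * p) := by
  obtain ⟨p, q, s, rfl, hp, hs⟩ := exists_lc_of_uni h hu
  obtain ⟨p', q', s', rfl, hp', hs'⟩ := exists_lc_of_uni ((add_comm k m).trans h) hv
  have key : ∀ g, blk (lc h) p 0 q s * an h c g * blk (lc ((add_comm k m).trans h)) p' 0 q' s' =
      rb h (c • (p * q')) (c • (p * s')) (s * g * p' + c • (q * q')) (c • (q * s')) := by
    intro g
    rw [an, blk_mul_rb, rb_mul_blk]
    simp
  rw [key, an] at he
  obtain ⟨h1, h2, -, h3⟩ := rb_inj h he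
  have h2' : p * s' = 1 := by
    have := congrArg (fun M => c⁻¹ • M) h2
    simpa [smul_smul, hc] using this
  have hq' : q' = 0 := by
    have h4 : p * q' = 0 := (smul_eq_zero.1 h1).resolve_left hc
    rw [← Matrix.one_mul q', ← mul_eq_one_comm.1 h2', Matrix.mul_assoc, h4, Matrix.mul_zero]
  have hq : q = 0 := by
    have h4 : q * s' = 0 := (smul_eq_zero.1 h3).resolve_left hc
    rw [← Matrix.mul_one q, ← mul_eq_one_comm.1 h2', ← Matrix.mul_assoc, h4, Matrix.zero_mul]
  refine ⟨s, p', hs, hp', ?_, fun g => ?_⟩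
  · have h5 := hp.su_mul hs'
    rw [h2', su_one] at h5
    rw [hq, hq', su_lc, su_lc]
    linear_combination h5
  · rw [key, hq', hq, h2', an]
    simp

theorem an_inj (h : m + k = n) {c : F} {g g' : Matrix (Fin m) (Fin m) F}
    (he : an h c g = an h c g') : g = g' := (rb_inj h he).2.2.1

open Classical in
/-- The bi-Whittaker function supported on the double cosets of antidiagonal block matrices. -/
noncomputable def lift (ψ : AddChar F ℂ) (h : m + k = n) (c : F)
    (φ : Matrix (Fin m) (Fin m) F → ℂ) (x : Matrix (Fin n) (Fin n) F) : ℂ :=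
  ∑ u : U F n, ∑ v : U F n, ψ (-suU u - suU v) *
    ∑ g, if ((u : GL (Fin n) F) : Matrix (Fin n) (Fin n) F) * x * ((v : GL (Fin n) F) :
      Matrix (Fin n) (Fin n) F) = an h c g then φ g else 0

theorem lift_mem (ψ : AddChar F ℂ) (h : m + k = n) {c : F} (hc : c ≠ 0)
    {φ : Matrix (Fin m) (Fin m) F → ℂ} (hφ : φ ∈ Bi ψ m) : lift ψ h c φ ∈ Bi ψ n := by
  classical
  refine ⟨fun M hM => ?_, fun u₀ v₀ M hu hv => ?_⟩
  · refine Finset.sum_eq_zero fun u _ => Finset.sum_eq_zero fun v _ => ?_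
    rw [Finset.sum_eq_zero, mul_zero]
    intro g _
    rw [ite_eq_right_iff]
    intro he
    by_contra hg
    have hgu : IsUnit g := by
      by_contra hgu
      exact hg (hφ.1 g hgu)
    have h1 := isUnit_an h hc hgu
    rw [← he, Units.isUnit_mul_units, Units.isUnit_units_mul] at h1
    exact hM h1
  · obtain ⟨u₀, rfl⟩ := hu.exists_U
    obtain ⟨v₀, rfl⟩ := hv.exists_U
    unfold lift
    rw [Finset.mul_sum, ← Equiv.sum_comp (Equiv.mulRight u₀)
      (fun u => ψ (su ((u₀ : GL (Fin n) F) : Matrix (Fin n) (Fin n) F) +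
        su ((v₀ : GL (Fin n) F) : Matrix (Fin n) (Fin n) F)) * _)]
    refine Finset.sum_congr rfl fun u _ => ?_
    rw [Finset.mul_sum]
    conv_rhs => rw [← Equiv.sum_comp (Equiv.mulLeft v₀)]
    refine Finset.sum_congr rfl fun v _ => ?_
    rw [← mul_assoc (ψ (su _ + su _)), ← AddChar.map_add_eq_mul, Equiv.coe_mulLeft,
      Equiv.coe_mulRight, suU_mul, suU_mul]
    congr 1
    · congr 1
      unfold suU
      ring
    · refine Finset.sum_congr rfl fun g _ => ?_
      refine if_congr ?_ rfl rfl
      rw [Subgroup.coe_mul, Subgroup.coe_mul, Units.val_mul, Units.val_mul]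
      simp only [Matrix.mul_assoc]

theorem lift_an (ψ : AddChar F ℂ) (h : m + k = n) {c : F} (hc : c ≠ 0) : ∃ N : ℂ, N ≠ 0 ∧
    ∀ φ ∈ Bi ψ m, ∀ g, lift ψ h c φ (an h c g) = N * φ g := by
  classical
  set S : Finset (U F n × U F n) := Finset.univ.filter fun w =>
    ∃ g₀ g₁, ((w.1 : GL (Fin n) F) : Matrix (Fin n) (Fin n) F) * an h c g₀ *
      ((w.2 : GL (Fin n) F) : Matrix (Fin n) (Fin n) F) = an h c g₁ with hS
  refine ⟨S.card, ?_, fun φ hφ g => ?_⟩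
  · rw [Nat.cast_ne_zero, ← pos_iff_ne_zero, Finset.card_pos]
    exact ⟨(1, 1), Finset.mem_filter.2 ⟨Finset.mem_univ _, 1, 1, by simp⟩⟩
  · unfold lift
    rw [← Fintype.sum_prod_type' (f := fun (u v : U F n) => ψ (-suU u - suU v) *
      ∑ g', if ((u : GL (Fin n) F) : Matrix (Fin n) (Fin n) F) * an h c g *
      ((v : GL (Fin n) F) : Matrix (Fin n) (Fin n) F) = an h c g' then φ g' else 0),
      ← Finset.sum_subset (Finset.subset_univ S), Finset.cast_card, Finset.sum_mul]
    · refine Finset.sum_congr rfl fun w hw => ?_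
      obtain ⟨g₀, g₁, he⟩ := (Finset.mem_filter.1 hw).2
      obtain ⟨s, p, hs, hp, hsp, hg⟩ := uni_mul_an_mul h hc (U_uni w.1) (U_uni w.2) he
      rw [Finset.sum_eq_single (s * g * p), if_pos (hg g), hφ.2 s p g hs hp, hsp, ← mul_assoc,
        ← AddChar.map_add_eq_mul]
      · unfold suU
        rw [show ∀ a b : F, -a - b + (a + b) = 0 by intros; ring, AddChar.map_zero_eq_one]
      · intro b _ hb
        rw [if_neg]
        rw [hg]
        exact fun h' => hb (an_inj h h').symm
      · exact fun h => absurd (Finset.mem_univ _) h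
    · intro w _ hw
      rw [Finset.sum_eq_zero, mul_zero]
      intro g' _
      rw [if_neg]
      exact fun he => hw (Finset.mem_filter.2 ⟨Finset.mem_univ _, g, g', he⟩)

theorem lift_an_ne (ψ : AddChar F ℂ) (h : m + k = n) (hk : 1 ≤ k) {c : F} (hc : c ≠ 0)
    {m' k' : ℕ} (h' : m' + k' = n) (hk' : 1 ≤ k') {c' : F} (hc' : c' ≠ 0)
    (hne : ¬ (k' = k ∧ c' = c)) (φ : Matrix (Fin m) (Fin m) F → ℂ)
    (g : Matrix (Fin m') (Fin m') F) : lift ψ h c φ (an h' c' g) = 0 := by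
  refine Finset.sum_eq_zero fun u _ => Finset.sum_eq_zero fun v _ => ?_
  rw [Finset.sum_eq_zero, mul_zero]
  intro g' _
  rw [if_neg]
  exact fun he => hne (an_disjoint h' hk' hc' h hk hc (U_uni u) (U_uni v) he)

/-- Restriction of bi-Whittaker functions to antidiagonal block matrices. -/
def toAn (ψ : AddChar F ℂ) (n : ℕ) : Bi (F := F) ψ n →ₗ[ℂ] ((i : Fin n × Fˣ) → Bi ψ (i.1 : ℕ)) where
  toFun φ i := ⟨fun g => φ.1 (an (Nat.add_sub_cancel' i.1.2.le) (i.2 : F) g),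
    comp_mem_Bi φ.2 _ i.2.ne_zero⟩
  map_add' _ _ := rfl
  map_smul' _ _ := rfl

theorem toAn_bijective {ψ : AddChar F ℂ} (hψ : ψ ≠ 1) (hn : 1 ≤ n) :
    Function.Bijective (toAn ψ n) := by
  classical
  constructor
  · rw [← LinearMap.ker_eq_bot, LinearMap.ker_eq_bot']
    intro φ hφ
    ext1
    refine Bi_inj hψ hn φ.2 fun m k h hk c hc g => ?_
    obtain rfl : k = n - m := by omega
    have h1 := congrFun hφ (⟨m, by omega⟩, Units.mk0 c hc)
    exact congrFun (Subtype.ext_iff.1 h1) g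
  · intro f
    choose N hN hNf using fun i : Fin n × Fˣ =>
      lift_an ψ (Nat.add_sub_cancel' i.1.2.le) i.2.ne_zero
    refine ⟨∑ i : Fin n × Fˣ, (N i)⁻¹ • ⟨lift ψ (Nat.add_sub_cancel' i.1.2.le) i.2 (f i).1,
      lift_mem ψ _ i.2.ne_zero (f i).2⟩, ?_⟩
    rw [map_sum]
    funext j
    rw [Finset.sum_apply, Finset.sum_eq_single j]
    · ext1
      funext g
      rw [map_smul]
      show (N j)⁻¹ * lift ψ _ _ _ (an _ _ g) = _
      rw [hNf j _ (f j).2, inv_mul_cancel_left₀ (hN j)]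
    · intro i _ hij
      ext1
      funext g
      rw [map_smul]
      show (N i)⁻¹ * lift ψ _ _ _ (an _ _ g) = 0
      rw [lift_an_ne ψ _ (by omega) i.2.ne_zero _ (by omega) j.2.ne_zero, mul_zero]
      rintro ⟨h1, h2⟩
      exact hij (Prod.ext (Fin.ext (by omega)) (Units.ext h2.symm))
    · exact fun h => absurd (Finset.mem_univ _) h

theorem finrank_Bi_sum {ψ : AddChar F ℂ} (hψ : ψ ≠ 1) (hn : 1 ≤ n) :
    Module.finrank ℂ (Bi (F := F) ψ n) =
      (Fintype.card F - 1) * ∑ m ∈ Finset.range n, Module.finrank ℂ (Bi (F := F) ψ m) := by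
  classical
  rw [(LinearEquiv.ofBijective _ (toAn_bijective hψ hn)).finrank_eq, Module.finrank_pi_fintype,
    Fintype.sum_prod_type]
  change ∑ x : Fin n, ∑ _ : Fˣ, Module.finrank ℂ (Bi (F := F) ψ (x : ℕ)) = _
  simp only [Finset.sum_const, Finset.card_univ, Fintype.card_units, smul_eq_mul]
  rw [← Finset.mul_sum, Finset.sum_range]

theorem finrank_Bi_zero (ψ : AddChar F ℂ) : Module.finrank ℂ (Bi (F := F) ψ 0) = 1 := by
  have h : Bi (F := F) ψ 0 = ⊤ := by
    refine eq_top_iff.2 fun φ _ => ⟨fun M hM => absurd (isUnit_of_subsingleton M) hM,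
      fun u v M _ _ => ?_⟩
    rw [Subsingleton.elim (u * M * v) M, show su u = 0 by simp [su], show su v = 0 by simp [su],
      add_zero, AddChar.map_zero_eq_one, one_mul]
  rw [h, finrank_top, Module.finrank_fintype_fun_eq_card]
  exact Fintype.card_eq_one_iff.2 ⟨0, fun _ => Subsingleton.elim _ _⟩

theorem finrank_Bi {ψ : AddChar F ℂ} (hψ : ψ ≠ 1) (n : ℕ) :
    Module.finrank ℂ (Bi (F := F) ψ (n + 1)) = (Fintype.card F - 1) * Fintype.card F ^ n := by
  have key : ∀ n, ∑ m ∈ Finset.range (n + 1), Module.finrank ℂ (Bi (F := F) ψ m) =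
      Fintype.card F ^ n := by
    intro n
    induction n with
    | zero => simp [finrank_Bi_zero]
    | succ n ih =>
      rw [Finset.sum_range_succ, finrank_Bi_sum hψ (by omega), ih, pow_succ]
      have := Fintype.card_pos (α := F)
      obtain ⟨q, hq⟩ := Nat.exists_eq_succ_of_ne_zero this.ne'
      rw [hq, Nat.succ_eq_add_one, Nat.add_sub_cancel]
      ring
  rw [finrank_Bi_sum hψ (by omega), key]

/-- Reflection of matrices in the antidiagonal. -/
def fl (M : Matrix (Fin n) (Fin n) F) : Matrix (Fin n) (Fin n) F :=
  Mᵀ.submatrix Fin.rev Fin.rev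

theorem fl_mul (M N : Matrix (Fin n) (Fin n) F) : fl (M * N) = fl N * fl M := by
  unfold fl
  rw [Matrix.transpose_mul, ← Matrix.submatrix_mul_equiv _ _ Fin.rev Fin.revPerm Fin.rev]
  rfl

theorem fl_fl (M : Matrix (Fin n) (Fin n) F) : fl (fl M) = M := by
  ext i j
  simp [fl]

theorem Uni.fl {M : Matrix (Fin n) (Fin n) F} (hM : Uni M) : Uni (fl M) := by
  intro i j hij
  have := hM j.rev i.rev (Fin.rev_le_rev.2 hij)
  rw [show GLCuspidal.fl M i j = M j.rev i.rev from rfl, this, Matrix.one_apply, Matrix.one_apply]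
  refine if_congr ?_ rfl rfl
  rw [Fin.rev_inj, eq_comm]

theorem fl_isUnit {M : Matrix (Fin n) (Fin n) F} : IsUnit (fl M) ↔ IsUnit M := by
  rw [Matrix.isUnit_iff_isUnit_det, Matrix.isUnit_iff_isUnit_det]
  have : (fl M).det = M.det := by
    have := Matrix.det_submatrix_equiv_self Fin.revPerm Mᵀ
    rw [Matrix.det_transpose] at this
    exact this
  rw [this]

theorem fl_an (h : m + k = n) (c : F) (g : Matrix (Fin m) (Fin m) F) :
    fl (an h c g) = an h c (fl g) := by
  have hl : ∀ i : Fin k, (lc h (Sum.inl i)).rev = lc ((add_comm k m).trans h) (Sum.inr i.rev) := by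
    intro i
    rw [Fin.ext_iff, Fin.val_rev, lc_inl, lc_inr, Fin.val_rev]
    omega
  have hr : ∀ i : Fin m, (lc h (Sum.inr i)).rev = lc ((add_comm k m).trans h) (Sum.inl i.rev) := by
    intro i
    rw [Fin.ext_iff, Fin.val_rev, lc_inl, lc_inr, Fin.val_rev]
    omega
  have hl' : ∀ i : Fin k, (lc ((add_comm k m).trans h) (Sum.inr i)).rev = lc h (Sum.inl i.rev) := by
    intro i
    rw [Fin.rev_eq_iff, hl, Fin.rev_rev]
  have hr' : ∀ i : Fin m, (lc ((add_comm k m).trans h) (Sum.inl i)).rev = lc h (Sum.inr i.rev) := by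
    intro i
    rw [Fin.rev_eq_iff, hr, Fin.rev_rev]
  ext i j
  obtain ⟨x, rfl⟩ := (lc h).surjective i
  obtain ⟨y, rfl⟩ := (lc ((add_comm k m).trans h)).surjective j
  rw [show ∀ i j, fl (an h c g) i j = an h c g j.rev i.rev from fun _ _ => rfl]
  rcases x with x | x <;> rcases y with y | y
  · rw [hl, hr', an, an, rb_apply, rb_apply]
    rfl
  · rw [hl, hl', an, an, rb_apply, rb_apply]
    simp only [fromBlocks_apply₁₂, Matrix.smul_apply, Matrix.one_apply]
    congr 1
    refine if_congr ?_ rfl rfl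
    rw [Fin.rev_inj, eq_comm]
  · rw [hr, hr', an, an, rb_apply, rb_apply]
    rfl
  · rw [hr, hl', an, an, rb_apply, rb_apply]
    rfl

theorem su_eq_fl (M : Matrix (Fin n) (Fin n) F) : su (fl M) = su M := by
  unfold su
  rw [Finset.sum_comm, ← Equiv.sum_comp Fin.revPerm]
  refine Finset.sum_congr rfl fun i _ => ?_
  rw [← Equiv.sum_comp Fin.revPerm]
  refine Finset.sum_congr rfl fun j _ => ?_
  rw [Fin.revPerm_apply, Fin.revPerm_apply]
  refine if_congr ?_ ?_ rfl
  · rw [Fin.val_rev, Fin.val_rev]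
    omega
  · rw [show fl M j.rev i.rev = M i.rev.rev j.rev.rev from rfl, Fin.rev_rev, Fin.rev_rev]

theorem Bi_fl {ψ : AddChar F ℂ} (hψ : ψ ≠ 1) (n : ℕ) :
    ∀ φ ∈ Bi (F := F) ψ n, ∀ x, φ (fl x) = φ x := by
  induction n using Nat.strong_induction_on with
  | _ n ih =>
    intro φ hφ
    rcases Nat.eq_zero_or_pos n with rfl | hn
    · intro x
      rw [Subsingleton.elim (fl x) x]
    have hφ' : (fun x => φ (fl x)) ∈ Bi ψ n := by
      refine ⟨fun M hM => hφ.1 _ (fl_isUnit.not.2 hM), fun u v M hu hv => ?_⟩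
      show φ (fl (u * M * v)) = ψ (su u + su v) * φ (fl M)
      rw [fl_mul, fl_mul, ← Matrix.mul_assoc, hφ.2 _ _ _ hv.fl hu.fl, su_eq_fl, su_eq_fl, add_comm]
    have h0 := Bi_inj hψ hn ((Bi ψ n).sub_mem hφ' hφ) fun m k h hk c hc g => by
      rw [Pi.sub_apply, fl_an, sub_eq_zero]
      exact ih m (by omega) _ (comp_mem_Bi hφ h hc) g
    intro x
    exact sub_eq_zero.1 (congrFun h0 x)

end BimoduleDim

section Generic

variable {F : Type} [Field F] [Fintype F] {d m k n : ℕ}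

open Classical in
/-- Extension of a function on the general linear group by zero to all matrices. -/
noncomputable def zext (χ : GL (Fin n) F → ℂ) (M : Matrix (Fin n) (Fin n) F) : ℂ :=
  if h : IsUnit M then χ h.unit else 0

theorem zext_coe (χ : GL (Fin n) F → ℂ) (x : GL (Fin n) F) :
    zext χ (x : Matrix (Fin n) (Fin n) F) = χ x := by
  unfold zext
  rw [dif_pos x.isUnit]
  congr 1
  exact Units.ext rfl

theorem zext_of_not_isUnit (χ : GL (Fin n) F → ℂ) {M : Matrix (Fin n) (Fin n) F}
    (hM : ¬ IsUnit M) : zext χ M = 0 := dif_neg hM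

theorem zext_mem_Bi {ψ : AddChar F ℂ} {f : GL (Fin n) F → ℂ}
    (hf : ∀ (u v : U F n) g, f (u * g * v) = ψ (suU u + suU v) * f g) : zext f ∈ Bi ψ n := by
  refine ⟨fun M hM => zext_of_not_isUnit _ hM, fun u v M hu hv => ?_⟩
  obtain ⟨u, rfl⟩ := hu.exists_U
  obtain ⟨v, rfl⟩ := hv.exists_U
  by_cases hM : IsUnit M
  · obtain ⟨g, rfl⟩ := hM
    rw [← Units.val_mul, ← Units.val_mul, zext_coe, zext_coe, hf]
    rfl
  · rw [zext_of_not_isUnit _ hM, zext_of_not_isUnit, mul_zero]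
    rwa [Units.isUnit_mul_units, Units.isUnit_units_mul]

/-- Reflection in the antidiagonal on the general linear group. -/
def flG (g : GL (Fin n) F) : GL (Fin n) F where
  val := fl g
  inv := fl ((g⁻¹ : GL (Fin n) F) : Matrix (Fin n) (Fin n) F)
  val_inv := by
    rw [← fl_mul, Units.inv_mul]
    ext i j
    simp [fl, Matrix.one_apply, eq_comm]
  inv_val := by
    rw [← fl_mul, Units.mul_inv]
    ext i j
    simp [fl, Matrix.one_apply, eq_comm]

theorem flG_mul (g h : GL (Fin n) F) : flG (g * h) = flG h * flG g := Units.ext (fl_mul _ _)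

theorem flG_flG (g : GL (Fin n) F) : flG (flG g) = g := Units.ext (fl_fl _)

theorem flG_eq {ψ : AddChar F ℂ} (hψ : ψ ≠ 1) {f : GL (Fin n) F → ℂ}
    (hf : ∀ (u v : U F n) g, f (u * g * v) = ψ (suU u + suU v) * f g) (g : GL (Fin n) F) :
    f (flG g) = f g := by
  rw [← zext_coe f, ← zext_coe f]
  exact Bi_fl hψ n _ (zext_mem_Bi hf) g

theorem convolution_comm {ψ : AddChar F ℂ} (hψ : ψ ≠ 1) {f₁ f₂ : GL (Fin n) F → ℂ}
    (hf₁ : ∀ (u v : U F n) g, f₁ (u * g * v) = ψ (suU u + suU v) * f₁ g)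
    (hf₂ : ∀ (u v : U F n) g, f₂ (u * g * v) = ψ (suU u + suU v) * f₂ g) (x : GL (Fin n) F) :
    ∑ g, f₁ g * f₂ (g⁻¹ * x) = ∑ g, f₂ g * f₁ (g⁻¹ * x) := by
  have h1 := flG_eq hψ (f := fun x => ∑ g, f₁ g * f₂ (g⁻¹ * x)) (by
    intro u v g
    rw [Finset.mul_sum, ← Equiv.sum_comp (Equiv.mulLeft (u : GL (Fin n) F))]
    refine Finset.sum_congr rfl fun h _ => ?_
    have h2 := hf₁ u 1 h
    have h3 := hf₂ 1 v (h⁻¹ * g)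
    rw [suU_one, Subgroup.coe_one, mul_one, add_zero] at h2
    rw [suU_one, Subgroup.coe_one, one_mul, zero_add] at h3
    rw [Equiv.coe_mulLeft, h2, show ((u : GL (Fin n) F) * h)⁻¹ * (u * g * v) = h⁻¹ * g * v by
      group, h3, AddChar.map_add_eq_mul]
    ring) x
  rw [← h1, ← Equiv.sum_comp ((Equiv.inv _).trans ((Equiv.mulRight x).trans
    ⟨flG, flG, flG_flG, flG_flG⟩))]
  refine Finset.sum_congr rfl fun g _ => ?_
  simp only [Equiv.trans_apply, Equiv.inv_apply, Equiv.coe_mulRight, Equiv.coe_fn_mk]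
  have h2 : (flG (g⁻¹ * x))⁻¹ * flG x = flG g := by
    rw [inv_mul_eq_iff_eq_mul, ← flG_mul, mul_inv_cancel_left]
  rw [h2, flG_eq hψ hf₁, flG_eq hψ hf₂, mul_comm]

section

variable {V : Type} [AddCommGroup V] [Module ℂ V] [FiniteDimensional ℂ V]

/-- The projection onto the Whittaker vectors. -/
noncomputable def whProj (ψ : AddChar F ℂ) (ρ : Representation ℂ (GL (Fin n) F) V) : V →ₗ[ℂ] V :=
  (Nat.card (U F n) : ℂ)⁻¹ • ∑ u : U F n, ψ (-suU u) • ρ u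

theorem trace_whProj (ψ : AddChar F ℂ) (ρ : Representation ℂ (GL (Fin n) F) V) :
    LinearMap.trace ℂ V (whProj ψ ρ) = wh ψ (zext ρ.character) := by
  unfold whProj wh
  rw [map_smul, map_sum, smul_eq_mul]
  congr 1
  refine Finset.sum_congr rfl fun u _ => ?_
  rw [map_smul, zext_coe, smul_eq_mul, mul_comm]
  rfl

theorem apply_whProj (ψ : AddChar F ℂ) (ρ : Representation ℂ (GL (Fin n) F) V) (u : U F n) (v : V) :
    ρ u (whProj ψ ρ v) = ψ (suU u) • whProj ψ ρ v := by
  unfold whProj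
  simp only [LinearMap.smul_apply, LinearMap.sum_apply, map_smul, map_sum]
  rw [smul_comm (ψ (suU u))]
  congr 1
  rw [Finset.smul_sum]
  conv_rhs => rw [← Equiv.sum_comp (Equiv.mulLeft u)]
  refine Finset.sum_congr rfl fun w _ => ?_
  rw [Equiv.coe_mulLeft, suU_mul, smul_smul, ← AddChar.map_add_eq_mul, Subgroup.coe_mul, map_mul]
  congr 2
  ring

theorem whProj_apply (ψ : AddChar F ℂ) (ρ : Representation ℂ (GL (Fin n) F) V) (u : U F n) (v : V) :
    whProj ψ ρ (ρ u v) = ψ (suU u) • whProj ψ ρ v := by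
  unfold whProj
  simp only [LinearMap.smul_apply, LinearMap.sum_apply, map_smul, map_sum]
  rw [smul_comm (ψ (suU u))]
  congr 1
  rw [Finset.smul_sum]
  conv_rhs => rw [← Equiv.sum_comp (Equiv.mulRight u)]
  refine Finset.sum_congr rfl fun w _ => ?_
  rw [Equiv.coe_mulRight, suU_mul, smul_smul, ← AddChar.map_add_eq_mul, Subgroup.coe_mul, map_mul]
  congr 2
  ring

theorem whProj_eq {ψ : AddChar F ℂ} {ρ : Representation ℂ (GL (Fin n) F) V} {v : V}
    (hv : ∀ u : U F n, ρ u v = ψ (suU u) • v) : whProj ψ ρ v = v := by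
  unfold whProj
  simp only [LinearMap.smul_apply, LinearMap.sum_apply, hv, smul_smul, ← AddChar.map_add_eq_mul,
    neg_add_cancel, AddChar.map_zero_eq_one, one_smul]
  rw [Finset.sum_const, Finset.card_univ, ← Nat.card_eq_fintype_card, ← Nat.cast_smul_eq_nsmul ℂ,
    smul_smul, inv_mul_cancel₀ card_ne_zero, one_smul]

theorem whProj_whProj (ψ : AddChar F ℂ) (ρ : Representation ℂ (GL (Fin n) F) V) (v : V) :
    whProj ψ ρ (whProj ψ ρ v) = whProj ψ ρ v := whProj_eq fun u => apply_whProj ψ ρ u v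

theorem wh_eq_finrank (ψ : AddChar F ℂ) (ρ : Representation ℂ (GL (Fin n) F) V) :
    wh ψ (zext ρ.character) = Module.finrank ℂ (LinearMap.range (whProj ψ ρ)) := by
  rw [← trace_whProj]
  exact LinearMap.IsProj.trace ⟨fun x => ⟨x, rfl⟩, by
    rintro _ ⟨x, rfl⟩
    exact whProj_whProj ψ ρ x⟩

theorem whittaker_unique {ψ : AddChar F ℂ} (hψ : ψ ≠ 1) {ρ : Representation ℂ (GL (Fin n) F) V}
    (hρ : IsIrreducibleRep ρ) : Module.finrank ℂ (LinearMap.range (whProj ψ ρ)) ≤ 1 := by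
  by_cases h0 : whProj ψ ρ = 0
  · rw [h0, LinearMap.range_zero, finrank_bot]
    exact zero_le_one
  obtain ⟨v₀, hv₀⟩ : ∃ v₀, whProj ψ ρ v₀ ≠ 0 := by
    by_contra h
    push Not at h
    exact h0 (LinearMap.ext h)
  set v := whProj ψ ρ v₀ with hv
  obtain ⟨l₁, hl₁⟩ : ∃ l : V →ₗ[ℂ] ℂ, l v ≠ 0 := by
    by_contra h
    push Not at h
    exact hv₀ ((Module.forall_dual_apply_eq_zero_iff ℂ v).1 h)
  set l := l₁ ∘ₗ whProj ψ ρ with hl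
  have hlv : l v ≠ 0 := by
    rw [hl, LinearMap.comp_apply, hv, whProj_whProj]
    exact hl₁
  have hψ' : ψ⁻¹ ≠ 1 := inv_ne_one.2 hψ
  obtain ⟨c, hc, hav⟩ := schur_average hρ
  have hf : ∀ w, (∀ u : U F n, ρ u w = ψ (suU u) • w) → ∀ (u u' : U F n) (g : GL (Fin n) F),
      l (ρ ((u : GL (Fin n) F) * g * u')⁻¹ w) = ψ⁻¹ (suU u + suU u') * l (ρ g⁻¹ w) := by
    intro w hw u u' g
    have h1 : ρ ((u : GL (Fin n) F) * g * u')⁻¹ w =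
        ρ ((u'⁻¹ : U F n) : GL (Fin n) F) (ρ g⁻¹ (ρ ((u⁻¹ : U F n) : GL (Fin n) F) w)) := by
      rw [← Module.End.mul_apply, ← Module.End.mul_apply, ← map_mul, ← map_mul, Subgroup.coe_inv,
        Subgroup.coe_inv]
      congr 2
      group
    rw [h1, hw, map_smul, map_smul, hl, map_smul, LinearMap.comp_apply, whProj_apply, suU_inv,
      suU_inv, AddChar.inv_apply, neg_add, AddChar.map_add_eq_mul, map_smul, smul_eq_mul,
      smul_eq_mul, LinearMap.comp_apply]
    ring
  have hcv : ∀ w₁ w₂ x, (c * l x) • (c * l w₂) • w₁ =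
      ∑ y, (∑ g, l (ρ g⁻¹ w₁) * l (ρ (g⁻¹ * y)⁻¹ w₂)) • ρ y x := by
    intro w₁ w₂ x
    rw [← hav l w₂ w₁, Finset.smul_sum]
    simp only [Finset.sum_smul]
    rw [Finset.sum_comm]
    refine Finset.sum_congr rfl fun g _ => ?_
    rw [smul_comm, ← map_smul, ← hav l x w₂, map_sum, Finset.smul_sum]
    conv_rhs => rw [← Equiv.sum_comp (Equiv.mulLeft g)]
    refine Finset.sum_congr rfl fun y _ => ?_
    rw [Equiv.coe_mulLeft, inv_mul_cancel_left, map_smul, smul_smul, map_mul,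
      Module.End.mul_apply]
  refine finrank_le_one ⟨v, v₀, rfl⟩ ?_
  rintro ⟨w, w₀, rfl⟩
  have h1 := hcv v (whProj ψ ρ w₀) v
  have h2 := hcv (whProj ψ ρ w₀) v v
  have h4 := convolution_comm (f₁ := fun g => l (ρ g⁻¹ v))
    (f₂ := fun g => l (ρ g⁻¹ (whProj ψ ρ w₀))) hψ' (hf v (fun u => apply_whProj ψ ρ u v₀))
    (hf (whProj ψ ρ w₀) (fun u => apply_whProj ψ ρ u w₀))
  rw [Finset.sum_congr rfl fun y _ => congrArg (· • ρ y v) (h4 y)] at h1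
  rw [← h2, smul_smul, smul_smul] at h1
  refine ⟨(l v)⁻¹ * l (whProj ψ ρ w₀), Subtype.ext ?_⟩
  have h3 := congrArg (fun z => ((c * l v) * (c * l v))⁻¹ • z) h1
  simp only [smul_smul] at h3
  rw [inv_mul_cancel₀ (by simp [hc, hlv]), one_smul] at h3
  show ((l v)⁻¹ * l (whProj ψ ρ w₀)) • v = whProj ψ ρ w₀
  refine Eq.trans ?_ h3
  congr 1
  field_simp

theorem wh_nat (ψ : AddChar F ℂ) {χ : GL (Fin n) F → ℂ} (hχ : χ ∈ RepChar (GL (Fin n) F)) :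
    ∃ N : ℕ, wh ψ (zext χ) = N := by
  obtain ⟨V, _, _, _, ρ, rfl⟩ := hχ
  exact ⟨_, wh_eq_finrank ψ ρ⟩

theorem wh_irr {ψ : AddChar F ℂ} (hψ : ψ ≠ 1) {χ : GL (Fin n) F → ℂ}
    (hχ : χ ∈ Irr (GL (Fin n) F)) : wh ψ (zext χ) = 0 ∨ wh ψ (zext χ) = 1 := by
  obtain ⟨V, _, _, _, ρ, hρ, rfl⟩ := hχ
  rw [wh_eq_finrank]
  have := whittaker_unique hψ hρ
  interval_cases Module.finrank ℂ (LinearMap.range (whProj ψ ρ)) <;> simp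

end

/-- The characters of the generic irreducible representations. -/
def Gen (ψ : AddChar F ℂ) (n : ℕ) : Set (GL (Fin n) F → ℂ) :=
  {χ | χ ∈ Irr (GL (Fin n) F) ∧ wh ψ (zext χ) ≠ 0}

theorem wh_eq_one {ψ : AddChar F ℂ} (hψ : ψ ≠ 1) {χ : GL (Fin n) F → ℂ}
    (hχ : χ ∈ Gen ψ n) : wh ψ (zext χ) = 1 := (wh_irr hψ hχ.1).resolve_left hχ.2

open Classical in
/-- The projection onto the bi-Whittaker functions. -/
noncomputable def biProj (ψ : AddChar F ℂ) (n : ℕ) :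
    (Matrix (Fin n) (Fin n) F → ℂ) →ₗ[ℂ] (Matrix (Fin n) (Fin n) F → ℂ) where
  toFun φ M := if IsUnit M then (Nat.card (U F n) : ℂ)⁻¹ * ((Nat.card (U F n) : ℂ)⁻¹ *
    ∑ u : U F n, ∑ v : U F n, ψ (-suU u - suU v) *
      φ (((u : GL (Fin n) F) : Matrix (Fin n) (Fin n) F) * M *
        ((v : GL (Fin n) F) : Matrix (Fin n) (Fin n) F))) else 0
  map_add' φ φ' := by
    funext M
    rw [Pi.add_apply]
    split_ifs
    · simp only [Pi.add_apply, mul_add, Finset.sum_add_distrib]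
    · rw [add_zero]
  map_smul' c φ := by
    funext M
    rw [Pi.smul_apply]
    split_ifs
    · simp only [Pi.smul_apply, smul_eq_mul, RingHom.id_apply, mul_left_comm _ c, ← Finset.mul_sum]
    · rw [smul_zero]

theorem biProj_isProj (ψ : AddChar F ℂ) (n : ℕ) :
    LinearMap.IsProj (Bi (F := F) ψ n) (biProj ψ n) := by
  classical
  refine ⟨fun φ => ⟨fun M hM => if_neg hM, fun u₀ v₀ M hu hv => ?_⟩, fun φ hφ => ?_⟩
  · obtain ⟨u₀, rfl⟩ := hu.exists_U
    obtain ⟨v₀, rfl⟩ := hv.exists_U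
    by_cases hM : IsUnit M
    · rw [biProj, LinearMap.coe_mk, AddHom.coe_mk, if_pos hM, if_pos (by
        rwa [Units.isUnit_mul_units, Units.isUnit_units_mul]), mul_left_comm (ψ _),
        mul_left_comm (ψ _)]
      congr 2
      rw [Finset.mul_sum, ← Equiv.sum_comp (Equiv.mulRight u₀)
        (fun u => ψ (su ((u₀ : GL (Fin n) F) : Matrix (Fin n) (Fin n) F) +
          su ((v₀ : GL (Fin n) F) : Matrix (Fin n) (Fin n) F)) * _)]
      refine Finset.sum_congr rfl fun u _ => ?_
      rw [Finset.mul_sum]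
      conv_rhs => rw [← Equiv.sum_comp (Equiv.mulLeft v₀)]
      refine Finset.sum_congr rfl fun v _ => ?_
      rw [← mul_assoc (ψ (su _ + su _)), ← AddChar.map_add_eq_mul, Equiv.coe_mulLeft,
        Equiv.coe_mulRight, suU_mul, suU_mul]
      congr 1
      · congr 1
        unfold suU
        ring
      · rw [Subgroup.coe_mul, Subgroup.coe_mul, Units.val_mul, Units.val_mul]
        simp only [Matrix.mul_assoc]
    · rw [biProj, LinearMap.coe_mk, AddHom.coe_mk, if_neg hM, if_neg (by
        rwa [Units.isUnit_mul_units, Units.isUnit_units_mul]), mul_zero]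
  · funext M
    by_cases hM : IsUnit M
    · rw [biProj, LinearMap.coe_mk, AddHom.coe_mk, if_pos hM]
      have : ∀ u v : U F n, ψ (-suU u - suU v) *
          φ (((u : GL (Fin n) F) : Matrix (Fin n) (Fin n) F) * M *
            ((v : GL (Fin n) F) : Matrix (Fin n) (Fin n) F)) = φ M := by
        intro u v
        rw [hφ.2 _ _ _ (U_uni u) (U_uni v), ← mul_assoc, ← AddChar.map_add_eq_mul]
        unfold suU
        rw [show ∀ a b : F, -a - b + (a + b) = 0 by intros; ring, AddChar.map_zero_eq_one, one_mul]
      simp only [this, Finset.sum_const, Finset.card_univ, ← Nat.card_eq_fintype_card, nsmul_eq_mul]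
      rw [inv_mul_cancel_left₀ card_ne_zero, inv_mul_cancel_left₀ card_ne_zero]
    · rw [biProj, LinearMap.coe_mk, AddHom.coe_mk, if_neg hM, hφ.1 M hM]

theorem trace_fun {ι : Type} [Fintype ι] [DecidableEq ι] (T : (ι → ℂ) →ₗ[ℂ] (ι → ℂ)) :
    LinearMap.trace ℂ (ι → ℂ) T = ∑ i, T (Pi.single i 1) i := by
  rw [LinearMap.trace_eq_matrix_trace ℂ (Pi.basisFun ℂ ι), Matrix.trace]
  refine Finset.sum_congr rfl fun i _ => ?_
  rw [Matrix.diag_apply, LinearMap.toMatrix_apply, Pi.basisFun_apply, Pi.basisFun_repr]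

theorem sum_wh_sq (ψ : AddChar F ℂ) (n : ℕ) :
    ∑ χ : Irr (GL (Fin n) F), wh ψ (zext (χ : GL (Fin n) F → ℂ)) ^ 2 =
      Module.finrank ℂ (Bi (F := F) ψ n) := by
  classical
  rw [← (biProj_isProj ψ n).trace, trace_fun]
  have h1 : ∀ M : Matrix (Fin n) (Fin n) F, ¬ IsUnit M → biProj ψ n (Pi.single M 1) M = 0 :=
    fun M hM => if_neg hM
  rw [sum_units _ h1]
  have h2 : ∀ x : GL (Fin n) F, biProj ψ n (Pi.single (x : Matrix (Fin n) (Fin n) F) 1) x =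
      (Nat.card (U F n) : ℂ)⁻¹ * ((Nat.card (U F n) : ℂ)⁻¹ *
        ∑ u : U F n, ∑ v : U F n, ψ (-suU u - suU v) *
          if x * (v : GL (Fin n) F) * x⁻¹ = (u : GL (Fin n) F)⁻¹ then 1 else 0) := by
    intro x
    rw [biProj, LinearMap.coe_mk, AddHom.coe_mk, if_pos x.isUnit]
    congr 2
    refine Finset.sum_congr rfl fun u _ => Finset.sum_congr rfl fun v _ => ?_
    rw [Pi.single_apply]
    congr 1
    refine if_congr ?_ rfl rfl
    rw [← Units.val_mul, ← Units.val_mul, Units.val_inj, mul_inv_eq_iff_eq_mul,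
      eq_inv_mul_iff_mul_eq, mul_assoc]
  simp only [h2]
  rw [← Finset.mul_sum, ← Finset.mul_sum, Finset.sum_comm]
  have h3 : ∀ χ : Irr (GL (Fin n) F), wh ψ (zext (χ : GL (Fin n) F → ℂ)) ^ 2 =
      (Nat.card (U F n) : ℂ)⁻¹ * ((Nat.card (U F n) : ℂ)⁻¹ *
        ∑ u : U F n, ∑ v : U F n, ψ (-suU u - suU v) *
          ((χ : GL (Fin n) F → ℂ) v * (χ : GL (Fin n) F → ℂ) u)) := by
    intro χ
    unfold wh
    rw [pow_two, mul_mul_mul_comm, mul_assoc, Finset.sum_mul_sum]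
    congr 2
    refine Finset.sum_congr rfl fun u _ => Finset.sum_congr rfl fun v _ => ?_
    rw [zext_coe, zext_coe, sub_eq_add_neg, AddChar.map_add_eq_mul]
    ring
  simp only [h3]
  rw [← Finset.mul_sum, ← Finset.mul_sum, Finset.sum_comm]
  congr 2
  refine Finset.sum_congr rfl fun u _ => ?_
  rw [Finset.sum_comm]
  conv_rhs => rw [Finset.sum_comm]
  refine Finset.sum_congr rfl fun v _ => ?_
  rw [← Finset.mul_sum, ← Finset.mul_sum, second_orthogonality, Finset.sum_boole]

theorem card_Gen {ψ : AddChar F ℂ} (hψ : ψ ≠ 1) (n : ℕ) :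
    Nat.card (Gen (F := F) ψ n) = Module.finrank ℂ (Bi (F := F) ψ n) := by
  classical
  have h : (Nat.card (Gen (F := F) ψ n) : ℂ) = Module.finrank ℂ (Bi (F := F) ψ n) := by
    rw [← sum_wh_sq]
    have h1 : ∀ χ : Irr (GL (Fin n) F), wh ψ (zext (χ : GL (Fin n) F → ℂ)) ^ 2 =
        if wh ψ (zext (χ : GL (Fin n) F → ℂ)) ≠ 0 then 1 else 0 := by
      intro χ
      rcases wh_irr hψ χ.2 with h | h <;> simp [h]
    rw [Finset.sum_congr rfl fun χ _ => h1 χ, Finset.sum_boole, Nat.cast_inj,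
      ← Fintype.card_subtype, ← Nat.card_eq_fintype_card]
    exact Nat.card_congr (Equiv.subtypeSubtypeEquivSubtypeInter _ _).symm
  exact_mod_cast h

end Generic

section Zext

variable {F : Type} [Field F] [Fintype F] {d m k n : ℕ}

theorem zext_isCl {χ : GL (Fin n) F → ℂ} (h : ∀ x y, χ (x * y * x⁻¹) = χ y) : IsCl (zext χ) := by
  refine ⟨fun M hM => zext_of_not_isUnit _ hM, fun x M => ?_⟩
  by_cases hM : IsUnit M
  · obtain ⟨g, rfl⟩ := hM
    rw [← Units.val_mul, ← Units.val_mul, zext_coe, zext_coe, h]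
  · rw [zext_of_not_isUnit _ hM, zext_of_not_isUnit]
    rwa [Units.isUnit_mul_units, Units.isUnit_units_mul]

theorem zext_comp_coe {f : Matrix (Fin n) (Fin n) F → ℂ} (hf : IsCl f) :
    zext (fun x : GL (Fin n) F => f x) = f := by
  funext M
  by_cases hM : IsUnit M
  · obtain ⟨g, rfl⟩ := hM
    rw [zext_coe]
  · rw [zext_of_not_isUnit _ hM, hf.supp _ hM]

theorem IsCl.class {f : Matrix (Fin n) (Fin n) F → ℂ} (hf : IsCl f) (x y : GL (Fin n) F) :
    f (x * y * x⁻¹ : GL (Fin n) F) = f y := hf.conj x y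

theorem bf_eq_cip {f g : Matrix (Fin n) (Fin n) F → ℂ} (hf : IsCl f) :
    bf f g = cip (fun x : GL (Fin n) F => f x) (fun x => g x) := by
  unfold bf pr cip
  rw [sum_units _ fun M hM => by rw [hf.supp M hM, zero_mul]]
  simp only [st_coe]
  rfl

theorem bf_zext {χ χ' : GL (Fin n) F → ℂ} (h : ∀ x y, χ (x * y * x⁻¹) = χ y) :
    bf (zext χ) (zext χ') = cip χ χ' := by
  rw [bf_eq_cip (zext_isCl h)]
  simp only [zext_coe]

theorem wh_sum (ψ : AddChar F ℂ) {ι : Type} (s : Finset ι) (c : ι → ℂ)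
    (f : ι → Matrix (Fin n) (Fin n) F → ℂ) :
    wh ψ (∑ i ∈ s, c i • f i) = ∑ i ∈ s, c i * wh ψ (f i) := by
  unfold wh
  simp only [Finset.sum_apply, Pi.smul_apply, smul_eq_mul, Finset.sum_mul, Finset.mul_sum]
  rw [Finset.sum_comm]
  refine Finset.sum_congr rfl fun i _ => Finset.sum_congr rfl fun u _ => ?_
  ring

theorem zext_sum {ι : Type} (s : Finset ι) (c : ι → ℂ) (f : ι → GL (Fin n) F → ℂ) :
    zext (∑ i ∈ s, c i • f i) = ∑ i ∈ s, c i • zext (f i) := by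
  funext M
  by_cases hM : IsUnit M
  · obtain ⟨g, rfl⟩ := hM
    simp only [Finset.sum_apply, Pi.smul_apply, zext_coe]
  · simp only [Finset.sum_apply, Pi.smul_apply, zext_of_not_isUnit _ hM, smul_zero,
      Finset.sum_const_zero]

open scoped ComplexOrder in
theorem star_character {G V : Type} [Group G] [Finite G] [AddCommGroup V] [Module ℂ V]
    [FiniteDimensional ℂ V] (ρ : Representation ℂ G V) (g : G) :
    star (ρ.character g) = ρ.character g⁻¹ := by
  classical
  have := Fintype.ofFinite G
  let b := Module.finBasis ℂ V
  let R : G → Matrix _ _ ℂ := fun g => LinearMap.toMatrix b b (ρ g)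
  have hR : ∀ g h, R (g * h) = R g * R h := fun g h => by
    simp only [R, map_mul, LinearMap.toMatrix_mul]
  have hR1 : R 1 = 1 := by simp only [R, map_one, LinearMap.toMatrix_one]
  have hc : ∀ g, ρ.character g = (R g).trace := fun g => LinearMap.trace_eq_matrix_trace ℂ b _
  let H := ∑ g, (R g)ᴴ * R g
  have hH : IsUnit H := by
    have h1 : (∑ g ∈ Finset.univ.erase (1 : G), (R g)ᴴ * R g).PosSemidef :=
      Matrix.posSemidef_sum _ fun g _ => Matrix.posSemidef_conjTranspose_mul_self _
    have h2 : H.PosDef := by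
      have h3 : H = 1 + ∑ g ∈ Finset.univ.erase (1 : G), (R g)ᴴ * R g := by
        simp only [H]
        rw [← Finset.add_sum_erase _ _ (Finset.mem_univ (1 : G)), hR1, conjTranspose_one, one_mul]
      rw [h3]
      exact Matrix.PosDef.one.add_posSemidef h1
    exact h2.isUnit
  have h1 : (R g)ᴴ * H * R g = H := by
    simp only [H, Finset.mul_sum, Finset.sum_mul]
    conv_rhs => rw [← Equiv.sum_comp (Equiv.mulRight g)]
    refine Finset.sum_congr rfl fun x _ => ?_
    rw [Equiv.coe_mulRight, hR, conjTranspose_mul]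
    simp only [Matrix.mul_assoc]
  have h2 : (R g)ᴴ = H * R g⁻¹ * H⁻¹ := by
    have h3 : R g * R g⁻¹ = 1 := by rw [← hR, mul_inv_cancel, hR1]
    have h4 := Matrix.mul_nonsing_inv H ((Matrix.isUnit_iff_isUnit_det H).1 hH)
    calc (R g)ᴴ = (R g)ᴴ * (H * (R g * R g⁻¹) * H⁻¹) := by rw [h3, mul_one, h4, mul_one]
      _ = ((R g)ᴴ * H * R g) * R g⁻¹ * H⁻¹ := by simp only [Matrix.mul_assoc]
      _ = _ := by rw [h1]
  rw [hc, hc, ← Matrix.trace_conjTranspose, h2, Matrix.trace_mul_cycle,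
    Matrix.nonsing_inv_mul H ((Matrix.isUnit_iff_isUnit_det H).1 hH), one_mul]

theorem herm_zext {V : Type} [AddCommGroup V] [Module ℂ V] [FiniteDimensional ℂ V]
    (ρ : Representation ℂ (GL (Fin n) F) V) : Herm (zext ρ.character) := by
  intro M
  by_cases hM : IsUnit M
  · obtain ⟨g, rfl⟩ := hM
    rw [st_coe, zext_coe, zext_coe, star_character]
  · rw [(st_isCl (zext_isCl (fun x y => Representation.char_conj ρ y x))).supp _ hM,
      zext_of_not_isUnit _ hM, star_zero]

end Zext

section Cuspidal

variable {F : Type} [Field F] [Fintype F] {d m k n : ℕ}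

theorem CuspFn.st_of_herm {f : Matrix (Fin n) (Fin n) F → ℂ} (h : CuspFn f) (hf : Herm f) :
    CuspFn (st f) := by
  intro S h0 h1
  obtain ⟨s, hs, hs1, hs2⟩ := h S h0 h1
  refine ⟨s, hs, hs1, fun M => ?_⟩
  simp only [hf _]
  rw [← star_sum, hs2, star_zero]

/-- Functions supported on the first coordinates. -/
def firstCoords (F : Type) [Field F] (r n : ℕ) : (Fin r → F) →ₗ[F] (Fin n → F) where
  toFun x i := if h : (i : ℕ) < r then x ⟨i, h⟩ else 0
  map_add' x y := by ext i; by_cases h : (i : ℕ) < r <;> simp [h]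
  map_smul' c x := by ext i; by_cases h : (i : ℕ) < r <;> simp [h]

theorem firstCoords_injective {r : ℕ} (hr : r ≤ n) :
    Function.Injective (firstCoords F r n) := by
  intro x y h
  ext i
  have := congrFun h ⟨i, by omega⟩
  simpa [firstCoords] using this

theorem exists_firstCoords {r : ℕ} (hr : r ≤ n) (v : Fin n → F)
    (hv : ∀ i : Fin n, r ≤ (i : ℕ) → v i = 0) : ∃ x, firstCoords F r n x = v := by
  refine ⟨fun i => v ⟨i, by omega⟩, ?_⟩
  ext i
  by_cases h : (i : ℕ) < r
  · simp [firstCoords, h]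
  · simp [firstCoords, h, hv i (by omega)]

theorem exists_map_firstCoords (S : Submodule F (Fin n → F)) :
    ∃ q : GL (Fin n) F, ∀ v, v ∈ S ↔
      ∃ x, (q : Matrix (Fin n) (Fin n) F) *ᵥ firstCoords F (Module.finrank F S) n x = v := by
  have hr : Module.finrank F S ≤ n := by simpa using Submodule.finrank_le S
  let b := (Module.finBasis F S).equivFun
  obtain ⟨q, hq⟩ := exists_GL_map (firstCoords F (Module.finrank F S) n)
    (S.subtype ∘ₗ b.symm.toLinearMap) (firstCoords_injective hr)
    (S.injective_subtype.comp b.symm.injective)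
  refine ⟨q, fun v => ⟨fun hv => ⟨b ⟨v, hv⟩, ?_⟩, ?_⟩⟩
  · rw [hq]
    simp
  · rintro ⟨x, rfl⟩
    rw [hq]
    exact (b.symm x).2

theorem cuspFn_zext {V : Type} [AddCommGroup V] [Module ℂ V] [FiniteDimensional ℂ V]
    {ρ : Representation ℂ (GL (Fin n) F) V} (hρ : IsCuspidal ρ) : CuspFn (zext ρ.character) := by
  classical
  intro S h0 h1
  let s : Finset (Matrix (Fin n) (Fin n) F) :=
    Finset.univ.filter fun Q => (∀ v ∈ S, Q *ᵥ v = 0) ∧ ∀ v, Q *ᵥ v ∈ S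
  have hs : ∀ Q, Q ∈ s ↔ (∀ v ∈ S, Q *ᵥ v = 0) ∧ ∀ v, Q *ᵥ v ∈ S := fun Q => by simp [s]
  have hmul : ∀ Q ∈ s, ∀ Q' ∈ s, Q * Q' = 0 := by
    intro Q hQ Q' hQ'
    apply Matrix.toLin'.injective
    refine LinearMap.ext fun v => ?_
    rw [Matrix.toLin'_mul, LinearMap.comp_apply, Matrix.toLin'_apply, Matrix.toLin'_apply,
      ((hs Q).1 hQ).1 _ (((hs Q').1 hQ').2 _), map_zero, LinearMap.zero_apply]
  have hadd : ∀ Q ∈ s, ∀ Q' ∈ s, Q + Q' ∈ s := by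
    intro Q hQ Q' hQ'
    rw [hs] at *
    refine ⟨fun v hv => ?_, fun v => ?_⟩
    · rw [Matrix.add_mulVec, hQ.1 v hv, hQ'.1 v hv, add_zero]
    · rw [Matrix.add_mulVec]
      exact S.add_mem (hQ.2 v) (hQ'.2 v)
  have hneg : ∀ Q ∈ s, -Q ∈ s := by
    intro Q hQ
    rw [hs] at *
    refine ⟨fun v hv => ?_, fun v => ?_⟩
    · rw [Matrix.neg_mulVec, hQ.1 v hv, neg_zero]
    · rw [Matrix.neg_mulVec]
      exact S.neg_mem (hQ.2 v)
  have hU : ∀ Q ∈ s, IsUnit (1 + Q) := by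
    intro Q hQ
    rw [Matrix.isUnit_iff_isUnit_det]
    apply Matrix.isUnit_det_of_right_inverse (B := 1 - Q)
    rw [add_mul, mul_sub, mul_sub, hmul Q hQ Q hQ]
    simp
  let u : Matrix (Fin n) (Fin n) F → GL (Fin n) F := fun Q =>
    if h : IsUnit (1 + Q) then h.unit else 1
  have hu : ∀ Q ∈ s, ((u Q : GL (Fin n) F) : Matrix (Fin n) (Fin n) F) = 1 + Q := by
    intro Q hQ
    simp only [u, dif_pos (hU Q hQ), IsUnit.unit_spec]
  have hum : ∀ Q ∈ s, ∀ Q' ∈ s, u Q * u Q' = u (Q + Q') := by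
    intro Q hQ Q' hQ'
    apply Units.ext
    rw [Units.val_mul, hu Q hQ, hu Q' hQ', hu _ (hadd Q hQ Q' hQ'), add_mul, mul_add, mul_add,
      hmul Q hQ Q' hQ']
    simp only [mul_one, one_mul, add_zero]
    abel
  have hP : ∑ Q ∈ s, ρ (u Q) = 0 := by
    refine LinearMap.ext fun v => ?_
    set w := (∑ Q ∈ s, ρ (u Q)) v with hw
    have hfix : ∀ Q ∈ s, ρ (u Q) w = w := by
      intro Q hQ
      rw [hw, ← Module.End.mul_apply, Finset.mul_sum]
      congr 1
      refine Finset.sum_bij' (fun Q' _ => Q + Q') (fun Q' _ => -Q + Q') ?_ ?_ ?_ ?_ ?_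
      · exact fun Q' hQ' => hadd Q hQ Q' hQ'
      · exact fun Q' hQ' => hadd _ (hneg Q hQ) Q' hQ'
      · intro Q' _; abel
      · intro Q' _; abel
      · intro Q' hQ'
        rw [← map_mul, hum Q hQ Q' hQ']
    obtain ⟨q, hq⟩ := exists_map_firstCoords S
    have hr0 : 0 < Module.finrank F S := by
      rw [Nat.pos_iff_ne_zero]
      exact fun h => h0 (Submodule.finrank_eq_zero.1 h)
    have hr1 : Module.finrank F S < n := by
      simpa using Submodule.finrank_lt h1
    have hz : ρ q⁻¹ w = 0 := by
      refine hρ.2 _ hr0 hr1 _ fun x hx => ?_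
      let N : Matrix (Fin n) (Fin n) F := (x : Matrix (Fin n) (Fin n) F) - 1
      have hN : ∀ i j : Fin n, ¬ ((i : ℕ) < Module.finrank F S ∧ Module.finrank F S ≤ (j : ℕ)) →
          N i j = 0 := by
        intro i j hij
        by_cases h : i = j
        · subst h
          simp [N, hx.1 i]
        · simp [N, hx.2 i j h hij, h]
      let Q : Matrix (Fin n) (Fin n) F := (q : Matrix (Fin n) (Fin n) F) * N *
        ((q⁻¹ : GL (Fin n) F) : Matrix (Fin n) (Fin n) F)
      have hQ : Q ∈ s := by
        rw [hs]
        constructor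
        · intro v hv
          obtain ⟨y, rfl⟩ := (hq v).1 hv
          simp only [Q]
          rw [← Matrix.mulVec_mulVec, Matrix.mulVec_mulVec _ (((q⁻¹ : GL (Fin n) F)) : Matrix (Fin n) (Fin n) F), Units.inv_mul,
            Matrix.one_mulVec, ← Matrix.mulVec_mulVec]
          have : N *ᵥ firstCoords F (Module.finrank F S) n y = 0 := by
            ext i
            simp only [Matrix.mulVec, dotProduct, Pi.zero_apply]
            refine Finset.sum_eq_zero fun j _ => ?_
            by_cases h : (j : ℕ) < Module.finrank F S
            · rw [hN i j (by omega), zero_mul]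
            · simp [firstCoords, h]
          rw [this, Matrix.mulVec_zero]
        · intro v
          rw [hq]
          simp only [Q, Matrix.mul_assoc]
          rw [← Matrix.mulVec_mulVec]
          obtain ⟨y, hy⟩ := exists_firstCoords hr1.le
            ((N * ((q⁻¹ : GL (Fin n) F) : Matrix (Fin n) (Fin n) F)) *ᵥ v) (by
              intro i hi
              rw [← Matrix.mulVec_mulVec]
              simp only [Matrix.mulVec, dotProduct]
              refine Finset.sum_eq_zero fun j _ => ?_
              rw [hN i j (by omega), zero_mul])
          exact ⟨y, by rw [hy]⟩
      have hxq : x * q⁻¹ = q⁻¹ * u Q := by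
        rw [eq_inv_mul_iff_mul_eq]
        apply Units.ext
        rw [hu Q hQ]
        simp only [Q, N, Units.val_mul, mul_sub, sub_mul, mul_one, one_mul, Units.mul_inv,
          Matrix.mul_assoc]
        abel
      rw [← Module.End.mul_apply, ← map_mul, hxq, map_mul, Module.End.mul_apply, hfix Q hQ]
    have := congrArg (ρ q) hz
    rwa [map_zero, ← Module.End.mul_apply, ← map_mul, mul_inv_cancel, map_one] at this
  refine ⟨s, ⟨0, by simp [hs]⟩, fun Q hQ => (hs Q).1 hQ, fun M => ?_⟩
  by_cases hM : IsUnit M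
  · obtain ⟨g, rfl⟩ := hM
    have : ∀ Q ∈ s, zext ρ.character ((g : Matrix (Fin n) (Fin n) F) * (1 + Q)) =
        LinearMap.trace ℂ V (ρ g * ρ (u Q)) := by
      intro Q hQ
      rw [← hu Q hQ, ← Units.val_mul, zext_coe, ← map_mul]
      rfl
    rw [Finset.sum_congr rfl this, ← map_sum, ← Finset.mul_sum, hP, mul_zero, map_zero]
  · refine Finset.sum_eq_zero fun Q hQ => zext_of_not_isUnit _ ?_
    rwa [← hu Q hQ, Units.isUnit_mul_units]

theorem cu_zext {V : Type} [AddCommGroup V] [Module ℂ V] [FiniteDimensional ℂ V]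
    {ρ : Representation ℂ (GL (Fin n) F) V} (hn : 0 < n) (hρ : IsCuspidal ρ) :
    Cu (zext ρ.character) where
  pos := hn
  isCl := zext_isCl fun x y => Representation.char_conj ρ y x
  cusp := cuspFn_zext hρ
  st_cusp := (cuspFn_zext hρ).st_of_herm (herm_zext ρ)
  herm := herm_zext ρ

end Cuspidal

section Kirillov

variable {F : Type} [Field F] [Fintype F] {n : ℕ}

theorem firstCoords_lt {r : ℕ} (x : Fin r → F) (i : Fin n) (h : (i : ℕ) < r) :
    firstCoords F r n x i = x ⟨i, h⟩ := dif_pos h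

theorem firstCoords_ge {r : ℕ} (x : Fin r → F) (i : Fin n) (h : r ≤ (i : ℕ)) :
    firstCoords F r n x i = 0 := dif_neg (by omega)

/-- The first columns are those of the identity matrix. -/
def ColOne (j : ℕ) (M : Matrix (Fin n) (Fin n) F) : Prop :=
  ∀ a b : Fin n, (b : ℕ) < j → M a b = (1 : Matrix (Fin n) (Fin n) F) a b

theorem ColOne.mulVec {j : ℕ} {M : Matrix (Fin n) (Fin n) F} (h : ColOne j M) (y : Fin j → F) :
    M *ᵥ firstCoords F j n y = firstCoords F j n y := by
  have h1 : M *ᵥ firstCoords F j n y = (1 : Matrix (Fin n) (Fin n) F) *ᵥ firstCoords F j n y := by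
    ext a
    simp only [Matrix.mulVec, dotProduct]
    refine Finset.sum_congr rfl fun b _ => ?_
    by_cases hb : (b : ℕ) < j
    · rw [h a b hb]
    · simp [firstCoords, hb]
  rw [h1, Matrix.one_mulVec]

theorem ColOne.mul_left {j : ℕ} {M w : Matrix (Fin n) (Fin n) F} (h : ColOne j M) (hw : Uni w)
    (a b : Fin n) (hb : (b : ℕ) < j) : (M * w) a b = w a b := by
  have h1 : (M * w) a b = ((1 : Matrix (Fin n) (Fin n) F) * w) a b := by
    simp only [Matrix.mul_apply]
    refine Finset.sum_congr rfl fun k _ => ?_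
    by_cases hk : (k : ℕ) < j
    · rw [h a k hk]
    · rw [hw.lower (Fin.lt_def.2 (by omega)), mul_zero, mul_zero]
  rw [h1, one_mul]

theorem ColOne.conj {j : ℕ} {x w : GL (Fin n) F} (h : ColOne j (x : Matrix (Fin n) (Fin n) F))
    (hw : Uni (w : Matrix (Fin n) (Fin n) F)) :
    ColOne j ((w⁻¹ * x * w : GL (Fin n) F) : Matrix (Fin n) (Fin n) F) := by
  intro a b hb
  rw [mul_assoc, Units.val_mul, ← Units.inv_mul w]
  simp only [Matrix.mul_apply]
  refine Finset.sum_congr rfl fun k _ => ?_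
  congr 1
  rw [Units.val_mul]
  exact h.mul_left hw k b hb

/-- The unitriangular matrix whose column `J` has the given entries above the diagonal. -/
def colMat (J : Fin n) (y : Fin (J : ℕ) → F) : Matrix (Fin n) (Fin n) F :=
  1 + vecMulVec (firstCoords F J n y) (Pi.single J 1)

theorem colMat_uni (J : Fin n) (y : Fin (J : ℕ) → F) : Uni (colMat J y) := by
  refine uni_one_add _ _ fun a b hab => ?_
  by_cases hb : b = J
  · subst hb
    rw [firstCoords_ge _ _ (Fin.le_def.1 hab), zero_mul]
  · simp [hb]

theorem ColOne.mul_colMat {J : Fin n} {M : Matrix (Fin n) (Fin n) F} (h : ColOne J M)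
    (y : Fin (J : ℕ) → F) :
    M * colMat J y = M + vecMulVec (firstCoords F J n y) (Pi.single J 1) := by
  rw [colMat, mul_add, mul_one, Matrix.mul_vecMulVec, h.mulVec]

theorem colMat_colOne (J : Fin n) (y : Fin (J : ℕ) → F) : ColOne J (colMat J y) := by
  intro a b hb
  have : b ≠ J := by rintro rfl; omega
  simp [colMat, vecMulVec_apply, this]

theorem colMat_mul (J : Fin n) (y z : Fin (J : ℕ) → F) :
    colMat J y * colMat J z = colMat J (y + z) := by
  rw [(colMat_colOne J y).mul_colMat, colMat, colMat, map_add, add_assoc, Matrix.add_vecMulVec]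

theorem colMat_zero (J : Fin n) : colMat (F := F) J 0 = 1 := by
  rw [colMat, map_zero, Matrix.zero_vecMulVec, add_zero]

theorem su_colMat (J : Fin n) (i : Fin (J : ℕ)) (hi : (i : ℕ) + 1 = J) (y : Fin (J : ℕ) → F) :
    su (colMat J y) = y i := by
  rw [colMat, su_one_add _ _ ⟨i, by omega⟩ J (by simpa using hi)]
  · rw [firstCoords_lt _ (⟨i, by omega⟩ : Fin n) i.2]
    simp
  · intro a ha
    rw [Fin.lt_def] at ha
    simp only at ha
    exact firstCoords_ge _ _ (by omega)
  · intro b hb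
    rw [Fin.le_def] at hb
    simp only at hb
    have : b ≠ J := by rintro rfl; omega
    simp [this]

/-- `colMat` as an invertible matrix. -/
noncomputable def colGL (J : Fin n) (y : Fin (J : ℕ) → F) : GL (Fin n) F :=
  (colMat_uni J y).isUnit.unit

theorem coe_colGL (J : Fin n) (y : Fin (J : ℕ) → F) :
    ((colGL J y : GL (Fin n) F) : Matrix (Fin n) (Fin n) F) = colMat J y := IsUnit.unit_spec _

theorem colGL_mul (J : Fin n) (y z : Fin (J : ℕ) → F) :
    colGL J y * colGL J z = colGL J (y + z) := by
  apply Units.ext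
  rw [Units.val_mul, coe_colGL, coe_colGL, coe_colGL, colMat_mul]

theorem colGL_zero (J : Fin n) : colGL (F := F) J 0 = 1 := by
  apply Units.ext
  rw [coe_colGL, colMat_zero, Units.val_one]

theorem exists_colGL {J : Fin n} {x : GL (Fin n) F} (hx : Uni (x : Matrix (Fin n) (Fin n) F))
    (h : ColOne J (x : Matrix (Fin n) (Fin n) F)) : ∃ (z : GL (Fin n) F) (y : Fin (J : ℕ) → F),
      x = z * colGL J y ∧ Uni (z : Matrix (Fin n) (Fin n) F) ∧
      ColOne (J + 1) (z : Matrix (Fin n) (Fin n) F) := by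
  let y : Fin (J : ℕ) → F := fun i =>
    (x : Matrix (Fin n) (Fin n) F) ⟨i, i.2.trans J.2⟩ J
  refine ⟨x * colGL J (-y), y, ?_, ?_, ?_⟩
  · rw [mul_assoc, colGL_mul, neg_add_cancel, colGL_zero, mul_one]
  · rw [Units.val_mul, coe_colGL]
    exact hx.mul (colMat_uni _ _)
  · intro a b hb
    rw [Units.val_mul, coe_colGL, h.mul_colMat, Matrix.add_apply, vecMulVec_apply]
    by_cases hbJ : b = J
    · subst hbJ
      by_cases ha : (a : ℕ) < b
      · have : a ≠ b := by rintro rfl; omega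
        rw [firstCoords_lt _ _ ha, Matrix.one_apply_ne this]
        simp [y]
      · rw [hx a b (Fin.le_def.2 (by omega))]
        rw [firstCoords_ge _ _ (by omega), zero_mul, add_zero]
    · have : (b : ℕ) ≠ J := fun h => hbJ (Fin.ext h)
      rw [h a b (by omega)]
      simp [hbJ]

/-- The block diagonal matrix acting on the first coordinates. -/
def dg (J : Fin n) (A : Matrix (Fin (J : ℕ)) (Fin (J : ℕ)) F) : Matrix (Fin n) (Fin n) F :=
  blk (B := Fin (n - J)) (finSumFinEquiv.trans (finCongr (by omega))) A 0 0 1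

theorem dg_mul (J : Fin n) (A B : Matrix (Fin (J : ℕ)) (Fin (J : ℕ)) F) :
    dg J A * dg J B = dg J (A * B) := by
  unfold dg
  rw [blk_mul]
  simp

theorem dg_one (J : Fin n) : dg (F := F) J 1 = 1 := blk_one _

theorem dg_row (J : Fin n) (A : Matrix (Fin (J : ℕ)) (Fin (J : ℕ)) F) (i j : Fin n)
    (h : J ≤ i ∨ J ≤ j) : dg J A i j = (1 : Matrix (Fin n) (Fin n) F) i j := by
  rw [← dg_one]
  unfold dg
  set e : Fin (J : ℕ) ⊕ Fin (n - J) ≃ Fin n := finSumFinEquiv.trans (finCongr (by omega)) with he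
  obtain ⟨i, rfl⟩ := e.surjective i
  obtain ⟨j, rfl⟩ := e.surjective j
  rcases i with i | i
  · rcases j with j | j
    · exfalso
      rw [Fin.le_def, Fin.le_def] at h
      simp [he] at h
      omega
    · simp [blk]
  · rcases j with j | j <;> simp [blk, Matrix.one_apply]

theorem dg_mulVec (J : Fin n) (A : Matrix (Fin (J : ℕ)) (Fin (J : ℕ)) F) (y : Fin (J : ℕ) → F) :
    dg J A *ᵥ firstCoords F J n y = firstCoords F J n (A *ᵥ y) := by
  unfold dg
  set e : Fin (J : ℕ) ⊕ Fin (n - J) ≃ Fin n := finSumFinEquiv.trans (finCongr (by omega)) with he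
  have h1 : ∀ (z : Fin (J : ℕ) → F) x, firstCoords F J n z (e x) = Sum.elim z 0 x := by
    intro z x
    rcases x with x | x
    · rw [firstCoords_lt _ _ (by simp [he])]
      simp [he]
    · rw [firstCoords_ge _ _ (by simp [he])]
      simp
  ext i
  obtain ⟨i, rfl⟩ := e.surjective i
  rw [h1]
  simp only [Matrix.mulVec, dotProduct]
  rw [← Equiv.sum_comp e]
  simp only [h1, Fintype.sum_sum_type]
  rcases i with i | i <;> simp [blk, Matrix.mulVec, dotProduct]

/-- `dg` as an invertible matrix. -/
def dgGL (J : Fin n) (A : GL (Fin (J : ℕ)) F) : GL (Fin n) F where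
  val := dg J (A : Matrix (Fin (J : ℕ)) (Fin (J : ℕ)) F)
  inv := dg J ((A⁻¹ : GL (Fin (J : ℕ)) F) : Matrix (Fin (J : ℕ)) (Fin (J : ℕ)) F)
  val_inv := by rw [dg_mul, Units.mul_inv, dg_one]
  inv_val := by rw [dg_mul, Units.inv_mul, dg_one]

theorem dgGL_colGL (J : Fin n) (A : GL (Fin (J : ℕ)) F) (y : Fin (J : ℕ) → F) :
    dgGL J A * colGL J y =
      colGL J ((A : Matrix (Fin (J : ℕ)) (Fin (J : ℕ)) F) *ᵥ y) * dgGL J A := by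
  apply Units.ext
  rw [Units.val_mul, Units.val_mul, coe_colGL, coe_colGL, colMat, colMat, mul_add, add_mul,
    mul_one, one_mul, Matrix.mul_vecMulVec, Matrix.vecMulVec_mul]
  congr 2
  · exact dg_mulVec J _ y
  · ext b
    rw [Matrix.single_one_vecMul]
    change _ = dg J _ J b
    rw [dg_row J _ _ _ (Or.inl le_rfl), Matrix.one_apply]
    simp [Pi.single_apply, eq_comm]

theorem dgGL_conj (J : Fin n) (A : GL (Fin (J : ℕ)) F) {x : GL (Fin n) F}
    (hx : Uni (x : Matrix (Fin n) (Fin n) F))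
    (h : ColOne (J + 1) (x : Matrix (Fin n) (Fin n) F)) (i j : Fin n) (hij : J ≤ i ∨ j ≤ J) :
    ((dgGL J A * x * (dgGL J A)⁻¹ : GL (Fin n) F) : Matrix (Fin n) (Fin n) F) i j =
      (x : Matrix (Fin n) (Fin n) F) i j := by
  obtain ⟨N, hN⟩ : ∃ N, (x : Matrix (Fin n) (Fin n) F) = 1 + N :=
    ⟨(x : Matrix (Fin n) (Fin n) F) - 1, by abel⟩
  have hN0 : ∀ a b : Fin n, b ≤ J → N a b = 0 := by
    intro a b hb
    have := h a b (by rw [Fin.le_def] at hb; omega)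
    rw [hN, Matrix.add_apply] at this
    simpa using this
  have h1 : N * dg J ((A⁻¹ : GL (Fin (J : ℕ)) F) : Matrix (Fin (J : ℕ)) (Fin (J : ℕ)) F) = N := by
    conv_rhs => rw [← mul_one N]
    ext a b
    simp only [Matrix.mul_apply]
    refine Finset.sum_congr rfl fun k _ => ?_
    rcases le_or_gt k J with hk | hk
    · rw [hN0 a k hk, zero_mul, zero_mul]
    · rw [dg_row J _ _ _ (Or.inl hk.le)]
  have h2 : ((dgGL J A * x * (dgGL J A)⁻¹ : GL (Fin n) F) : Matrix (Fin n) (Fin n) F) =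
      1 + dg J (A : Matrix (Fin (J : ℕ)) (Fin (J : ℕ)) F) * N := by
    rw [Units.val_mul, Units.val_mul, hN]
    change dg J (A : Matrix (Fin (J : ℕ)) (Fin (J : ℕ)) F) * (1 + N) *
      dg J ((A⁻¹ : GL (Fin (J : ℕ)) F) : Matrix (Fin (J : ℕ)) (Fin (J : ℕ)) F) = _
    rw [mul_add, add_mul, mul_one, dg_mul, Units.mul_inv, dg_one, Matrix.mul_assoc, h1]
  rw [h2, hN, Matrix.add_apply, Matrix.add_apply]
  congr 1
  rcases hij with hi | hj
  · conv_rhs => rw [← one_mul N]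
    simp only [Matrix.mul_apply]
    refine Finset.sum_congr rfl fun k _ => ?_
    rw [dg_row J _ _ _ (Or.inl hi)]
  · rw [Matrix.mul_apply, hN0 _ _ hj]
    exact Finset.sum_eq_zero fun k _ => by rw [hN0 _ _ hj, mul_zero]

theorem dgGL_conj_mem (J : Fin n) (A : GL (Fin (J : ℕ)) F) {x : GL (Fin n) F}
    (hx : Uni (x : Matrix (Fin n) (Fin n) F))
    (h : ColOne (J + 1) (x : Matrix (Fin n) (Fin n) F)) :
    Uni ((dgGL J A * x * (dgGL J A)⁻¹ : GL (Fin n) F) : Matrix (Fin n) (Fin n) F) ∧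
    ColOne (J + 1) ((dgGL J A * x * (dgGL J A)⁻¹ : GL (Fin n) F) : Matrix (Fin n) (Fin n) F) ∧
    su ((dgGL J A * x * (dgGL J A)⁻¹ : GL (Fin n) F) : Matrix (Fin n) (Fin n) F) =
      su (x : Matrix (Fin n) (Fin n) F) := by
  have key := dgGL_conj J A hx h
  refine ⟨fun i j hij => ?_, fun i j hj => ?_, ?_⟩
  · rw [key i j, hx i j hij]
    rcases le_total J i with h | h
    · exact Or.inl h
    · exact Or.inr (hij.trans h)
  · rw [key i j (Or.inr (Fin.le_def.2 (by omega))), h i j hj]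
  · unfold su
    refine Finset.sum_congr rfl fun i _ => Finset.sum_congr rfl fun j _ => ?_
    split_ifs with hij
    · rw [key i j]
      rw [Fin.le_def, Fin.le_def]
      omega
    · rfl

end Kirillov

section Kirillov

variable {F : Type} [Field F] [Fintype F] {n : ℕ}
variable {V : Type} [AddCommGroup V] [Module ℂ V]

theorem sum_addChar_dot {ψ : AddChar F ℂ} (hψ : ψ ≠ 1) {r : ℕ} (y : Fin r → F) (hy : y ≠ 0) :
    ∑ l : Fin r → F, ψ (-(l ⬝ᵥ y)) = 0 := by
  obtain ⟨i, hi⟩ := Function.ne_iff.1 hy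
  obtain ⟨t, ht⟩ := exists_addChar_ne hψ (a := y i) (b := 0) hi
  rw [mul_zero, AddChar.map_zero_eq_one] at ht
  have h1 : ψ (t * y i) * ∑ l : Fin r → F, ψ (-(l ⬝ᵥ y)) = ∑ l : Fin r → F, ψ (-(l ⬝ᵥ y)) := by
    rw [Finset.mul_sum]
    conv_rhs => rw [← Equiv.sum_comp (Equiv.addRight (-Pi.single i t : Fin r → F))]
    refine Finset.sum_congr rfl fun l _ => ?_
    rw [Equiv.coe_addRight, add_dotProduct, neg_dotProduct, single_dotProduct,
      ← AddChar.map_add_eq_mul]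
    congr 1
    ring
  by_contra h
  exact ht (mul_right_cancel₀ h (h1.trans (one_mul _).symm))

/-- Vectors transforming by the generic character under the unitriangular matrices with trivial
first `j` columns. -/
def WhVec (ψ : AddChar F ℂ) (ρ : Representation ℂ (GL (Fin n) F) V) (j : ℕ) (v : V) : Prop :=
  ∀ x : GL (Fin n) F, Uni (x : Matrix (Fin n) (Fin n) F) →
    ColOne j (x : Matrix (Fin n) (Fin n) F) →
    ρ x v = ψ (su (x : Matrix (Fin n) (Fin n) F)) • v

theorem su_conj {x w : GL (Fin n) F} (hx : Uni (x : Matrix (Fin n) (Fin n) F))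
    (hw : Uni (w : Matrix (Fin n) (Fin n) F)) :
    Uni ((w⁻¹ * x * w : GL (Fin n) F) : Matrix (Fin n) (Fin n) F) ∧
    su ((w⁻¹ * x * w : GL (Fin n) F) : Matrix (Fin n) (Fin n) F) =
      su (x : Matrix (Fin n) (Fin n) F) := by
  obtain ⟨x, rfl⟩ : ∃ x' : U F n, (x' : GL (Fin n) F) = x := ⟨⟨x, (mem_U x).2 hx⟩, rfl⟩
  obtain ⟨w, rfl⟩ : ∃ w' : U F n, (w' : GL (Fin n) F) = w := ⟨⟨w, (mem_U w).2 hw⟩, rfl⟩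
  refine ⟨U_uni (w⁻¹ * x * w), ?_⟩
  have : suU (w⁻¹ * x * w) = suU x := by
    rw [suU_mul, suU_mul, suU_inv]
    ring
  exact this

theorem WhVec.apply {ψ : AddChar F ℂ} {ρ : Representation ℂ (GL (Fin n) F) V} {j : ℕ} {v : V}
    (hv : WhVec ψ ρ j v) {w : GL (Fin n) F} (hw : Uni (w : Matrix (Fin n) (Fin n) F)) :
    WhVec ψ ρ j (ρ w v) := by
  intro x hx hj
  rw [← Module.End.mul_apply, ← map_mul, show x * w = w * (w⁻¹ * x * w) by group, map_mul,
    Module.End.mul_apply, hv _ (su_conj hx hw).1 (hj.conj hw), (su_conj hx hw).2, map_smul]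

theorem exists_whVec_step {ψ : AddChar F ℂ} (hψ : ψ ≠ 1)
    {ρ : Representation ℂ (GL (Fin n) F) V} (hρ : IsCuspidal ρ) (J : Fin n) (hJ : 0 < (J : ℕ))
    {v : V} (hv : v ≠ 0) (hW : WhVec ψ ρ (J + 1) v) : ∃ w, w ≠ 0 ∧ WhVec ψ ρ J w := by
  classical
  let i : Fin (J : ℕ) := ⟨J - 1, by omega⟩
  have hi : (i : ℕ) + 1 = J := by simp only [i]; omega
  let P : (Fin (J : ℕ) → F) → V := fun l => ∑ y, ψ (-(l ⬝ᵥ y)) • ρ (colGL J y) v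
  have hP : ∀ l z, ρ (colGL J z) (P l) = ψ (l ⬝ᵥ z) • P l := by
    intro l z
    simp only [P, map_sum, map_smul, Finset.smul_sum]
    conv_rhs => rw [← Equiv.sum_comp (Equiv.addLeft z)]
    refine Finset.sum_congr rfl fun y _ => ?_
    rw [Equiv.coe_addLeft, ← Module.End.mul_apply, ← map_mul, colGL_mul, smul_smul,
      ← AddChar.map_add_eq_mul, dotProduct_add]
    congr 2
    ring
  have hPW : ∀ l, WhVec ψ ρ (J + 1) (P l) := by
    intro l x hx hj
    simp only [P, map_sum, map_smul, Finset.smul_sum]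
    refine Finset.sum_congr rfl fun y _ => ?_
    rw [(hW.apply (w := colGL J y) (by rw [coe_colGL]; exact colMat_uni J y)) x hx hj, smul_comm]
  have hsum : ∑ l, P l = (Fintype.card (Fin (J : ℕ) → F) : ℂ) • v := by
    simp only [P]
    rw [Finset.sum_comm]
    simp only [← Finset.sum_smul]
    rw [Finset.sum_eq_single 0]
    · rw [colGL_zero, map_one, Module.End.one_apply]
      simp
    · intro y _ hy
      rw [sum_addChar_dot hψ y hy, zero_smul]
    · simp
  obtain ⟨l, hl, hl'⟩ : ∃ l, l ≠ 0 ∧ P l ≠ 0 := by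
    by_contra! hcon
    apply hv
    rw [Finset.sum_eq_single 0 (fun l _ hl => hcon l hl) (by simp)] at hsum
    have hfix : ∀ z, ρ (colGL J z) v = v := by
      intro z
      have h1 := hP 0 z
      rw [zero_dotProduct, AddChar.map_zero_eq_one, one_smul, hsum, map_smul] at h1
      exact smul_right_injective V (by simp : (Fintype.card (Fin (J : ℕ) → F) : ℂ) ≠ 0) h1
    refine hρ.2 J hJ J.2 v fun u hu => ?_
    have hu1 : Uni (u : Matrix (Fin n) (Fin n) F) := by
      intro a b hab
      by_cases h : a = b
      · subst h
        rw [hu.1, Matrix.one_apply_eq]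
      · rw [hu.2 a b h (by rw [Fin.le_def] at hab; omega), Matrix.one_apply_ne h]
    have hu2 : ColOne J (u : Matrix (Fin n) (Fin n) F) := by
      intro a b hb
      by_cases h : a = b
      · subst h
        rw [hu.1, Matrix.one_apply_eq]
      · rw [hu.2 a b h (by omega), Matrix.one_apply_ne h]
    obtain ⟨z, y, hz, hz1, hz2⟩ := exists_colGL hu1 hu2
    have hsz : su (z : Matrix (Fin n) (Fin n) F) = 0 := by
      refine Finset.sum_eq_zero fun a _ => Finset.sum_eq_zero fun b _ => ?_
      split_ifs with hab
      · have hne : a ≠ b := by rintro rfl; omega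
        by_cases hb : (b : ℕ) < J + 1
        · rw [hz2 a b hb, Matrix.one_apply_ne hne]
        · have hz3 : z = u * colGL J (-y) := by
            rw [hz, mul_assoc, colGL_mul, add_neg_cancel, colGL_zero, mul_one]
          have hbJ : b ≠ J := by rintro rfl; omega
          rw [hz3, Units.val_mul, coe_colGL, hu2.mul_colMat, Matrix.add_apply, vecMulVec_apply,
            hu.2 a b hne (by omega)]
          simp [hbJ]
      · rfl
    rw [hz, map_mul, Module.End.mul_apply, hfix, hW z hz1 hz2, hsz, AddChar.map_zero_eq_one,
      one_smul]
  obtain ⟨q, hq⟩ := exists_GL_map (N := Fin (J : ℕ)) (LinearMap.toSpanSingleton F _ l)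
    (LinearMap.toSpanSingleton F _ (Pi.single i (1 : F) : Fin (J : ℕ) → F))
    (smul_left_injective F hl) (smul_left_injective F (by simp))
  have hq1 : (q : Matrix (Fin (J : ℕ)) (Fin (J : ℕ)) F) *ᵥ l = Pi.single i 1 := by
    simpa using hq 1
  let A : GL (Fin (J : ℕ)) F :=
    { val := (q : Matrix (Fin (J : ℕ)) (Fin (J : ℕ)) F)ᵀ
      inv := ((q⁻¹ : GL (Fin (J : ℕ)) F) : Matrix (Fin (J : ℕ)) (Fin (J : ℕ)) F)ᵀ
      val_inv := by rw [← Matrix.transpose_mul, Units.inv_mul, Matrix.transpose_one]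
      inv_val := by rw [← Matrix.transpose_mul, Units.mul_inv, Matrix.transpose_one] }
  have hA : ∀ y, l ⬝ᵥ ((A : Matrix (Fin (J : ℕ)) (Fin (J : ℕ)) F) *ᵥ y) = y i := by
    intro y
    change l ⬝ᵥ ((q : Matrix (Fin (J : ℕ)) (Fin (J : ℕ)) F)ᵀ *ᵥ y) = y i
    rw [Matrix.dotProduct_mulVec, Matrix.vecMul_transpose, hq1, single_one_dotProduct]
  have hinv : ∀ x : GL (Fin n) F, ∀ t : V, ρ x (ρ x⁻¹ t) = t := by
    intro x t
    rw [← Module.End.mul_apply, ← map_mul, mul_inv_cancel, map_one, Module.End.one_apply]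
  refine ⟨ρ (dgGL J A)⁻¹ (P l), fun h => hl' ?_, ?_⟩
  · rw [← hinv (dgGL J A) (P l), h, map_zero]
  · intro x hx hj
    obtain ⟨z, y, rfl, hz1, hz2⟩ := exists_colGL hx hj
    have h1 : ρ (colGL J y) (ρ (dgGL J A)⁻¹ (P l)) = ψ (y i) • ρ (dgGL J A)⁻¹ (P l) := by
      rw [← Module.End.mul_apply, ← map_mul, show colGL J y * (dgGL J A)⁻¹ = (dgGL J A)⁻¹ *
        colGL J ((A : Matrix (Fin (J : ℕ)) (Fin (J : ℕ)) F) *ᵥ y) by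
          rw [eq_inv_mul_iff_mul_eq, ← mul_assoc, dgGL_colGL, mul_inv_cancel_right], map_mul,
        Module.End.mul_apply, hP, map_smul, hA]
    have h2 : ρ z (ρ (dgGL J A)⁻¹ (P l)) =
        ψ (su (z : Matrix (Fin n) (Fin n) F)) • ρ (dgGL J A)⁻¹ (P l) := by
      obtain ⟨h3, h4, h5⟩ := dgGL_conj_mem J A hz1 hz2
      rw [← Module.End.mul_apply, ← map_mul, show z * (dgGL J A)⁻¹ = (dgGL J A)⁻¹ *
        (dgGL J A * z * (dgGL J A)⁻¹) by group, map_mul, Module.End.mul_apply, hPW l _ h3 h4,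
        map_smul, h5]
    rw [map_mul, Module.End.mul_apply, h1, map_smul, h2, smul_smul, Units.val_mul,
      hz1.su_mul (by rw [coe_colGL]; exact colMat_uni J y), coe_colGL, su_colMat J i hi,
      AddChar.map_add_eq_mul, mul_comm]

theorem exists_whVec {ψ : AddChar F ℂ} (hψ : ψ ≠ 1) {ρ : Representation ℂ (GL (Fin n) F) V}
    (hρ : IsCuspidal ρ) (k : ℕ) (hk : k < n) : ∃ w, w ≠ 0 ∧ WhVec ψ ρ (n - k) w := by
  induction k with
  | zero =>
    obtain ⟨v, hv⟩ : ∃ v : V, v ≠ 0 := by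
      by_contra! h
      exact hρ.1.1 (Submodule.ext fun v => by simp [h v])
    refine ⟨v, hv, fun x hx hj => ?_⟩
    have : x = 1 := Units.ext (Matrix.ext fun a b => hj a b (by omega))
    subst this
    rw [map_one, Units.val_one, su_one, AddChar.map_zero_eq_one, one_smul, Module.End.one_apply]
  | succ k ih =>
    obtain ⟨v, hv, hW⟩ := ih (by omega)
    refine exists_whVec_step hψ hρ ⟨n - (k + 1), by omega⟩ (by simp only; omega) hv ?_
    simp only
    rwa [show n - (k + 1) + 1 = n - k by omega]

theorem wh_cuspidal [FiniteDimensional ℂ V] {ψ : AddChar F ℂ} (hψ : ψ ≠ 1)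
    {ρ : Representation ℂ (GL (Fin n) F) V} (hρ : IsCuspidal ρ) (hn : 0 < n) :
    wh ψ (zext ρ.character) = 1 := by
  have hirr : ρ.character ∈ Irr (GL (Fin n) F) := ⟨V, _, _, ‹_›, ρ, hρ.1, rfl⟩
  rcases wh_irr hψ hirr with h | h
  · exfalso
    obtain ⟨v, hv, hW⟩ := exists_whVec hψ hρ (n - 1) (by omega)
    rw [show n - (n - 1) = 1 by omega] at hW
    rw [wh_eq_finrank, Nat.cast_eq_zero, Submodule.finrank_eq_zero] at h
    apply hv
    rw [← Submodule.mem_bot ℂ, ← h]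
    refine ⟨v, whProj_eq fun u => ?_⟩
    refine hW u (U_uni u) fun a b hb => U_uni u a b (Fin.le_def.2 (by omega))
  · exact h

end Kirillov

section Jacquet

open scoped TensorProduct in
theorem trace_comp_comp {V W : Type} [AddCommGroup V] [Module ℂ V] [FiniteDimensional ℂ V]
    [AddCommGroup W] [Module ℂ W] [FiniteDimensional ℂ W] (A : W →ₗ[ℂ] W) (B : V →ₗ[ℂ] V)
    (T : (V →ₗ[ℂ] W) →ₗ[ℂ] (V →ₗ[ℂ] W)) (hT : ∀ f, T f = A ∘ₗ f ∘ₗ B) :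
    LinearMap.trace ℂ _ T = LinearMap.trace ℂ _ A * LinearMap.trace ℂ _ B := by
  let E : Module.Dual ℂ V ⊗[ℂ] W ≃ₗ[ℂ] (V →ₗ[ℂ] W) := dualTensorHomEquiv ℂ V W
  have h : T = E.conj (TensorProduct.map (Module.Dual.transpose B) A) := by
    have h1 : T ∘ₗ E.toLinearMap =
        E.toLinearMap ∘ₗ TensorProduct.map (Module.Dual.transpose B) A := by
      ext φ w v
      simp [E, hT, dualTensorHomEquiv, Module.Dual.transpose_apply]
    refine LinearMap.ext fun f => ?_
    have h2 := LinearMap.congr_fun h1 (E.symm f)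
    simpa [LinearEquiv.conj_apply] using h2
  rw [h, LinearMap.trace_conj', LinearMap.trace_tensorProduct', LinearMap.trace_transpose',
    mul_comm]

variable {F : Type} [Field F] [Fintype F] {d k n : ℕ}

/-- Block upper triangular elements of the general linear group. -/
noncomputable def bG (e : Fin d ⊕ Fin k ≃ Fin n) (a : GL (Fin d) F) (b : Matrix (Fin d) (Fin k) F)
    (c : GL (Fin k) F) : GL (Fin n) F :=
  ((isUnit_blk e (a : Matrix (Fin d) (Fin d) F) b (c : Matrix (Fin k) (Fin k) F)).2
    ⟨a.isUnit, c.isUnit⟩).unit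

theorem coe_bG (e : Fin d ⊕ Fin k ≃ Fin n) (a : GL (Fin d) F) (b : Matrix (Fin d) (Fin k) F)
    (c : GL (Fin k) F) : ((bG e a b c : GL (Fin n) F) : Matrix (Fin n) (Fin n) F) =
      blk e (a : Matrix (Fin d) (Fin d) F) b 0 (c : Matrix (Fin k) (Fin k) F) := IsUnit.unit_spec _

theorem bG_mul (e : Fin d ⊕ Fin k ≃ Fin n) (a a' : GL (Fin d) F) (b b' : Matrix (Fin d) (Fin k) F)
    (c c' : GL (Fin k) F) : bG e a b c * bG e a' b' c' = bG e (a * a')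
      ((a : Matrix (Fin d) (Fin d) F) * b' + b * (c' : Matrix (Fin k) (Fin k) F)) (c * c') := by
  apply Units.ext
  rw [Units.val_mul, coe_bG, coe_bG, coe_bG, blk_mul, Units.val_mul, Units.val_mul]
  simp

theorem bG_one (e : Fin d ⊕ Fin k ≃ Fin n) : bG e (1 : GL (Fin d) F) 0 1 = 1 := by
  apply Units.ext
  rw [coe_bG, Units.val_one, Units.val_one, Units.val_one, blk_one]

variable {V W : Type} [AddCommGroup V] [Module ℂ V] [AddCommGroup W] [Module ℂ W]

/-- The twisted action of the unipotent radical and first block on homomorphisms. -/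
noncomputable def jacOp (e : Fin d ⊕ Fin k ≃ Fin n) (ρ : Representation ℂ (GL (Fin d) F) V)
    (π : Representation ℂ (GL (Fin n) F) W) (a : GL (Fin d) F) (b : Matrix (Fin d) (Fin k) F) :
    (V →ₗ[ℂ] W) →ₗ[ℂ] (V →ₗ[ℂ] W) where
  toFun f := π (bG e a b 1) ∘ₗ f ∘ₗ ρ a⁻¹
  map_add' f g := by rw [LinearMap.add_comp, LinearMap.comp_add]
  map_smul' c f := by rw [LinearMap.smul_comp, LinearMap.comp_smul, RingHom.id_apply]

/-- The action of the second block on homomorphisms. -/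
noncomputable def jacRep (e : Fin d ⊕ Fin k ≃ Fin n) (V : Type) [AddCommGroup V] [Module ℂ V]
    (π : Representation ℂ (GL (Fin n) F) W) : Representation ℂ (GL (Fin k) F) (V →ₗ[ℂ] W) where
  toFun c :=
    { toFun := fun f => π (bG e 1 0 c) ∘ₗ f
      map_add' := fun f g => LinearMap.comp_add _ _ _
      map_smul' := fun c f => LinearMap.comp_smul _ _ _ }
  map_one' := by
    ext f v
    simp [bG_one]
  map_mul' c c' := by
    ext f v
    have h : bG e (1 : GL (Fin d) F) 0 (c * c') = bG e 1 0 c * bG e 1 0 c' := by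
      rw [bG_mul]
      simp
    simp [h]

theorem jacOp_apply (e : Fin d ⊕ Fin k ≃ Fin n) (ρ : Representation ℂ (GL (Fin d) F) V)
    (π : Representation ℂ (GL (Fin n) F) W) (a : GL (Fin d) F) (b : Matrix (Fin d) (Fin k) F)
    (f : V →ₗ[ℂ] W) : jacOp e ρ π a b f = π (bG e a b 1) ∘ₗ f ∘ₗ ρ a⁻¹ := rfl

theorem jacOp_mul (e : Fin d ⊕ Fin k ≃ Fin n) (ρ : Representation ℂ (GL (Fin d) F) V)
    (π : Representation ℂ (GL (Fin n) F) W) (a a' : GL (Fin d) F)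
    (b b' : Matrix (Fin d) (Fin k) F) : jacOp e ρ π a b * jacOp e ρ π a' b' =
      jacOp e ρ π (a * a') ((a : Matrix (Fin d) (Fin d) F) * b' + b) := by
  ext f v
  have h : bG e (a * a') ((a : Matrix (Fin d) (Fin d) F) * b' + b) (1 : GL (Fin k) F) =
      bG e a b 1 * bG e a' b' 1 := by
    rw [bG_mul]
    simp
  rw [Module.End.mul_apply, jacOp_apply, jacOp_apply, jacOp_apply, h, _root_.mul_inv_rev, map_mul,
    map_mul]
  rfl

/-- The projection onto the homomorphisms invariant under the unipotent radical and the first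
block. -/
noncomputable def jacProj (e : Fin d ⊕ Fin k ≃ Fin n) (ρ : Representation ℂ (GL (Fin d) F) V)
    (π : Representation ℂ (GL (Fin n) F) W) : (V →ₗ[ℂ] W) →ₗ[ℂ] (V →ₗ[ℂ] W) :=
  (glc F (Fin d) * Nat.card (Matrix (Fin d) (Fin k) F))⁻¹ •
    ∑ a : GL (Fin d) F, ∑ b, jacOp e ρ π a b

theorem jac_card_ne_zero : glc F (Fin d) * Nat.card (Matrix (Fin d) (Fin k) F) ≠ 0 :=
  mul_ne_zero glc_ne_zero (by simp [Nat.card_pos.ne'])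

theorem jacProj_of_fixed (e : Fin d ⊕ Fin k ≃ Fin n) (ρ : Representation ℂ (GL (Fin d) F) V)
    (π : Representation ℂ (GL (Fin n) F) W) (f : V →ₗ[ℂ] W) (h : ∀ a b, jacOp e ρ π a b f = f) :
    jacProj e ρ π f = f := by
  unfold jacProj
  rw [LinearMap.smul_apply]
  simp only [LinearMap.sum_apply, h, Finset.sum_const, Finset.card_univ]
  rw [inv_smul_eq_iff₀ jac_card_ne_zero, ← mul_smul, ← Nat.cast_smul_eq_nsmul ℂ]
  congr 1
  simp [glc, ← Nat.card_eq_fintype_card]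

theorem jacOp_jacProj (e : Fin d ⊕ Fin k ≃ Fin n) (ρ : Representation ℂ (GL (Fin d) F) V)
    (π : Representation ℂ (GL (Fin n) F) W) (a : GL (Fin d) F) (b : Matrix (Fin d) (Fin k) F) :
    jacOp e ρ π a b * jacProj e ρ π = jacProj e ρ π := by
  unfold jacProj
  rw [mul_smul_comm]
  congr 1
  simp only [Finset.mul_sum, jacOp_mul]
  conv_rhs => rw [← Equiv.sum_comp (Equiv.mulLeft a)]
  refine Finset.sum_congr rfl fun a' _ => ?_
  refine Fintype.sum_bijective (fun b' => (a : Matrix (Fin d) (Fin d) F) * b' + b) ?_ _ _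
    fun b' => rfl
  refine (Finite.injective_iff_bijective).1 fun x y hxy => ?_
  have h := congrArg (fun z => ((a⁻¹ : GL (Fin d) F) : Matrix (Fin d) (Fin d) F) * z)
    (add_right_cancel hxy)
  simpa only [← Matrix.mul_assoc, Units.inv_mul, Matrix.one_mul] using h

theorem jacProj_idem (e : Fin d ⊕ Fin k ≃ Fin n) (ρ : Representation ℂ (GL (Fin d) F) V)
    (π : Representation ℂ (GL (Fin n) F) W) :
    jacProj e ρ π ∘ₗ jacProj e ρ π = jacProj e ρ π := by
  refine LinearMap.ext fun f => jacProj_of_fixed e ρ π _ fun a b => ?_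
  exact LinearMap.congr_fun (jacOp_jacProj e ρ π a b) f

theorem jacRep_comp (e : Fin d ⊕ Fin k ≃ Fin n) (ρ : Representation ℂ (GL (Fin d) F) V)
    (π : Representation ℂ (GL (Fin n) F) W) (a : GL (Fin d) F) (b : Matrix (Fin d) (Fin k) F)
    (c : GL (Fin k) F) : jacOp e ρ π a b ∘ₗ jacRep e V π c =
      jacRep e V π c ∘ₗ jacOp e ρ π a (b * (c : Matrix (Fin k) (Fin k) F)) := by
  ext f v
  have h : bG e a b 1 * bG e (1 : GL (Fin d) F) 0 c =
      bG e 1 0 c * bG e a (b * (c : Matrix (Fin k) (Fin k) F)) 1 := by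
    rw [bG_mul, bG_mul]
    simp
  have h' := LinearMap.congr_fun (congrArg π h) (f (ρ a⁻¹ v))
  rw [map_mul, map_mul] at h'
  exact h'

theorem sum_mul_unit (c : GL (Fin k) F) {X : Type} [AddCommMonoid X]
    (φ : Matrix (Fin d) (Fin k) F → X) :
    ∑ b, φ (b * (c : Matrix (Fin k) (Fin k) F)) = ∑ b, φ b := by
  refine Fintype.sum_bijective (fun b : Matrix (Fin d) (Fin k) F =>
    b * (c : Matrix (Fin k) (Fin k) F)) ?_ _ _ fun b' => rfl
  refine (Finite.injective_iff_bijective).1 fun (x y : Matrix (Fin d) (Fin k) F) hxy => ?_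
  have h := congrArg (fun z : Matrix (Fin d) (Fin k) F => z * ((c⁻¹ : GL (Fin k) F) : Matrix (Fin k) (Fin k) F)) hxy
  simpa only [Matrix.mul_assoc, Units.mul_inv, Matrix.mul_one] using h

theorem jacRep_jacProj (e : Fin d ⊕ Fin k ≃ Fin n) (ρ : Representation ℂ (GL (Fin d) F) V)
    (π : Representation ℂ (GL (Fin n) F) W) (c : GL (Fin k) F) :
    jacRep e V π c ∘ₗ jacProj e ρ π = jacProj e ρ π ∘ₗ jacRep e V π c := by
  unfold jacProj
  rw [LinearMap.comp_smul, LinearMap.smul_comp]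
  congr 1
  refine LinearMap.ext fun f => ?_
  simp only [LinearMap.comp_apply, LinearMap.sum_apply, map_sum]
  refine Finset.sum_congr rfl fun a _ => ?_
  rw [← sum_mul_unit c]
  refine Finset.sum_congr rfl fun b _ => ?_
  exact (LinearMap.congr_fun (jacRep_comp e ρ π a b c) f).symm

theorem trace_jacProj [FiniteDimensional ℂ V] [FiniteDimensional ℂ W]
    (e : Fin d ⊕ Fin k ≃ Fin n) (ρ : Representation ℂ (GL (Fin d) F) V)
    (π : Representation ℂ (GL (Fin n) F) W) (c : GL (Fin k) F) :
    LinearMap.trace ℂ _ (jacProj e ρ π ∘ₗ jacRep e V π c) =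
      Ef e (st (zext ρ.character)) (zext π.character) c := by
  unfold jacProj Ef
  rw [LinearMap.smul_comp, map_smul, smul_eq_mul]
  congr 1
  rw [sum_units]
  · have h : (∑ a : GL (Fin d) F, ∑ b, jacOp e ρ π a b) ∘ₗ jacRep e V π c =
        ∑ a : GL (Fin d) F, ∑ b, jacOp e ρ π a b ∘ₗ jacRep e V π c := by
      refine LinearMap.ext fun f => ?_
      simp only [LinearMap.comp_apply, LinearMap.sum_apply]
    rw [h, map_sum]
    refine Finset.sum_congr rfl fun a _ => ?_
    rw [map_sum]
    conv_rhs => rw [← sum_mul_unit c]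
    refine Finset.sum_congr rfl fun b _ => ?_
    rw [trace_comp_comp (π (bG e a b 1) ∘ₗ π (bG e 1 0 c)) (ρ a⁻¹) _ fun f => rfl,
      st_coe, zext_coe, ← coe_bG, zext_coe, mul_comm]
    congr 1
    change LinearMap.trace ℂ _ (π (bG e a b 1) * π (bG e 1 0 c)) = _
    rw [← map_mul, bG_mul]
    simp [Representation.character]
    rfl
  · intro M hM
    refine Finset.sum_eq_zero fun b _ => ?_
    rw [(st_isCl (zext_isCl fun x y => Representation.char_conj ρ y x)).supp _ hM, zero_mul]

theorem jac_mem_repChar [FiniteDimensional ℂ V] [FiniteDimensional ℂ W]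
    (e : Fin d ⊕ Fin k ≃ Fin n) (ρ : Representation ℂ (GL (Fin d) F) V)
    (π : Representation ℂ (GL (Fin n) F) W) :
    (fun c : GL (Fin k) F => Ef e (st (zext ρ.character)) (zext π.character)
      (c : Matrix (Fin k) (Fin k) F)) ∈ RepChar (GL (Fin k) F) := by
  simp only [← trace_jacProj]
  exact trace_proj_mem_repChar _ _ (jacProj_idem e ρ π) (jacRep_jacProj e ρ π)

end Jacquet

section Support

variable {F : Type} [Field F] [Fintype F] {d k n : ℕ}

theorem exists_bG_of_isBlockUnipotent {s : ℕ} (hs : s ≤ d) {u : GL (Fin (d + k)) F}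
    (hu : IsBlockUnipotent s u) : ∃ (a : GL (Fin d) F) (b : Matrix (Fin d) (Fin k) F),
      IsBlockUnipotent s a ∧ u = bG finSumFinEquiv a b 1 := by
  obtain ⟨a, b, c, c', h⟩ := exists_blk finSumFinEquiv (u : Matrix (Fin (d + k)) (Fin (d + k)) F)
  have hent : ∀ x y : Fin d ⊕ Fin k, fromBlocks a b c c' x y =
      (u : Matrix (Fin (d + k)) (Fin (d + k)) F) (finSumFinEquiv x) (finSumFinEquiv y) := by
    intro x y
    rw [h]
    simp [blk]
  have hc : c = 0 := by
    ext i j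
    have h1 := hent (Sum.inr i) (Sum.inl j)
    rw [fromBlocks_apply₂₁] at h1
    rw [h1]
    refine hu.2 _ _ (fun h => by simpa using finSumFinEquiv.injective h) fun h => ?_
    have := h.1
    rw [finSumFinEquiv_apply_right, Fin.val_natAdd] at this
    omega
  have hc' : c' = 1 := by
    ext i j
    have h1 := hent (Sum.inr i) (Sum.inr j)
    rw [fromBlocks_apply₂₂] at h1
    rw [h1]
    by_cases hij : i = j
    · subst hij
      rw [hu.1, one_apply_eq]
    · rw [one_apply_ne hij]
      refine hu.2 _ _ (fun h => hij (by simpa using h)) fun h => ?_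
      have := h.1
      rw [finSumFinEquiv_apply_right, Fin.val_natAdd] at this
      omega
  subst hc hc'
  have hunit := (isUnit_blk finSumFinEquiv a b (1 : Matrix (Fin k) (Fin k) F)).1 (h ▸ u.isUnit)
  refine ⟨hunit.1.unit, b, ⟨fun i => ?_, fun i j hij hlt => ?_⟩, ?_⟩
  · rw [IsUnit.unit_spec, ← fromBlocks_apply₁₁ a b 0 (1 : Matrix (Fin k) (Fin k) F), hent, hu.1]
  · rw [IsUnit.unit_spec, ← fromBlocks_apply₁₁ a b 0 (1 : Matrix (Fin k) (Fin k) F), hent]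
    refine hu.2 _ _ (fun h => hij (by simpa using h)) ?_
    rwa [finSumFinEquiv_apply_left, finSumFinEquiv_apply_left, Fin.val_castAdd, Fin.val_castAdd]
  · apply Units.ext
    rw [coe_bG, IsUnit.unit_spec, Units.val_one, h]

theorem isBlockUnipotent_bG (b : Matrix (Fin d) (Fin k) F) :
    IsBlockUnipotent d (bG finSumFinEquiv 1 b 1) := by
  constructor
  · intro i
    obtain ⟨x, rfl⟩ := finSumFinEquiv.surjective i
    rw [coe_bG]
    cases x <;> simp [blk]
  · intro i j hij h
    obtain ⟨x, rfl⟩ := finSumFinEquiv.surjective i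
    obtain ⟨y, rfl⟩ := finSumFinEquiv.surjective j
    rw [coe_bG]
    cases x with
    | inl x =>
      cases y with
      | inl y =>
        have hxy : x ≠ y := fun h => hij (by rw [h])
        simp [blk, hxy]
      | inr y => exact absurd ⟨by simp, by simp⟩ h
    | inr x =>
      cases y with
      | inl y => simp [blk]
      | inr y =>
        have hxy : x ≠ y := fun h => hij (by rw [h])
        simp [blk, hxy]

variable {W : Type} [AddCommGroup W] [Module ℂ W]

/-- The vectors fixed by all block unipotent elements. -/
def fixSub (π : Representation ℂ (GL (Fin n) F) W) (r : ℕ) : Submodule ℂ W where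
  carrier := {v | ∀ u : GL (Fin n) F, IsBlockUnipotent r u → π u v = v}
  add_mem' h h' u hu := by rw [map_add, h u hu, h' u hu]
  zero_mem' u hu := map_zero _
  smul_mem' c v h u hu := by rw [map_smul, h u hu]

theorem fixSub_self (π : Representation ℂ (GL (Fin n) F) W) : fixSub π n = ⊤ := by
  rw [eq_top_iff]
  intro v _ u hu
  have : u = 1 := by
    apply Units.ext
    ext i j
    by_cases h : i = j
    · subst h
      rw [hu.1, Units.val_one, one_apply_eq]
    · rw [Units.val_one, one_apply_ne h]
      exact hu.2 i j h fun h' => by omega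
  rw [this, map_one, Module.End.one_apply]

/-- The restriction of a representation to the first block. -/
noncomputable def firstBlock (e : Fin d ⊕ Fin k ≃ Fin n)
    (π : Representation ℂ (GL (Fin n) F) W) : Representation ℂ (GL (Fin d) F) W where
  toFun a := π (bG e a 0 1)
  map_one' := by rw [bG_one, map_one]
  map_mul' a a' := by
    rw [← map_mul, bG_mul]
    simp

theorem firstBlock_apply (e : Fin d ⊕ Fin k ≃ Fin n)
    (π : Representation ℂ (GL (Fin n) F) W) (a : GL (Fin d) F) :
    firstBlock e π a = π (bG e a 0 1) := rfl

theorem bG_eq_mul (e : Fin d ⊕ Fin k ≃ Fin n) (a : GL (Fin d) F) (b : Matrix (Fin d) (Fin k) F) :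
    bG e a b 1 = bG e 1 b 1 * bG e a 0 1 := by
  rw [bG_mul]
  simp

theorem repInvariant_fixSub (π : Representation ℂ (GL (Fin (d + k)) F) W) :
    RepInvariant (firstBlock finSumFinEquiv π) (fixSub π d) := by
  intro a v hv u hu
  obtain ⟨a', b, ha', rfl⟩ := exists_bG_of_isBlockUnipotent le_rfl hu
  have h1 : bG finSumFinEquiv a' b 1 * bG finSumFinEquiv a 0 1 = bG finSumFinEquiv a 0 1 *
      bG finSumFinEquiv 1 (((a⁻¹ : GL (Fin d) F) : Matrix (Fin d) (Fin d) F) * b)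
        (1 : GL (Fin k) F) := by
    have h2 : a' = 1 := by
      apply Units.ext
      ext i j
      by_cases h : i = j
      · subst h
        rw [ha'.1, Units.val_one, one_apply_eq]
      · rw [Units.val_one, one_apply_ne h]
        exact ha'.2 i j h fun h' => by omega
    rw [h2, bG_mul, bG_mul]
    simp only [← Matrix.mul_assoc, Units.mul_inv]
    simp
  rw [firstBlock_apply, ← Module.End.mul_apply, ← map_mul, h1, map_mul, Module.End.mul_apply,
    hv _ (isBlockUnipotent_bG _)]

theorem exists_support_aux [FiniteDimensional ℂ W] (π : Representation ℂ (GL (Fin (d + k)) F) W)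
    (hne : fixSub π d ≠ ⊥) (hmin : ∀ s, 0 < s → s < d → fixSub π s = ⊥) :
    ∃ (V : Type) (_ : AddCommGroup V) (_ : Module ℂ V) (_ : FiniteDimensional ℂ V)
      (ρ : Representation ℂ (GL (Fin d) F) V), IsCuspidal ρ ∧
      ∃ τ ∈ Irr (GL (Fin k) F), cip (fun c : GL (Fin k) F => Ef finSumFinEquiv
        (st (zext ρ.character)) (zext π.character) (c : Matrix (Fin k) (Fin k) F)) τ ≠ 0 := by
  obtain ⟨W₁, hW₁, hle, hirr⟩ := exists_irreducible_le _ _ (repInvariant_fixSub π) hne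
  refine ⟨W₁, inferInstance, inferInstance, inferInstance, restrictRep _ W₁ hW₁, ⟨hirr, ?_⟩, ?_⟩
  · intro s hs hsd v hv
    have h1 : (v : W) ∈ fixSub π s := by
      intro u hu
      obtain ⟨a, b, ha, rfl⟩ := exists_bG_of_isBlockUnipotent hsd.le hu
      have h2 : π (bG finSumFinEquiv a 0 1) (v : W) = v := congrArg Subtype.val (hv a ha)
      rw [bG_eq_mul, map_mul, Module.End.mul_apply, h2, hle v.2 _ (isBlockUnipotent_bG _)]
    rw [hmin s hs hsd, Submodule.mem_bot] at h1
    exact Subtype.ext h1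
  · set ρ := restrictRep _ W₁ hW₁ with hρ
    by_contra! hcon
    have h0 := eq_zero_of_orthogonal _ (repChar_class (jac_mem_repChar finSumFinEquiv ρ π)) hcon
    have h1 := congrFun h0 1
    simp only [← trace_jacProj, Pi.zero_apply, map_one] at h1
    have h2 : IsIdempotentElem (jacProj finSumFinEquiv ρ π) := jacProj_idem _ ρ π
    have h3 : jacProj finSumFinEquiv ρ π = 0 :=
      (LinearMap.IsIdempotentElem.trace_eq_zero_iff h2).1 h1
    have h4 : jacProj finSumFinEquiv ρ π W₁.subtype = W₁.subtype := by
      refine jacProj_of_fixed _ _ _ _ fun a b => LinearMap.ext fun v => ?_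
      change π (bG finSumFinEquiv a b 1) (π (bG finSumFinEquiv a⁻¹ 0 1) (v : W)) = v
      rw [← Module.End.mul_apply, ← map_mul, bG_mul]
      simp only [mul_inv_cancel, Matrix.mul_zero, zero_add, Units.val_one, Matrix.mul_one]
      rw [one_mul]
      exact hle v.2 _ (isBlockUnipotent_bG _)
    rw [h3, LinearMap.zero_apply] at h4
    apply hirr.1
    refine (Submodule.eq_bot_iff _).2 (fun x _ => ?_) |>.symm
    exact Subtype.ext (LinearMap.congr_fun h4 x).symm

end Support

section Multiplication

variable (F : Type) [Field F] [Fintype F]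

/-- The irreducible characters of all general linear groups. -/
abbrev Pt := Σ n : ℕ, Irr (GL (Fin n) F)

/-- The cuspidal characters of a general linear group. -/
def Csp (n : ℕ) : Set (GL (Fin n) F → ℂ) :=
  {χ | ∃ (V : Type) (_ : AddCommGroup V) (_ : Module ℂ V) (_ : FiniteDimensional ℂ V)
    (ρ : Representation ℂ (GL (Fin n) F) V), IsCuspidal ρ ∧ ρ.character = χ}

/-- The cuspidal characters of all general linear groups of positive rank. -/
abbrev Cpt := {p : Σ n : ℕ, Csp F n // 0 < p.1}

variable {F}

theorem csp_subset_irr (n : ℕ) : Csp F n ⊆ Irr (GL (Fin n) F) := by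
  rintro χ ⟨V, i1, i2, i3, ρ, hρ, rfl⟩
  exact ⟨V, i1, i2, i3, ρ, hρ.1, rfl⟩

theorem Cpt.cu (p : Cpt F) : Cu (zext (p.1.2 : GL (Fin p.1.1) F → ℂ)) := by
  obtain ⟨⟨n, χ, V, i1, i2, i3, ρ, hρ, rfl⟩, hn⟩ := p
  exact cu_zext hn hρ

theorem Cpt.wh_eq {ψ : AddChar F ℂ} (hψ : ψ ≠ 1) (p : Cpt F) :
    wh ψ (zext (p.1.2 : GL (Fin p.1.1) F → ℂ)) = 1 := by
  obtain ⟨⟨n, χ, V, i1, i2, i3, ρ, hρ, rfl⟩, hn⟩ := p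
  exact wh_cuspidal hψ hρ hn

theorem Cpt.bd_eq_zero {p q : Cpt F} (h : p ≠ q) :
    bd (zext (p.1.2 : GL (Fin p.1.1) F → ℂ)) (zext (q.1.2 : GL (Fin q.1.1) F → ℂ)) = 0 := by
  obtain ⟨⟨n, χ⟩, hn⟩ := p
  obtain ⟨⟨m, χ'⟩, hm⟩ := q
  by_cases hnm : m = n
  · subst hnm
    have hne : (χ : GL (Fin m) F → ℂ) ≠ χ' := fun h' => h (by rw [Subtype.ext h'])
    rw [bd_same, bf_zext (irr_class (csp_subset_irr _ χ.2)), cip_irr (csp_subset_irr _ χ.2)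
      (csp_subset_irr _ χ'.2), if_neg hne]
  · exact bd_ne hnm _ _

/-- The family of functions concentrated at a single irreducible character. -/
noncomputable def fam (x : Pt F) : Fam F := Pi.single x.1 (zext (x.2 : GL (Fin x.1) F → ℂ))

theorem fam_self (n : ℕ) (χ : Irr (GL (Fin n) F)) :
    fam ⟨n, χ⟩ n = zext (χ : GL (Fin n) F → ℂ) := Pi.single_eq_same _ _

theorem fam_of_ne {x : Pt F} {n : ℕ} (h : n ≠ x.1) : fam x n = 0 := Pi.single_eq_of_ne h _

theorem fam_isCl (x : Pt F) : FCl (fam x) := by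
  intro n
  by_cases h : n = x.1
  · subst h
    rw [fam_self]
    exact zext_isCl (irr_class x.2.2)
  · rw [fam_of_ne h]
    exact isCl_zero

/-- The coefficient of an irreducible character in a family of functions. -/
noncomputable def co (f : Fam F) (x : Pt F) : ℂ := bf (f x.1) (zext (x.2 : GL (Fin x.1) F → ℂ))

/-- Multiplication by a cuspidal character. -/
noncomputable def Tp (p : Cpt F) (f : Fam F) : Fam F :=
  T p.1.1 (zext (p.1.2 : GL (Fin p.1.1) F → ℂ)) f

/-- The adjoint of multiplication by a cuspidal character. -/
noncomputable def Dp (p : Cpt F) (f : Fam F) : Fam F :=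
  D p.1.1 (zext (p.1.2 : GL (Fin p.1.1) F → ℂ)) f

theorem fcl_Tp (p : Cpt F) {f : Fam F} (hf : FCl f) : FCl (Tp p f) := FCl.T p.cu.isCl hf

theorem fcl_Dp (p : Cpt F) {f : Fam F} (hf : FCl f) : FCl (Dp p f) := FCl.D hf

theorem bf_zero_left {n : ℕ} (g : Matrix (Fin n) (Fin n) F → ℂ) : bf 0 g = 0 := by
  have := bf_smul_left (0 : ℂ) 0 g
  rwa [zero_smul, zero_mul] at this

theorem bf_sum_left {n : ℕ} {ι : Type} (s : Finset ι) (c : ι → ℂ)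
    (f : ι → Matrix (Fin n) (Fin n) F → ℂ) (g : Matrix (Fin n) (Fin n) F → ℂ) :
    bf (∑ i ∈ s, c i • f i) g = ∑ i ∈ s, c i * bf (f i) g := by
  classical
  induction s using Finset.induction_on with
  | empty =>
    rw [Finset.sum_empty, Finset.sum_empty, bf_zero_left]
  | insert a s ha ih => rw [Finset.sum_insert ha, Finset.sum_insert ha, bf_add_left, bf_smul_left, ih]

theorem fam_expansion {f : Fam F} (hf : FCl f) (n : ℕ) :
    f n = ∑ χ : Irr (GL (Fin n) F), co f ⟨n, χ⟩ • zext (χ : GL (Fin n) F → ℂ) := by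
  conv_lhs => rw [← zext_comp_coe (hf n),
    expansion (fun x : GL (Fin n) F => f n x) (IsCl.class (hf n)), zext_sum]
  refine Finset.sum_congr rfl fun χ _ => ?_
  rw [co, bf_eq_cip (hf n)]
  simp only [zext_coe]

theorem bf_eq_sum_co {f : Fam F} (hf : FCl f) (n : ℕ) (g : Matrix (Fin n) (Fin n) F → ℂ) :
    bf (f n) g = ∑ χ : Irr (GL (Fin n) F), co f ⟨n, χ⟩ * bf (zext (χ : GL (Fin n) F → ℂ)) g := by
  conv_lhs => rw [fam_expansion hf n, bf_sum_left]

theorem bf_eq_sum_co_co {f g : Fam F} (hf : FCl f) (hg : FCl g) (n : ℕ) :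
    bf (f n) (g n) = ∑ χ : Irr (GL (Fin n) F), co f ⟨n, χ⟩ * co g ⟨n, χ⟩ := by
  rw [bf_eq_sum_co hf]
  refine Finset.sum_congr rfl fun χ _ => ?_
  rw [co, co, bf_comm (hg n) (zext_isCl (irr_class χ.2))]

/-- Multiplicities of the multiplication by a cuspidal character. -/
noncomputable def Nm (p : Cpt F) (x y : Pt F) : ℂ := co (Tp p (fam x)) y

theorem co_Tp (p : Cpt F) {f : Fam F} (hf : FCl f) (k : ℕ)
    (χ : Irr (GL (Fin (p.1.1 + k)) F)) : co (Tp p f) ⟨p.1.1 + k, χ⟩ =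
      ∑ τ : Irr (GL (Fin k) F), co f ⟨k, τ⟩ * Nm p ⟨k, τ⟩ ⟨p.1.1 + k, χ⟩ := by
  have key : ∀ f : Fam F, co (Tp p f) ⟨p.1.1 + k, χ⟩ =
      bf (f k) (Dp p (fam ⟨p.1.1 + k, χ⟩) k) := by
    intro f
    have := bf_T_D (f := f) p.cu.isCl (fam_isCl ⟨p.1.1 + k, χ⟩) k
    rw [fam_self] at this
    exact this
  rw [key, bf_eq_sum_co hf]
  refine Finset.sum_congr rfl fun τ _ => ?_
  rw [Nm, key, fam_self]

theorem co_Dp (p : Cpt F) {k : ℕ} (χ : Irr (GL (Fin (p.1.1 + k)) F)) (τ : Irr (GL (Fin k) F)) :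
    co (Dp p (fam ⟨p.1.1 + k, χ⟩)) ⟨k, τ⟩ = Nm p ⟨k, τ⟩ ⟨p.1.1 + k, χ⟩ := by
  have := bf_T_D (f := fam ⟨k, τ⟩) p.cu.isCl (fam_isCl ⟨p.1.1 + k, χ⟩) k
  rw [fam_self, fam_self] at this
  rw [co, bf_comm (fcl_Dp p (fam_isCl _) k) (zext_isCl (irr_class τ.2))]
  exact this.symm

theorem Nm_eq_cip (p : Cpt F) {k : ℕ} (τ : Irr (GL (Fin k) F))
    (χ : Irr (GL (Fin (p.1.1 + k)) F)) : Nm p ⟨k, τ⟩ ⟨p.1.1 + k, χ⟩ =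
      cip (fun c : GL (Fin k) F => Ef finSumFinEquiv (st (zext (p.1.2 : GL (Fin p.1.1) F → ℂ)))
        (zext (χ : GL (Fin (p.1.1 + k)) F → ℂ)) (c : Matrix (Fin k) (Fin k) F)) τ := by
  rw [← co_Dp, co, bf_eq_cip (fcl_Dp p (fam_isCl _) k)]
  simp only [zext_coe, Dp, D, fam_self]

theorem Nm_deg {p : Cpt F} {x y : Pt F} (h : Nm p x y ≠ 0) : y.1 = p.1.1 + x.1 := by
  by_contra hne
  apply h
  obtain ⟨n, χ⟩ := y
  by_cases hlt : n < p.1.1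
  · rw [Nm, co, Tp, T_of_lt hlt, bf_zero_left]
  · obtain ⟨m, rfl⟩ := Nat.exists_eq_add_of_le (not_lt.1 hlt)
    have hm : m ≠ x.1 := fun h' => hne (congrArg (p.1.1 + ·) h')
    rw [Nm, co_Tp p (fam_isCl _)]
    refine Finset.sum_eq_zero fun σ _ => ?_
    rw [co, fam_of_ne hm, bf_zero_left, zero_mul]

theorem Nm_nat (p : Cpt F) (x y : Pt F) : ∃ N : ℕ, Nm p x y = N := by
  by_cases h : Nm p x y = 0
  · exact ⟨0, by rw [h, Nat.cast_zero]⟩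
  · have hd := Nm_deg h
    obtain ⟨k, τ⟩ := x
    obtain ⟨n, χ⟩ := y
    obtain rfl : n = p.1.1 + k := hd
    rw [Nm_eq_cip]
    obtain ⟨⟨d, χ', V, i1, i2, i3, ρ, hρ, rfl⟩, hd⟩ := p
    obtain ⟨χ, W, j1, j2, j3, π, hπ, rfl⟩ := χ
    exact cip_repChar_nat (jac_mem_repChar _ ρ π) (irr_subset_repChar τ.2)

end Multiplication

section Generic

variable {F : Type} [Field F] [Fintype F] {ψ : AddChar F ℂ}

theorem exists_of_co_Tp {p : Cpt F} {f : Fam F} (hf : FCl f) {y : Pt F} (h : co (Tp p f) y ≠ 0) :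
    ∃ τ : Pt F, co f τ ≠ 0 ∧ Nm p τ y ≠ 0 := by
  obtain ⟨n, χ⟩ := y
  by_cases hlt : n < p.1.1
  · refine absurd ?_ h
    rw [co, Tp, T_of_lt hlt, bf_zero_left]
  · obtain ⟨m, rfl⟩ := Nat.exists_eq_add_of_le (not_lt.1 hlt)
    rw [co_Tp p hf] at h
    obtain ⟨τ, -, hτ⟩ := Finset.exists_ne_zero_of_sum_ne_zero h
    exact ⟨⟨m, τ⟩, left_ne_zero_of_mul hτ, right_ne_zero_of_mul hτ⟩

theorem sum_nat_ne_zero {ι : Type} [Fintype ι] {f : ι → ℂ} (hf : ∀ i, ∃ N : ℕ, f i = N) {i : ι}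
    (hi : f i ≠ 0) : ∑ i, f i ≠ 0 := by
  choose N hN using hf
  simp only [hN] at hi ⊢
  rw [← Nat.cast_sum, Nat.cast_ne_zero]
  exact fun h => hi (by rw [Finset.sum_eq_zero_iff.1 h i (Finset.mem_univ i), Nat.cast_zero])

theorem mul_nat {a b : ℂ} (ha : ∃ N : ℕ, a = N) (hb : ∃ N : ℕ, b = N) : ∃ N : ℕ, a * b = N := by
  obtain ⟨M, rfl⟩ := ha
  obtain ⟨N, rfl⟩ := hb
  exact ⟨M * N, (Nat.cast_mul M N).symm⟩

theorem co_Tp_ne_zero {p : Cpt F} {f : Fam F} (hf : FCl f) (hN : ∀ τ, ∃ N : ℕ, co f τ = N)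
    {τ y : Pt F} (h : co f τ ≠ 0) (h' : Nm p τ y ≠ 0) : co (Tp p f) y ≠ 0 := by
  have hd := Nm_deg h'
  obtain ⟨k, τ⟩ := τ
  obtain ⟨n, χ⟩ := y
  obtain rfl : n = p.1.1 + k := hd
  rw [co_Tp p hf]
  exact sum_nat_ne_zero (fun σ => mul_nat (hN _) (Nm_nat _ _ _)) (mul_ne_zero h h')

/-- The value of the Whittaker functional at an irreducible character. -/
noncomputable def whp (ψ : AddChar F ℂ) (x : Pt F) : ℂ := wh ψ (zext (x.2 : GL (Fin x.1) F → ℂ))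

theorem whp_nat (ψ : AddChar F ℂ) (x : Pt F) : ∃ N : ℕ, whp ψ x = N :=
  wh_nat ψ (irr_subset_repChar x.2.2)

theorem sum_Nm_mul_whp (hψ : ψ ≠ 1) (p : Cpt F) (x : Pt F) :
    ∑ χ : Irr (GL (Fin (p.1.1 + x.1)) F), Nm p x ⟨p.1.1 + x.1, χ⟩ * whp ψ ⟨p.1.1 + x.1, χ⟩ =
      whp ψ x := by
  have h := wh_T hψ p.cu.isCl (fam_isCl x) (add_comm p.1.1 x.1)
  rw [p.wh_eq hψ, one_mul] at h
  change wh ψ (Tp p (fam x) (p.1.1 + x.1)) = _ at h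
  rw [fam_expansion (fcl_Tp p (fam_isCl x)), wh_sum] at h
  refine Eq.trans ?_ (h.trans ?_)
  · rfl
  · exact congrArg (wh ψ) (fam_self x.1 x.2)

theorem whp_ne_zero_of_Nm (hψ : ψ ≠ 1) {p : Cpt F} {x y : Pt F} (h : Nm p x y ≠ 0)
    (hy : whp ψ y ≠ 0) : whp ψ x ≠ 0 := by
  have hd := Nm_deg h
  obtain ⟨n, χ⟩ := y
  obtain rfl : n = p.1.1 + x.1 := hd
  rw [← sum_Nm_mul_whp hψ p x]
  exact sum_nat_ne_zero (fun σ => mul_nat (Nm_nat _ _ _) (whp_nat _ _)) (mul_ne_zero h hy)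

theorem exists_product (hψ : ψ ≠ 1) (p : Cpt F) {x : Pt F} (hx : whp ψ x ≠ 0) :
    ∃ y : Pt F, whp ψ y ≠ 0 ∧ Nm p x y ≠ 0 ∧
      ∀ z : Pt F, whp ψ z ≠ 0 → Nm p x z ≠ 0 → z = y := by
  have h := sum_Nm_mul_whp hψ p x
  have h1 : whp ψ x = 1 := wh_eq_one hψ ⟨x.2.2, hx⟩
  obtain ⟨χ, -, hχ⟩ := Finset.exists_ne_zero_of_sum_ne_zero (h.trans_ne hx)
  refine ⟨⟨_, χ⟩, right_ne_zero_of_mul hχ, left_ne_zero_of_mul hχ, fun z hz hzN => ?_⟩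
  have hd := Nm_deg hzN
  obtain ⟨n, χ'⟩ := z
  obtain rfl : n = p.1.1 + x.1 := hd
  by_contra hne
  have hne' : χ' ≠ χ := fun h' => hne (by rw [h'])
  rw [h1] at h
  choose N hN using fun σ : Irr (GL (Fin (p.1.1 + x.1)) F) =>
    mul_nat (Nm_nat p x ⟨p.1.1 + x.1, σ⟩) (whp_nat ψ ⟨p.1.1 + x.1, σ⟩)
  have hχ' := mul_ne_zero hzN hz
  rw [hN, Nat.cast_ne_zero] at hχ hχ'
  simp only [hN] at h
  rw [← Nat.cast_sum, Nat.cast_eq_one] at h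
  classical
  have h2 := Finset.sum_le_univ_sum_of_nonneg (s := {χ', χ}) (f := N) fun _ => Nat.zero_le _
  rw [Finset.sum_pair hne', h] at h2
  omega

/-- The generic irreducible characters of all general linear groups. -/
abbrev GPt (ψ : AddChar F ℂ) := {x : Pt F // whp ψ x ≠ 0}

/-- The unique generic constituent of the product with a cuspidal character. -/
noncomputable def mulG (hψ : ψ ≠ 1) (p : Cpt F) (x : GPt ψ) : GPt ψ :=
  ⟨(exists_product hψ p x.2).choose, (exists_product hψ p x.2).choose_spec.1⟩

theorem Nm_mulG (hψ : ψ ≠ 1) (p : Cpt F) (x : GPt ψ) : Nm p x.1 (mulG hψ p x).1 ≠ 0 :=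
  (exists_product hψ p x.2).choose_spec.2.1

theorem mulG_unique (hψ : ψ ≠ 1) {p : Cpt F} {x y : GPt ψ} (h : Nm p x.1 y.1 ≠ 0) :
    y = mulG hψ p x :=
  Subtype.ext ((exists_product hψ p x.2).choose_spec.2.2 y.1 y.2 h)

theorem exists_of_Nm (hψ : ψ ≠ 1) {p : Cpt F} {x : Pt F} {y : GPt ψ} (h : Nm p x y.1 ≠ 0) :
    ∃ x' : GPt ψ, x'.1 = x ∧ y = mulG hψ p x' :=
  ⟨⟨x, whp_ne_zero_of_Nm hψ h y.2⟩, rfl, mulG_unique hψ h⟩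

theorem bf_fam_of_ne {x y : Pt F} (h : x ≠ y) : bf (fam x y.1) (fam y y.1) = 0 := by
  obtain ⟨n, χ⟩ := x
  obtain ⟨m, χ'⟩ := y
  by_cases hnm : m = n
  · subst hnm
    have hne : (χ : GL (Fin m) F → ℂ) ≠ χ' := fun h' => h (by rw [Subtype.ext h'])
    rw [fam_self, fam_self, bf_zext (irr_class χ.2), cip_irr χ.2 χ'.2, if_neg hne]
  · rw [fam_of_ne hnm, bf_zero_left]

theorem mulG_exchange (hψ : ψ ≠ 1) {p q : Cpt F} {x y : GPt ψ} (h : mulG hψ p x = mulG hψ q y)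
    (hne : p ≠ q ∨ x ≠ y) : ∃ z, x = mulG hψ q z ∧ y = mulG hψ p z := by
  have hp := Nm_mulG hψ p x
  have hq := Nm_mulG hψ q y
  rw [← h] at hq
  set z := mulG hψ p x with hz
  have hpd := Nm_deg hp
  have hqd := Nm_deg hq
  have h1 : bf (Tp p (fam x.1) z.1.1) (Tp q (fam y.1) z.1.1) ≠ 0 := by
    rw [bf_eq_sum_co_co (fcl_Tp p (fam_isCl _)) (fcl_Tp q (fam_isCl _))]
    exact sum_nat_ne_zero (i := z.1.2) (fun σ => mul_nat (Nm_nat _ _ _) (Nm_nat _ _ _))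
      (mul_ne_zero hp hq)
  rw [hqd, Tp, Tp, bf_T_T p.cu q.cu (fam_isCl _) (fam_isCl _)] at h1
  have h2 : bd (zext (p.1.2 : GL (Fin p.1.1) F → ℂ)) (zext (q.1.2 : GL (Fin q.1.1) F → ℂ)) *
      bf (fam x.1 y.1.1) (fam y.1 y.1.1) = 0 := by
    rcases hne with hne | hne
    · rw [Cpt.bd_eq_zero hne, zero_mul]
    · rw [bf_fam_of_ne fun h' => hne (Subtype.ext h'), mul_zero]
  rw [h2, zero_add] at h1
  have h3 : co (Tp p (Dp q (fam x.1))) y.1 ≠ 0 := by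
    have := fam_self y.1.1 y.1.2
    rw [co, ← this]
    exact h1
  obtain ⟨τ, hτ, hτy⟩ := exists_of_co_Tp (fcl_Dp q (fam_isCl _)) h3
  obtain ⟨w, rfl, hw⟩ := exists_of_Nm hψ hτy
  refine ⟨w, mulG_unique hψ ?_, hw⟩
  have hwd := Nm_deg hτy
  have hxd : x.1.1 = q.1.1 + w.1.1 := by omega
  obtain ⟨⟨n, χ⟩, hx⟩ := x
  obtain rfl : n = q.1.1 + w.1.1 := hxd
  rwa [← co_Dp]

theorem mulG_comm (hψ : ψ ≠ 1) (p q : Cpt F) (x : GPt ψ) :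
    mulG hψ p (mulG hψ q x) = mulG hψ q (mulG hψ p x) := by
  have h1 := Nm_mulG hψ q x
  have h2 := Nm_mulG hψ p (mulG hψ q x)
  have h3 := co_Tp_ne_zero (fcl_Tp q (fam_isCl x.1)) (Nm_nat q x.1) h1 h2
  have h4 : Tp p (Tp q (fam x.1)) = Tp q (Tp p (fam x.1)) := T_comm p.cu q.cu (fam_isCl x.1)
  rw [h4] at h3
  obtain ⟨τ, hτ, hτ'⟩ := exists_of_co_Tp (fcl_Tp p (fam_isCl x.1)) h3
  obtain ⟨w, rfl, hw⟩ := exists_of_Nm hψ hτ'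
  rw [hw, mulG_unique hψ hτ]

theorem exists_mulG (hψ : ψ ≠ 1) (x : GPt ψ) (hx : x.1.1 ≠ 0) : ∃ p y, mulG hψ p y = x := by
  suffices ∃ (p : Cpt F) (τ : Pt F), Nm p τ x.1 ≠ 0 by
    obtain ⟨p, τ, h⟩ := this
    obtain ⟨w, -, hw⟩ := exists_of_Nm hψ h
    exact ⟨p, w, hw.symm⟩
  obtain ⟨⟨n, χ, W, j1, j2, j3, π, hπ, rfl⟩, hg⟩ := x
  have hn : 0 < n := Nat.pos_of_ne_zero hx
  clear hx
  have hex : ∃ d, 0 < d ∧ fixSub π d ≠ ⊥ := ⟨n, hn, by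
    rw [fixSub_self]
    exact hπ.1.symm⟩
  classical
  have hle : Nat.find hex ≤ n := Nat.find_min' hex ⟨hn, by
    rw [fixSub_self]
    exact hπ.1.symm⟩
  obtain ⟨hd, hne⟩ := Nat.find_spec hex
  have hmin : ∀ s, 0 < s → s < Nat.find hex → fixSub π s = ⊥ := fun s hs hlt => by
    by_contra hcon
    exact Nat.find_min hex hlt ⟨hs, hcon⟩
  generalize Nat.find hex = d at hle hd hne hmin
  obtain ⟨k, rfl⟩ := Nat.exists_eq_add_of_le hle
  obtain ⟨V, i1, i2, i3, ρ, hρ, τ, hτ, h⟩ := exists_support_aux π hne hmin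
  refine ⟨⟨⟨d, ρ.character, V, i1, i2, i3, ρ, hρ, rfl⟩, hd⟩, ⟨k, τ, hτ⟩, ?_⟩
  rw [Nm_eq_cip]
  exact h

end Generic

section Counting

variable {F : Type} [Field F] [Fintype F] {ψ : AddChar F ℂ}

/-- The action of cuspidal characters on generic characters. -/
noncomputable def genAction (hψ : ψ ≠ 1) : FreeAction (GPt ψ) (Cpt F) where
  deg x := x.1.1
  wt p := p.1.1
  act p x := mulG hψ p x
  wt_pos p := p.2
  deg_act p x := Nm_deg (Nm_mulG hψ p x)
  inj p x y h := by
    by_contra hne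
    obtain ⟨z, hx, hy⟩ := mulG_exchange hψ h (Or.inr hne)
    exact hne (hx.trans hy.symm)
  comm := mulG_comm hψ
  exch p q x y hne h := mulG_exchange hψ h (Or.inl hne)
  gen := exists_mulG hψ

end Counting

section Classes

variable {F : Type} [Field F] [Fintype F] {ψ : AddChar F ℂ}

theorem card_gPt (hψ : ψ ≠ 1) (n : ℕ) :
    Nat.card {x : GPt ψ // (genAction hψ).deg x = n} = Nat.card (Gen (F := F) ψ n) := by
  refine Nat.card_congr ⟨fun x => ⟨x.2 ▸ x.1.1.2.1, ?_⟩, fun χ => ⟨⟨⟨n, χ.1, χ.2.1⟩, χ.2.2⟩, rfl⟩,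
    fun x => ?_, fun χ => rfl⟩
  · obtain ⟨⟨⟨m, χ⟩, hx⟩, rfl⟩ := x
    exact ⟨χ.2, hx⟩
  · obtain ⟨⟨⟨m, χ⟩, hx⟩, rfl⟩ := x
    rfl

theorem card_cPt (hψ : ψ ≠ 1) {n : ℕ} (hn : 0 < n) :
    Nat.card {p : Cpt F // (genAction hψ).wt p = n} = Nat.card (Csp F n) := by
  refine Nat.card_congr ⟨fun p => p.2 ▸ p.1.1.2, fun χ => ⟨⟨⟨n, χ⟩, hn⟩, rfl⟩,
    fun x => ?_, fun χ => rfl⟩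
  obtain ⟨⟨⟨m, χ⟩, hx⟩, rfl⟩ := x
  rfl

theorem exists_addChar_ne_one (F : Type) [Field F] [Fintype F] : ∃ ψ : AddChar F ℂ, ψ ≠ 1 :=
  ⟨AddChar.FiniteField.primitiveChar_to_Complex F, by
    have h := AddChar.FiniteField.primitiveChar_to_Complex_isPrimitive F (a := 1) one_ne_zero
    rwa [AddChar.mulShift_one] at h⟩

theorem card_csp {n : ℕ} (hn : 0 < n) :
    (Nat.card (Csp F n) : ℚ) = (1 / (n : ℚ)) * ∑ d ∈ n.divisors,
      ((ArithmeticFunction.moebius d : ℤ) : ℚ) * ((Fintype.card F : ℚ) ^ (n / d) - 1) := by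
  obtain ⟨ψ, hψ⟩ := exists_addChar_ne_one F
  rw [← card_cPt hψ hn]
  refine (genAction hψ).card_wt (Fintype.card F) Fintype.one_lt_card ?_ (fun m => ?_) n hn
  · rw [card_gPt, card_Gen hψ, finrank_Bi_zero]
  · rw [card_gPt, card_Gen hψ, finrank_Bi hψ]

theorem nonempty_iso_iff {n : ℕ} {V W : FDRep ℂ (GL (Fin n) F)} (hV : IsCuspidal V.ρ)
    (hW : IsCuspidal W.ρ) : Nonempty (V ≅ W) ↔
      Representation.character V.ρ = Representation.character W.ρ := by
  constructor
  · rintro ⟨i⟩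
    funext g
    rw [Representation.character, Representation.character, FDRep.Iso.conj_ρ i,
      LinearMap.trace_conj']
  · intro h
    obtain ⟨e⟩ := nonempty_equiv_of_character_eq hV.1 hW.1 h
    exact ⟨(forget₂ (FDRep ℂ (GL (Fin n) F)) (Rep ℂ (GL (Fin n) F))).preimageIso (Rep.mkIso e)⟩

theorem card_quotient (F : Type) [Field F] [Fintype F] (n : ℕ) :
    Nat.card (Quotient (cuspidalSetoid F n)) = Nat.card (Csp F n) := by
  refine Nat.card_congr (Equiv.ofBijective (Quotient.lift (fun V => ⟨Representation.character V.1.ρ,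
    V.1, inferInstance, inferInstance, inferInstance, V.1.ρ, V.2, rfl⟩) fun V W h =>
      Subtype.ext ((nonempty_iso_iff V.2 W.2).1 h)) ⟨?_, ?_⟩)
  · intro x y
    refine Quotient.inductionOn₂ x y fun V W h => Quotient.sound ?_
    exact (nonempty_iso_iff V.2 W.2).2 (congrArg Subtype.val h)
  · rintro ⟨χ, V, i1, i2, i3, ρ, hρ, rfl⟩
    exact ⟨Quotient.mk _ ⟨FDRep.of ρ, hρ⟩, rfl⟩

end Classes

end GLCuspidal

/-- Let `𝔽` be a finite field with `q` elements and `n ≥ 1`. The number of isomorphism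
classes of cuspidal representations of `GL_n(𝔽)` equals
`(1/n) * ∑_{d ∣ n} μ(d) (q^{n/d} - 1)`, reflecting Green's parametrization of cuspidal
representations by regular characters of `F_{q^n}^×` up to Galois action. -/
theorem card_cuspidal_GL (𝔽 : Type) [Field 𝔽] [Fintype 𝔽] (q n : ℕ)
    (hq : Fintype.card 𝔽 = q) (hn : 1 ≤ n) :
    (Nat.card (Quotient (cuspidalSetoid 𝔽 n)) : ℚ) =
      (1 / (n : ℚ)) *
        ∑ d ∈ n.divisors, ((ArithmeticFunction.moebius d : ℤ) : ℚ) * ((q : ℚ) ^ (n / d) - 1) := by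
  subst hq
  rw [GLCuspidal.card_quotient]
  exact GLCuspidal.card_csp hn
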